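/- There exists a constant C > 0, depending only on Ω, such that for every λ > 0 and every Neumann eigenfunction φ of Ω with eigenvalue λ², the set of connected components K of the nodal set N = {x ∈ Ω : φ(x) = 0} whose closure intersects ∂Ω (i.e. the set {K : ∃ x ∈ N, K = connectedComponentIn N x and closure K ∩ ∂Ω ≠ ∅}) is finite and has cardinality at most C·λ. -/

import Mathlib

open MeasureTheory Real
open scoped RealInnerProductSpace

noncomputable section

abbrev E2 : Type := EuclideanSpace ℝ (Fin 2)

/-- The Euclidean Laplacian `∂²/∂x₁² + ∂²/∂x₂²` on `ℝ²`. -/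
def lap (φ : E2 → ℝ) (x : E2) : ℝ :=
  ∑ i : Fin 2,
    fderiv ℝ (fun y => fderiv ℝ φ y (EuclideanSpace.single i 1)) x (EuclideanSpace.single i 1)

/-- A bounded open connected planar domain. -/
structure IsPlaneDomain (Ω : Set E2) : Prop where
  isOpen : IsOpen Ω
  isBounded : Bornology.IsBounded Ω
  isConnected : IsConnected Ω

/-- An arc-length parametrization `q` of the boundary of `Ω` (periodic with period `len`,
injective on `[0, len)`, unit speed, image equal to the frontier of `Ω`), together with the
unit normal `ν` along the boundary, pointing into `Ω`. -/
structure BoundaryParam (Ω : Set E2) where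
  len : ℝ
  len_pos : 0 < len
  q : ℝ → E2
  qd : ℝ → E2
  hasDerivAt : ∀ s, HasDerivAt q (qd s) s
  periodic : Function.Periodic q len
  injOn : Set.InjOn q (Set.Ico 0 len)
  unitSpeed : ∀ s, ‖qd s‖ = 1
  range_eq : Set.range q = frontier Ω
  ν : ℝ → E2
  ν_unit : ∀ s, ‖ν s‖ = 1
  ν_orth : ∀ s, ⟪ν s, qd s⟫ = 0
  ν_inward : ∀ s, ∃ δ > 0, ∀ t ∈ Set.Ioo (0 : ℝ) δ, q s + t • ν s ∈ Ω

/-- The boundary parametrization is real-analytic. -/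
def BoundaryParam.IsAnalytic {Ω : Set E2} (B : BoundaryParam Ω) : Prop :=
  AnalyticOnNhd ℝ B.q Set.univ

/-- `φ` is a Neumann eigenfunction of `Ω` with eigenvalue `lam²`: it is real-analytic on an
open neighborhood of the closure of `Ω`, not identically zero on `Ω`, satisfies
`Δφ = -lam² φ` on `Ω` and has vanishing normal derivative along the boundary. -/
structure IsNeumannEigenfunction {Ω : Set E2} (B : BoundaryParam Ω) (lam : ℝ)
    (φ : E2 → ℝ) : Prop where
  analytic : ∃ U : Set E2, IsOpen U ∧ closure Ω ⊆ U ∧ AnalyticOnNhd ℝ φ U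
  nontrivial : ∃ x ∈ Ω, φ x ≠ 0
  eigen : ∀ x ∈ Ω, lap φ x = -lam ^ 2 * φ x
  neumann : ∀ s : ℝ, ⟪gradient φ (B.q s), B.ν s⟫ = 0

open Set Filter Topology in
/-- The Taylor series of a real function `f` at the real point `a`, evaluated at a complex point. -/
def complexTaylor (f : ℝ → ℝ) (a : ℝ) (z : ℂ) : ℂ :=
  ∑' n : ℕ, ((iteratedDeriv n f a / n.factorial : ℝ) : ℂ) * (z - a) ^ n

section ComplexTaylor
open Set Filter Topology

variable {f : ℝ → ℝ} {C r : ℝ}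

lemma norm_complexTaylor_term_le (hr : 0 < r)
    {a : ℝ} (hb : ∀ n, |iteratedDeriv n f a| ≤ C * n.factorial / r ^ n) {z : ℂ} {r' : ℝ}
    (hz : ‖z - a‖ ≤ r') (n : ℕ) :
    ‖((iteratedDeriv n f a / n.factorial : ℝ) : ℂ) * (z - a) ^ n‖ ≤ C * (r' / r) ^ n := by
  have hC : 0 ≤ C := by simpa using (abs_nonneg _).trans (hb 0)
  rw [norm_mul, norm_pow, Complex.norm_real, Real.norm_eq_abs, abs_div, Nat.abs_cast, div_pow]
  have hn : (0 : ℝ) < n.factorial := by positivity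
  have h1 : |iteratedDeriv n f a| / n.factorial ≤ C / r ^ n := by
    rw [div_le_iff₀ hn]
    calc _ ≤ _ := hb n
      _ = _ := by ring
  calc _ ≤ (C / r ^ n) * r' ^ n := by gcongr
    _ = _ := by ring

lemma differentiableOn_complexTaylor (hr : 0 < r)
    {a : ℝ} (hb : ∀ n, |iteratedDeriv n f a| ≤ C * n.factorial / r ^ n) :
    DifferentiableOn ℂ (complexTaylor f a) (Metric.ball (a : ℂ) r) := by
  intro z hz
  rw [Metric.mem_ball, dist_eq_norm] at hz
  obtain ⟨r', h1, h2⟩ := exists_between hz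
  have h0 : 0 ≤ r' := (norm_nonneg _).trans h1.le
  have : DifferentiableOn ℂ (complexTaylor f a) (Metric.ball (a : ℂ) r') := by
    refine Complex.differentiableOn_tsum_of_summable_norm (u := fun n => C * (r' / r) ^ n)
      ((summable_geometric_of_lt_one (by positivity) (by rw [div_lt_one hr]; exact h2)).mul_left C)
      (fun n => by fun_prop) Metric.isOpen_ball (fun n w hw => ?_)
    rw [Metric.mem_ball, dist_eq_norm] at hw
    exact norm_complexTaylor_term_le hr hb hw.le n
  exact (this.differentiableAt (Metric.isOpen_ball.mem_nhds
    (by rw [Metric.mem_ball, dist_eq_norm]; exact h1))).differentiableWithinAt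

lemma norm_complexTaylor_le (hr : 0 < r)
    {a : ℝ} (hb : ∀ n, |iteratedDeriv n f a| ≤ C * n.factorial / r ^ n) {z : ℂ}
    (hz : ‖z - a‖ ≤ r / 2) : ‖complexTaylor f a z‖ ≤ 2 * C := by
  have h := norm_complexTaylor_term_le hr hb hz
  have e : r / 2 / r = 1 / 2 := by field_simp
  rw [e] at h
  refine tsum_of_norm_bounded (f := fun n =>
    ((iteratedDeriv n f a / n.factorial : ℝ) : ℂ) * (z - a) ^ n) ?_ h
  rw [mul_comm]
  exact hasSum_geometric_two.mul_left C

lemma complexTaylor_eventuallyEq (hf : AnalyticAt ℝ f r) :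
    ∀ᶠ t : ℝ in 𝓝 r, complexTaylor f r t = f t := by
  have h := hf.hasFPowerSeriesAt
  rw [hasFPowerSeriesAt_iff'] at h
  filter_upwards [h] with t ht
  have := Complex.hasSum_ofReal.mpr ht
  rw [← this.tsum_eq, complexTaylor]
  congr 1
  ext n
  simp [FormalMultilinearSeries.coeff_ofScalars]
  ring

lemma complexTaylor_eqOn (hr : 0 < r) (hf : AnalyticOnNhd ℝ f univ)
    (hb : ∀ n x, |iteratedDeriv n f x| ≤ C * n.factorial / r ^ n) {a b : ℝ} (hab : |b - a| < r) :
    EqOn (complexTaylor f a) (complexTaylor f b)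
      (Metric.ball (a : ℂ) r ∩ Metric.ball (b : ℂ) r) := by
  have key : ∀ t : ℝ, |t - a| < r → complexTaylor f a t = f t := by
    intro t ht
    have hana : AnalyticOnNhd ℝ (fun s : ℝ => (complexTaylor f a s).re) (Metric.ball a r) := by
      intro s hs
      have h1 : AnalyticAt ℂ (complexTaylor f a) (s : ℂ) :=
        (differentiableOn_complexTaylor hr fun n => hb n a).analyticAt (Metric.isOpen_ball.mem_nhds (by
          simpa [dist_eq_norm, ← Complex.ofReal_sub] using hs))
      exact h1.re_ofReal
    have hE := hana.eqOn_of_preconnected_of_eventuallyEq (g := f) (z₀ := a)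
      (fun s _ => hf s trivial) (convex_ball a r).isPreconnected (by simpa using hr) (by
        filter_upwards [complexTaylor_eventuallyEq (hf a trivial)] with s hs
        simp [hs])
    have h2 : (complexTaylor f a t).im = 0 := by
      rw [complexTaylor]
      have : ∀ n : ℕ, ((iteratedDeriv n f a / n.factorial : ℝ) : ℂ) * ((t : ℂ) - a) ^ n =
          (((iteratedDeriv n f a / n.factorial) * (t - a) ^ n : ℝ) : ℂ) := by
        intro n; push_cast; rfl
      simp_rw [this]
      rw [← Complex.ofReal_tsum, Complex.ofReal_im]
    refine Complex.ext ?_ (by simpa using h2)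
    simpa using hE (by simpa [dist_eq_norm] using ht : t ∈ Metric.ball a r)
  have hbm : (b : ℂ) ∈ Metric.ball (a : ℂ) r ∩ Metric.ball (b : ℂ) r := by
    refine ⟨?_, by simpa using hr⟩
    simpa [dist_eq_norm, ← Complex.ofReal_sub] using hab
  have hop : IsOpen (Metric.ball (a : ℂ) r ∩ Metric.ball (b : ℂ) r) :=
    Metric.isOpen_ball.inter Metric.isOpen_ball
  refine AnalyticOnNhd.eqOn_of_preconnected_of_frequently_eq (z₀ := (b : ℂ))
    (((differentiableOn_complexTaylor hr fun n => hb n a).mono inter_subset_left).analyticOnNhd hop)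
    (((differentiableOn_complexTaylor hr fun n => hb n b).mono inter_subset_right).analyticOnNhd hop)
    ((convex_ball _ _).inter (convex_ball _ _)).isPreconnected hbm ?_
  have h3 : ∀ᶠ t : ℝ in 𝓝 b, complexTaylor f a t = complexTaylor f b t := by
    have : ∀ᶠ t : ℝ in 𝓝 b, |t - a| < r :=
      (by fun_prop : Continuous fun t : ℝ => |t - a|).continuousAt.eventually_lt_const hab
    filter_upwards [complexTaylor_eventuallyEq (hf b trivial), this] with t h1 h2
    rw [key t h2, h1]
  have h4 : ∃ᶠ t : ℝ in 𝓝[≠] b, complexTaylor f a t = complexTaylor f b t :=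
    (h3.filter_mono nhdsWithin_le_nhds).frequently
  have h5 : Tendsto (fun t : ℝ => (t : ℂ)) (𝓝[≠] b) (𝓝[≠] (b : ℂ)) := by
    refine tendsto_nhdsWithin_of_tendsto_nhds_of_eventually_within _
      (Complex.continuous_ofReal.continuousAt.tendsto.mono_left nhdsWithin_le_nhds) ?_
    filter_upwards [self_mem_nhdsWithin] with t ht
    simpa using ht
  exact h5.frequently h4

/-- A real-analytic function on the line with uniformly controlled derivatives extends
holomorphically to a horizontal strip. -/
theorem exists_holomorphic_extension (hr : 0 < r) (hf : AnalyticOnNhd ℝ f univ)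
    (hb : ∀ n x, |iteratedDeriv n f x| ≤ C * n.factorial / r ^ n) :
    ∃ F : ℂ → ℂ, DifferentiableOn ℂ F {z | |z.im| < r} ∧ (∀ x : ℝ, F x = f x) ∧
      ∀ z, |z.im| ≤ r / 2 → ‖F z‖ ≤ 2 * C := by
  have hn : ∀ z : ℂ, z - z.re = z.im * Complex.I := by
    intro z; apply Complex.ext <;> simp
  refine ⟨fun z => complexTaylor f z.re z, ?_, ?_, ?_⟩
  · intro z hz
    have hz : |z.im| < r := hz
    have h1 : DifferentiableAt ℂ (complexTaylor f z.re) z :=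
      (differentiableOn_complexTaylor hr fun n => hb n z.re).differentiableAt
        (Metric.isOpen_ball.mem_nhds (by
          rw [Metric.mem_ball, dist_eq_norm, hn]; simpa using hz))
    refine (h1.congr_of_eventuallyEq ?_).differentiableWithinAt
    have c1 : ∀ᶠ w : ℂ in 𝓝 z, ‖w - z.re‖ < r := by
      refine (by fun_prop : Continuous fun w : ℂ => ‖w - z.re‖).continuousAt.eventually_lt_const ?_
      change ‖z - z.re‖ < r
      rw [hn]; simpa using hz
    have c2 : ∀ᶠ w : ℂ in 𝓝 z, |w.im| < r :=
      (by fun_prop : Continuous fun w : ℂ => |w.im|).continuousAt.eventually_lt_const hz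
    filter_upwards [c1, c2] with w h1 h2
    refine (complexTaylor_eqOn hr hf hb ?_ ⟨?_, ?_⟩).symm
    · have := (Complex.abs_re_le_norm (w - z.re)).trans_lt h1
      simpa using this
    · simpa [dist_eq_norm] using h1
    · rw [Metric.mem_ball, dist_eq_norm, hn]; simpa using h2
  · intro x
    simpa using (complexTaylor_eventuallyEq (hf x trivial)).self_of_nhds
  · intro z hz
    refine norm_complexTaylor_le hr (fun n => hb n _) ?_
    rw [hn]; simpa using hz

end ComplexTaylor

/-- The conformal map from the strip `|Im z| < r` to the unit disc sending the real point `a`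
to `0`. -/
def stripBlaschke (r a : ℝ) (z : ℂ) : ℂ :=
  (Complex.exp (π / (2 * r) * (z - a)) - 1) / (Complex.exp (π / (2 * r) * (z - a)) + 1)

section StripBlaschke
open Set Filter Topology

variable {r R a B : ℝ}

lemma stripBlaschke_arg_im (r a : ℝ) (z : ℂ) :
    ((π / (2 * r) * (z - a) : ℂ)).im = π / (2 * r) * z.im := by
  have : (π / (2 * r) * (z - a) : ℂ) = ((π / (2 * r) : ℝ) : ℂ) * (z - a) := by push_cast; ring
  rw [this, Complex.im_ofReal_mul]; simp

lemma stripBlaschke_arg_re (r a : ℝ) (z : ℂ) :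
    ((π / (2 * r) * (z - a) : ℂ)).re = π / (2 * r) * (z.re - a) := by
  have : (π / (2 * r) * (z - a) : ℂ) = ((π / (2 * r) : ℝ) : ℂ) * (z - a) := by push_cast; ring
  rw [this, Complex.re_ofReal_mul]; simp

lemma Complex.norm_sub_one_sq (w : ℂ) : ‖w - 1‖ ^ 2 = ‖w‖ ^ 2 + 1 - 2 * w.re := by
  rw [← Complex.normSq_eq_norm_sq, ← Complex.normSq_eq_norm_sq, Complex.normSq_apply,
    Complex.normSq_apply]
  simp; ring

lemma Complex.norm_add_one_sq (w : ℂ) : ‖w + 1‖ ^ 2 = ‖w‖ ^ 2 + 1 + 2 * w.re := by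
  rw [← Complex.normSq_eq_norm_sq, ← Complex.normSq_eq_norm_sq, Complex.normSq_apply,
    Complex.normSq_apply]
  simp; ring

lemma stripBlaschke_den_ne_zero (hr : 0 < r) {z : ℂ} (hz : |z.im| < 2 * r) :
    Complex.exp (π / (2 * r) * (z - a)) + 1 ≠ 0 := by
  intro h
  have h1 : Complex.exp (π / (2 * r) * (z - a)) = Complex.exp (π * Complex.I) := by
    rw [Complex.exp_pi_mul_I]; linear_combination h
  obtain ⟨n, hn⟩ := Complex.exp_eq_exp_iff_exists_int.mp h1
  have h2 := congrArg Complex.im hn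
  rw [stripBlaschke_arg_im] at h2
  simp at h2
  have h3 : z.im = 2 * r * (1 + 2 * n) := by
    field_simp at h2
    linarith
  rw [h3, abs_mul, abs_of_pos (by positivity : (0 : ℝ) < 2 * r)] at hz
  have h4 : |(1 + 2 * n : ℝ)| < 1 := by nlinarith
  have h5 : |1 + 2 * n| < 1 := by exact_mod_cast h4
  rw [Int.abs_lt_one_iff] at h5
  omega

lemma stripBlaschke_eq_zero (hr : 0 < r) {z : ℂ} (hz : |z.im| < 2 * r)
    (h : stripBlaschke r a z = 0) : z = a := by
  rw [stripBlaschke, div_eq_zero_iff, or_iff_left (stripBlaschke_den_ne_zero hr hz),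
    sub_eq_zero, Complex.exp_eq_one_iff] at h
  obtain ⟨n, hn⟩ := h
  have h2 := congrArg Complex.im hn
  rw [stripBlaschke_arg_im] at h2
  simp at h2
  have h3 : z.im = 2 * r * (2 * n) := by
    field_simp at h2
    linarith
  rw [h3, abs_mul, abs_of_pos (by positivity : (0 : ℝ) < 2 * r)] at hz
  have h4 : |(2 * n : ℝ)| < 1 := by nlinarith
  have h5 : |2 * n| < 1 := by exact_mod_cast h4
  rw [Int.abs_lt_one_iff] at h5
  have : n = 0 := by omega
  subst this
  have hp : (π / (2 * r) : ℂ) ≠ 0 := by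
    have := hr.ne'
    have := Real.pi_ne_zero
    norm_cast; positivity
  simp only [Int.cast_zero, zero_mul, mul_eq_zero, hp, false_or] at hn
  linear_combination hn

lemma isOpen_strip (R : ℝ) : IsOpen {z : ℂ | |z.im| < R} :=
  isOpen_lt (by fun_prop) continuous_const

lemma convex_strip (R : ℝ) : Convex ℝ {z : ℂ | |z.im| < R} := by
  have : {z : ℂ | |z.im| < R} = Complex.imCLM ⁻¹' (Metric.ball 0 R) := by
    ext; simp
  rw [this]
  exact (convex_ball 0 R).is_linear_preimage Complex.imCLM.isLinear

lemma differentiableOn_stripBlaschke (hr : 0 < r) (hR : R ≤ 2 * r) :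
    DifferentiableOn ℂ (stripBlaschke r a) {z | |z.im| < R} := by
  unfold stripBlaschke
  refine DifferentiableOn.div (by fun_prop) (by fun_prop) (fun z hz => ?_)
  exact stripBlaschke_den_ne_zero hr (lt_of_lt_of_le hz hR)

lemma stripBlaschke_exp_re (r a : ℝ) (z : ℂ) :
    (Complex.exp (π / (2 * r) * (z - a))).re =
      Real.exp (π / (2 * r) * (z.re - a)) * Real.cos (π / (2 * r) * z.im) := by
  rw [Complex.exp_re, stripBlaschke_arg_im, stripBlaschke_arg_re]

lemma norm_stripBlaschke_lt_one (hr : 0 < r) {z : ℂ} (hz : |z.im| < r) :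
    ‖stripBlaschke r a z‖ < 1 := by
  have hd := stripBlaschke_den_ne_zero (a := a) hr (z := z) (by linarith)
  rw [stripBlaschke, norm_div, div_lt_one (norm_pos_iff.mpr hd)]
  refine lt_of_pow_lt_pow_left₀ 2 (norm_nonneg _) ?_
  rw [Complex.norm_sub_one_sq, Complex.norm_add_one_sq]
  have : 0 < (Complex.exp (π / (2 * r) * (z - a))).re := by
    rw [stripBlaschke_exp_re]
    refine mul_pos (Real.exp_pos _) (Real.cos_pos_of_mem_Ioo ?_)
    rw [abs_lt] at hz
    have hp : 0 < π / (2 * r) := by positivity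
    have e : π / (2 * r) * r = π / 2 := by field_simp
    constructor <;> nlinarith
  linarith

lemma norm_stripBlaschke_eq_one (hr : 0 < r) {z : ℂ} (hz : |z.im| = r) :
    ‖stripBlaschke r a z‖ = 1 := by
  have hd := stripBlaschke_den_ne_zero (a := a) hr (z := z) (by linarith)
  rw [stripBlaschke, norm_div, div_eq_one_iff_eq (norm_ne_zero_iff.mpr hd)]
  refine (pow_left_inj₀ (norm_nonneg _) (norm_nonneg _) two_ne_zero).mp ?_
  rw [Complex.norm_sub_one_sq, Complex.norm_add_one_sq]
  have : (Complex.exp (π / (2 * r) * (z - a))).re = 0 := by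
    rw [stripBlaschke_exp_re, mul_eq_zero]
    right
    have e : π / (2 * r) * r = π / 2 := by field_simp
    rcases abs_eq hr.le |>.mp hz with h | h
    · rw [h, e, Real.cos_pi_div_two]
    · rw [h, mul_neg, e, Real.cos_neg, Real.cos_pi_div_two]
  linarith

lemma half_le_norm_stripBlaschke (hr : 0 < r) {z : ℂ} (hz : |z.im| < r)
    (h : 2 ≤ |π / (2 * r) * (z.re - a)|) : 1 / 2 ≤ ‖stripBlaschke r a z‖ := by
  have hd := stripBlaschke_den_ne_zero (a := a) hr (z := z) (by linarith)
  rw [stripBlaschke, norm_div, div_le_div_iff₀ two_pos (norm_pos_iff.mpr hd)]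
  set w := Complex.exp (π / (2 * r) * (z - a)) with hw
  have hn : ‖w‖ = Real.exp (π / (2 * r) * (z.re - a)) := by
    rw [hw, Complex.norm_exp, stripBlaschke_arg_re]
  have e2 : (3 : ℝ) ≤ Real.exp 2 := by
    have := Real.add_one_le_exp (2 : ℝ); linarith
  have h1 : ‖w + 1‖ ≤ ‖w‖ + 1 := by simpa using norm_add_le w 1
  have h2 : ‖w‖ - 1 ≤ ‖w - 1‖ := by simpa using norm_sub_norm_le w 1
  have h3 : 1 - ‖w‖ ≤ ‖w - 1‖ := by
    rw [norm_sub_rev]; simpa using norm_sub_norm_le 1 w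
  rcases le_abs.mp h with h | h
  · have : 3 ≤ ‖w‖ := by rw [hn]; exact e2.trans (Real.exp_le_exp.mpr h)
    linarith
  · have : 3 * ‖w‖ ≤ 1 := by
      rw [hn]
      calc _ ≤ Real.exp 2 * Real.exp (π / (2 * r) * (z.re - a)) := by gcongr
        _ = Real.exp (2 + π / (2 * r) * (z.re - a)) := by rw [Real.exp_add]
        _ ≤ 1 := by rw [Real.exp_le_one_iff]; linarith
    linarith

lemma hasDerivAt_stripBlaschke (r a : ℝ) :
    HasDerivAt (stripBlaschke r a) (π / (2 * r) / 2) (a : ℂ) := by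
  have h1 : HasDerivAt (fun z : ℂ => Complex.exp (π / (2 * r) * (z - a))) (π / (2 * r)) (a : ℂ) := by
    have := (((hasDerivAt_id (a : ℂ)).sub_const (a : ℂ)).const_mul (π / (2 * r) : ℂ)).cexp
    simpa using this
  have h2 := (h1.sub_const 1).div (h1.add_const 1) (by simp)
  have e : stripBlaschke r a = fun z : ℂ => (Complex.exp (π / (2 * r) * (z - a)) - 1) /
      (Complex.exp (π / (2 * r) * (z - a)) + 1) := rfl
  rw [e]
  refine h2.congr_deriv ?_
  simp
  ring

/-- Dividing out a real zero by a Blaschke factor of the strip does not increase the bound. -/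
lemma exists_div_stripBlaschke (hr : 0 < r) (hrR : r < R) (hR : R ≤ 2 * r) {U : ℂ → ℂ}
    (hU : DifferentiableOn ℂ U {z | |z.im| < R}) (hB : ∀ z, |z.im| ≤ r → ‖U z‖ ≤ B)
    (ha : U a = 0) :
    ∃ H : ℂ → ℂ, DifferentiableOn ℂ H {z | |z.im| < R} ∧
      (∀ z, |z.im| < R → U z = stripBlaschke r a z * H z) ∧
      ∀ z, |z.im| ≤ r → ‖H z‖ ≤ B := by
  have hR0 : 0 < R := hr.trans hrR
  have hmem : {z : ℂ | |z.im| < R} ∈ 𝓝 (a : ℂ) := (isOpen_strip R).mem_nhds (by simpa using hR0)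
  have hba : stripBlaschke r a a = 0 := by simp [stripBlaschke]
  have hb1 : ∀ z : ℂ, z ≠ a → dslope (stripBlaschke r a) a z = stripBlaschke r a z / (z - a) := by
    intro z hz
    rw [dslope_of_ne _ hz, slope_def_field, hba, sub_zero]
  have hU1 : ∀ z : ℂ, z ≠ a → dslope U a z = U z / (z - a) := by
    intro z hz
    rw [dslope_of_ne _ hz, slope_def_field, ha, sub_zero]
  have hbne : ∀ z : ℂ, |z.im| < R → dslope (stripBlaschke r a) a z ≠ 0 := by
    intro z hz
    by_cases h : z = a
    · rw [h, dslope_same, (hasDerivAt_stripBlaschke r a).deriv]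
      have := Real.pi_ne_zero
      have h2 := hr.ne'
      norm_cast; positivity
    · rw [hb1 z h]
      refine div_ne_zero (fun h0 => h (stripBlaschke_eq_zero hr (by linarith) h0)) (sub_ne_zero.mpr h)
  set H : ℂ → ℂ := fun z => dslope U a z / dslope (stripBlaschke r a) a z with hH
  have hHd : DifferentiableOn ℂ H {z | |z.im| < R} :=
    ((Complex.differentiableOn_dslope hmem).mpr hU).div
      ((Complex.differentiableOn_dslope hmem).mpr (differentiableOn_stripBlaschke hr hR)) hbne
  have hHU : ∀ z : ℂ, z ≠ a → H z = U z / stripBlaschke r a z := by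
    intro z h
    have := sub_ne_zero.mpr h
    simp only [hH, hb1 z h, hU1 z h]
    rw [div_div_div_cancel_right₀ this]
  refine ⟨H, hHd, ?_, ?_⟩
  · intro z hz
    by_cases h : z = a
    · rw [h, ha, hba, zero_mul]
    · rw [hHU z h, mul_div_cancel₀]
      exact fun h0 => h (stripBlaschke_eq_zero hr (by linarith) h0)
  · have hbd : ∀ z : ℂ, |z.im| = r → ‖H z‖ ≤ B := by
      intro z hz
      have hza : z ≠ a := by
        rintro rfl
        simp at hz; linarith
      rw [hHU z hza, norm_div, norm_stripBlaschke_eq_one hr hz, div_one]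
      exact hB z hz.le
    intro z hz
    rw [abs_le] at hz
    have hBn : 0 ≤ B := (norm_nonneg _).trans (hB 0 (by simpa using hr.le))
    refine PhragmenLindelof.horizontal_strip (a := -r) (b := r) (f := H) ?_ ?_
      (fun w hw => hbd w (by rw [hw, abs_neg, abs_of_pos hr]))
      (fun w hw => hbd w (by rw [hw, abs_of_pos hr])) hz.1 hz.2
    · refine DifferentiableOn.diffContOnCl (hHd.mono ?_)
      refine (closure_minimal (t := {z : ℂ | |z.im| ≤ r}) ?_
        (isClosed_le (by fun_prop) continuous_const)).trans ?_
      · intro w hw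
        exact abs_le.mpr ⟨hw.1.le, hw.2.le⟩
      · intro w hw
        exact lt_of_le_of_lt hw hrR
    · refine ⟨0, div_pos Real.pi_pos (by linarith), 0, ?_⟩
      refine Asymptotics.IsBigO.of_bound (2 * B) ?_
      rw [eventually_inf_principal]
      have hev : ∀ᶠ x : ℝ in atTop, |a| + 4 * r / π + 0 < x := eventually_gt_atTop _
      filter_upwards [preimage_mem_comap hev] with w hw hws
      simp only [zero_mul, Real.exp_zero, norm_one, mul_one]
      have hw : |a| + 4 * r / π + 0 < |w.re| := hw
      have hws' : |w.im| < r := abs_lt.mpr hws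
      have hge : 2 ≤ |π / (2 * r) * (w.re - a)| := by
        rw [abs_mul, abs_of_pos (by positivity : (0 : ℝ) < π / (2 * r))]
        have h1 : |w.re| - |a| ≤ |w.re - a| := abs_sub_abs_le_abs_sub _ _
        have h2 : π / (2 * r) * (4 * r / π) = 2 := by
          have := Real.pi_ne_zero
          field_simp; norm_num
        calc (2 : ℝ) = _ := h2.symm
          _ ≤ _ := mul_le_mul_of_nonneg_left (by linarith) (by positivity)
      have hwa : w ≠ a := by
        intro h
        rw [h] at hge
        norm_num at hge
      rw [hHU w hwa, norm_div]
      have := half_le_norm_stripBlaschke hr hws' hge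
      rw [div_le_iff₀ (by linarith)]
      have := hB w hws'.le
      nlinarith

lemma analyticOrderAt_stripBlaschke_self (hr : 0 < r) (a : ℝ) :
    analyticOrderAt (stripBlaschke r a) (a : ℂ) = 1 := by
  have han : AnalyticAt ℂ (stripBlaschke r a) (a : ℂ) :=
    (differentiableOn_stripBlaschke hr le_rfl).analyticAt
      ((isOpen_strip (2 * r)).mem_nhds (by simpa using hr))
  have h := han.analyticOrderAt_sub_eq_one_of_deriv_ne_zero (by
    rw [(hasDerivAt_stripBlaschke r a).deriv]
    have := Real.pi_ne_zero
    have h2 := hr.ne'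
    norm_cast; positivity)
  have hba : stripBlaschke r a a = 0 := by simp [stripBlaschke]
  simpa [hba] using h

/-- Each zero of a bounded holomorphic function on the strip forces a factor of decay. -/
theorem norm_le_mul_pow_of_zeros (hr : 0 < r) (hrR : r < R) (hR : R ≤ 2 * r) {z : ℂ}
    (hz : |z.im| ≤ r) {ρ : ℝ} (Z : Finset ℝ) (hρ : ∀ a ∈ Z, ‖stripBlaschke r a z‖ ≤ ρ) (N : ℕ) :
    ∀ (U : ℂ → ℂ) (m : ℝ → ℕ), DifferentiableOn ℂ U {z | |z.im| < R} →
      (∀ z, |z.im| ≤ r → ‖U z‖ ≤ B) → (∀ a ∈ Z, (m a : ℕ∞) ≤ analyticOrderAt U (a : ℂ)) →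
      ∑ a ∈ Z, m a = N → ‖U z‖ ≤ B * ρ ^ N := by
  induction N with
  | zero => intro U m _ hB _ _; simpa using hB z hz
  | succ N ih =>
    intro U m hU hB hm hN
    obtain ⟨a, haZ, hma⟩ : ∃ a ∈ Z, m a ≠ 0 := by
      by_contra! h
      rw [Finset.sum_eq_zero h] at hN
      omega
    have hR0 : 0 < R := hr.trans hrR
    have hmem : ∀ b : ℝ, {z : ℂ | |z.im| < R} ∈ 𝓝 (b : ℂ) := fun b =>
      (isOpen_strip R).mem_nhds (by simpa using hR0)
    have ha0 : U a = 0 := by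
      by_contra h
      have h1 := (hU.analyticAt (hmem a)).analyticOrderAt_eq_zero.mpr h
      have h2 := hm a haZ
      rw [h1] at h2
      simp at h2
      exact hma h2
    obtain ⟨H, hH, hUH, hHB⟩ := exists_div_stripBlaschke hr hrR hR hU hB ha0
    have hord : ∀ b : ℝ, analyticOrderAt U (b : ℂ) =
        analyticOrderAt (stripBlaschke r a) (b : ℂ) + analyticOrderAt H (b : ℂ) := by
      intro b
      rw [← analyticOrderAt_mul
        ((differentiableOn_stripBlaschke hr hR).analyticAt (hmem b)) (hH.analyticAt (hmem b))]
      refine analyticOrderAt_congr ?_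
      filter_upwards [hmem b] with w hw
      exact hUH w hw
    have h1 := ih H (Function.update m a (m a - 1)) hH hHB (by
      intro b hb
      have h2 := hm b hb
      rw [hord] at h2
      by_cases hba : b = a
      · subst hba
        rw [analyticOrderAt_stripBlaschke_self hr] at h2
        rw [Function.update_self]
        have h3 : ((m b - 1 : ℕ) : ℕ∞) + 1 = m b := by
          norm_cast; omega
        rw [← h3, add_comm] at h2
        exact (ENat.add_le_add_iff_left (by simp)).mp h2
      · rw [Function.update_of_ne hba]
        have h4 : analyticOrderAt (stripBlaschke r a) (b : ℂ) = 0 := by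
          rw [((differentiableOn_stripBlaschke hr hR).analyticAt (hmem b)).analyticOrderAt_eq_zero]
          intro h0
          have := stripBlaschke_eq_zero hr (by simpa using hr) h0
          exact hba (by exact_mod_cast this)
        simpa [h4] using h2) (by
      rw [Finset.sum_update_of_mem haZ]
      rw [← Finset.add_sum_erase _ _ haZ] at hN
      rw [Finset.sdiff_singleton_eq_erase]
      omega)
    rw [hUH z (lt_of_le_of_lt hz hrR), norm_mul]
    have hB0 : 0 ≤ B := (norm_nonneg _).trans (hB 0 (by simpa using hr.le))
    have hρ0 := (norm_nonneg _).trans (hρ a haZ)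
    calc _ ≤ ρ * (B * ρ ^ N) := by
          gcongr
          exact hρ a haZ
      _ = _ := by ring

lemma exists_norm_stripBlaschke_le (hr : 0 < r) (ℓ : ℝ) :
    ∃ ρ : ℝ, 0 < ρ ∧ ρ < 1 ∧ ∀ (z : ℂ) (a : ℝ), |z.im| ≤ r / 2 → |z.re - a| ≤ ℓ →
      ‖stripBlaschke r a z‖ ≤ ρ := by
  set K : Set ℂ := Icc (-ℓ) ℓ ×ℂ Icc (-(r / 2)) (r / 2) with hK
  have hKc : IsCompact K := isCompact_Icc.reProdIm isCompact_Icc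
  have hsh : ∀ (z : ℂ) (a : ℝ), stripBlaschke r a z = stripBlaschke r 0 (z - a) := by
    intro z a; simp [stripBlaschke]
  have hKs : K ⊆ {z : ℂ | |z.im| < r} := by
    intro z hz
    have := abs_le.mpr hz.2
    change |z.im| < r
    linarith
  obtain ⟨ρ, h1, h2⟩ : ∃ ρ : ℝ, ρ < 1 ∧ ∀ z ∈ K, ‖stripBlaschke r 0 z‖ ≤ ρ := by
    rcases K.eq_empty_or_nonempty with h | h
    · exact ⟨0, by norm_num, by simp [h]⟩
    · obtain ⟨w, hw, hmax⟩ := hKc.exists_isMaxOn h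
        (((differentiableOn_stripBlaschke (a := 0) hr (R := r) (by linarith)).continuousOn.mono
          hKs).norm)
      exact ⟨_, norm_stripBlaschke_lt_one hr (hKs hw), fun z hz => hmax hz⟩
  refine ⟨max ρ (1 / 2), by positivity, max_lt h1 (by norm_num), fun z a hz ha => ?_⟩
  rw [hsh]
  refine (h2 _ ⟨?_, ?_⟩).trans (le_max_left _ _)
  · simpa [abs_le] using ha
  · simpa [abs_le] using hz

end StripBlaschke

section ZeroCount
open Set Filter Topology

lemma AnalyticAt.iteratedDeriv' {𝕜 : Type*} [NontriviallyNormedField 𝕜] [CompleteSpace 𝕜]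
    {f : 𝕜 → 𝕜} {x : 𝕜} (h : AnalyticAt 𝕜 f x) (n : ℕ) : AnalyticAt 𝕜 (iteratedDeriv n f) x := by
  rw [iteratedDeriv_eq_iterate]
  exact h.iterated_deriv n

lemma iteratedDeriv_ofReal_eq {u : ℝ → ℝ} {U : ℂ → ℂ} {r : ℝ} (hr : 0 < r)
    (hu : AnalyticOnNhd ℝ u univ) (hU : DifferentiableOn ℂ U {z | |z.im| < r})
    (h : ∀ x : ℝ, U x = u x) (k : ℕ) :
    ∀ x : ℝ, iteratedDeriv k U (x : ℂ) = (iteratedDeriv k u x : ℝ) := by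
  induction k with
  | zero => intro x; simpa using h x
  | succ k ih =>
    intro x
    have hmem : {z : ℂ | |z.im| < r} ∈ 𝓝 (x : ℂ) := (isOpen_strip r).mem_nhds (by simpa using hr)
    have h1 : AnalyticAt ℂ (iteratedDeriv k U) (x : ℂ) := (hU.analyticAt hmem).iteratedDeriv' k
    have h2 := h1.differentiableAt.hasDerivAt.comp_ofReal
    have h3 : HasDerivAt (fun y : ℝ => ((iteratedDeriv k u y : ℝ) : ℂ))
        ((deriv (iteratedDeriv k u) x : ℝ) : ℂ) x :=
      ((hu x trivial).iteratedDeriv' k).differentiableAt.hasDerivAt.ofReal_comp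
    rw [iteratedDeriv_succ, iteratedDeriv_succ]
    simp_rw [ih] at h2
    exact h2.unique h3

lemma Function.Periodic.iteratedDeriv' {u : ℝ → ℝ} {ℓ : ℝ} (h : Function.Periodic u ℓ) (k : ℕ) :
    Function.Periodic (iteratedDeriv k u) ℓ := by
  intro x
  have := congrFun (iteratedDeriv_comp_add_const k u ℓ) x
  rw [← this]
  congr 1
  ext y
  exact h y

/-- A quantitative bound for the number of zeros, with multiplicity, of a periodic analytic
function with uniformly controlled derivatives. -/
theorem exists_zero_count_bound {r ℓ : ℝ} (hr : 0 < r) (hℓ : 0 < ℓ) :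
    ∃ ρ : ℝ, 0 < ρ ∧ ρ < 1 ∧ ∀ (u : ℝ → ℝ) (B b : ℝ), AnalyticOnNhd ℝ u univ →
      Function.Periodic u ℓ → (∀ n x, |iteratedDeriv n u x| ≤ B * n.factorial / r ^ n) →
      ∀ (x : ℝ) (k : ℕ), b * k.factorial ≤ |iteratedDeriv k u x| * (r / 4) ^ k →
      ∀ (Z : Finset ℝ) (m : ℝ → ℕ), (∀ a ∈ Z, a ∈ Ico 0 ℓ) →
        (∀ a ∈ Z, ∀ i < m a, iteratedDeriv i u a = 0) → b ≤ 2 * B * ρ ^ (∑ a ∈ Z, m a) := by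
  obtain ⟨ρ, h0, h1, hρ⟩ := exists_norm_stripBlaschke_le (half_pos hr) (ℓ + r / 4)
  refine ⟨ρ, h0, h1, fun u B b hu hper hb x k hx Z m hZ hm => ?_⟩
  obtain ⟨U, hU, hUu, hUB⟩ := exists_holomorphic_extension hr hu hb
  wlog hx0 : x ∈ Ico 0 ℓ generalizing x
  · refine this (toIcoMod hℓ 0 x) ?_ (by simpa using toIcoMod_mem_Ico hℓ 0 x)
    rwa [toIcoMod, (hper.iteratedDeriv' k).sub_zsmul_eq]
  have hmem : ∀ b : ℝ, {z : ℂ | |z.im| < r} ∈ 𝓝 (b : ℂ) := fun b =>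
      (isOpen_strip r).mem_nhds (by simpa using hr)
  set N := ∑ a ∈ Z, m a with hN
  have key : ∀ z ∈ Metric.sphere (x : ℂ) (r / 4), ‖U z‖ ≤ 2 * B * ρ ^ N := by
    intro z hz
    rw [mem_sphere_iff_norm] at hz
    have him : |z.im| ≤ r / 4 := by
      have := Complex.abs_im_le_norm (z - x)
      simp only [Complex.sub_im, Complex.ofReal_im, sub_zero] at this
      linarith
    have hre : |z.re - x| ≤ r / 4 := by
      have := Complex.abs_re_le_norm (z - x)
      simp only [Complex.sub_re, Complex.ofReal_re] at this
      linarith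
    refine norm_le_mul_pow_of_zeros (r := r / 2) (R := r) (by linarith) (by linarith)
      (by linarith) (by linarith) Z (fun a ha => ?_) N U m hU hUB (fun a ha => ?_) rfl
    · refine hρ z a (by linarith) ?_
      have := hZ a ha
      rw [abs_le] at *
      obtain ⟨h1, h2⟩ := this
      obtain ⟨h3, h4⟩ := hx0
      constructor <;> linarith
    · rw [natCast_le_analyticOrderAt_iff_iteratedDeriv_eq_zero (hU.analyticAt (hmem a))]
      intro i hi
      rw [iteratedDeriv_ofReal_eq hr hu hU hUu, hm a ha i hi]
      simp
  have hdc : DiffContOnCl ℂ U (Metric.ball (x : ℂ) (r / 4)) := by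
    refine DifferentiableOn.diffContOnCl (hU.mono ?_)
    refine Metric.closure_ball_subset_closedBall.trans (fun z hz => ?_)
    rw [mem_closedBall_iff_norm] at hz
    have := Complex.abs_im_le_norm (z - x)
    simp only [Complex.sub_im, Complex.ofReal_im, sub_zero] at this
    change |z.im| < r
    linarith
  have h4 := Complex.norm_iteratedDeriv_le_of_forall_mem_sphere_norm_le k (by positivity) hdc key
  rw [iteratedDeriv_ofReal_eq hr hu hU hUu, Complex.norm_real, Real.norm_eq_abs,
    le_div_iff₀ (by positivity)] at h4
  have hk : (0 : ℝ) < k.factorial := by positivity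
  refine le_of_mul_le_mul_right ?_ hk
  linarith

end ZeroCount

/-- The partial derivative in the first variable. -/
def dx (f : ℝ × ℝ → ℝ) (p : ℝ × ℝ) : ℝ := fderiv ℝ f p (1, 0)

/-- The partial derivative in the second variable. -/
def dy (f : ℝ × ℝ → ℝ) (p : ℝ × ℝ) : ℝ := fderiv ℝ f p (0, 1)

/-- Smoothness near the closed strip `0 ≤ y ≤ h`. -/
def SmoothStrip (h : ℝ) (f : ℝ × ℝ → ℝ) : Prop :=
  ∀ p : ℝ × ℝ, p.2 ∈ Set.Icc 0 h → ContDiffAt ℝ ((⊤ : ℕ∞) : WithTop ℕ∞) f p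

/-- Periodicity in the first variable. -/
def PeriodicX (ℓ : ℝ) (f : ℝ × ℝ → ℝ) : Prop := ∀ x y, f (x + ℓ, y) = f (x, y)

section Partial
open Set Filter Topology

variable {f g : ℝ × ℝ → ℝ} {h ℓ : ℝ} {p : ℝ × ℝ}

lemma hasFDerivAt_partial (hf : DifferentiableAt ℝ f p) :
    HasDerivAt (fun x => f (x, p.2)) (dx f p) p.1 ∧ HasDerivAt (fun y => f (p.1, y)) (dy f p) p.2 := by
  have h0 : HasFDerivAt f (fderiv ℝ f p) (p.1, p.2) := hf.hasFDerivAt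
  constructor
  · exact h0.comp_hasDerivAt p.1 ((hasDerivAt_id p.1).prodMk (hasDerivAt_const p.1 p.2))
  · exact h0.comp_hasDerivAt p.2 ((hasDerivAt_const p.2 p.1).prodMk (hasDerivAt_id p.2))

lemma hasDerivAt_dx (hf : DifferentiableAt ℝ f p) :
    HasDerivAt (fun x => f (x, p.2)) (dx f p) p.1 := (hasFDerivAt_partial hf).1

lemma hasDerivAt_dy (hf : DifferentiableAt ℝ f p) :
    HasDerivAt (fun y => f (p.1, y)) (dy f p) p.2 := (hasFDerivAt_partial hf).2

lemma fderiv_eq_partial (a : ℝ × ℝ) : fderiv ℝ f p a = a.1 * dx f p + a.2 * dy f p := by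
  have : a = a.1 • ((1, 0) : ℝ × ℝ) + a.2 • ((0, 1) : ℝ × ℝ) := by ext <;> simp
  conv_lhs => rw [this]
  rw [map_add, map_smul, map_smul]; rfl

lemma dx_add (hf : DifferentiableAt ℝ f p) (hg : DifferentiableAt ℝ g p) :
    dx (f + g) p = dx f p + dx g p := by simp [dx, fderiv_add hf hg]

lemma dy_add (hf : DifferentiableAt ℝ f p) (hg : DifferentiableAt ℝ g p) :
    dy (f + g) p = dy f p + dy g p := by simp [dy, fderiv_add hf hg]

lemma dx_mul (hf : DifferentiableAt ℝ f p) (hg : DifferentiableAt ℝ g p) :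
    dx (f * g) p = dx f p * g p + f p * dx g p := by
  simp [dx, fderiv_mul hf hg]; ring

lemma dy_mul (hf : DifferentiableAt ℝ f p) (hg : DifferentiableAt ℝ g p) :
    dy (f * g) p = dy f p * g p + f p * dy g p := by
  simp [dy, fderiv_mul hf hg]; ring

lemma SmoothStrip.diff (hf : SmoothStrip h f) (hp : p.2 ∈ Icc 0 h) : DifferentiableAt ℝ f p :=
  (hf p hp).differentiableAt (by simp)

lemma SmoothStrip.cont (hf : SmoothStrip h f) : ContinuousOn f {p | p.2 ∈ Icc 0 h} :=
  fun p hp => (hf p hp).continuousAt.continuousWithinAt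

lemma SmoothStrip.fderiv_apply (hf : SmoothStrip h f) (a : ℝ × ℝ) :
    SmoothStrip h (fun p => fderiv ℝ f p a) := fun p hp =>
  ((hf p hp).fderiv_right (m := ((⊤ : ℕ∞) : WithTop ℕ∞)) (by norm_cast)).clm_apply contDiffAt_const

lemma SmoothStrip.dx (hf : SmoothStrip h f) : SmoothStrip h (dx f) := hf.fderiv_apply _
lemma SmoothStrip.dy (hf : SmoothStrip h f) : SmoothStrip h (dy f) := hf.fderiv_apply _

lemma SmoothStrip.mul (hf : SmoothStrip h f) (hg : SmoothStrip h g) : SmoothStrip h (f * g) :=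
  fun p hp => (hf p hp).mul (hg p hp)
lemma SmoothStrip.add (hf : SmoothStrip h f) (hg : SmoothStrip h g) : SmoothStrip h (f + g) :=
  fun p hp => (hf p hp).add (hg p hp)

lemma _root_.ContDiff.smoothStrip (hf : ContDiff ℝ ((⊤ : ℕ∞) : WithTop ℕ∞) f) : SmoothStrip h f :=
  fun _ _ => hf.contDiffAt

lemma SmoothStrip.iterate_dx (hf : SmoothStrip h f) (k : ℕ) : SmoothStrip h (_root_.dx^[k] f) := by
  induction k with
  | zero => exact hf
  | succ k ih => rw [Function.iterate_succ_apply']; exact ih.dx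

lemma PeriodicX.fderiv_apply (hf : PeriodicX ℓ f) (a : ℝ × ℝ) :
    PeriodicX ℓ (fun p => fderiv ℝ f p a) := by
  intro x y
  have h1 := fderiv_comp_add_right (𝕜 := ℝ) (f := f) (x := (x, y)) ((ℓ, 0) : ℝ × ℝ)
  have h2 : (fun p : ℝ × ℝ => f (p + (ℓ, 0))) = f := by
    ext ⟨x, y⟩; simpa using hf x y
  rw [h2] at h1
  simp only [h1]; simp

lemma PeriodicX.dx (hf : PeriodicX ℓ f) : PeriodicX ℓ (dx f) := hf.fderiv_apply _
lemma PeriodicX.mul (hf : PeriodicX ℓ f) (hg : PeriodicX ℓ g) : PeriodicX ℓ (f * g) :=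
  fun x y => by simp [hf x y, hg x y]
lemma PeriodicX.iterate_dx (hf : PeriodicX ℓ f) (k : ℕ) : PeriodicX ℓ (_root_.dx^[k] f) := by
  induction k with
  | zero => exact hf
  | succ k ih => rw [Function.iterate_succ_apply']; exact ih.dx

lemma dx_dy_comm (hf : ContDiffAt ℝ ((⊤ : ℕ∞) : WithTop ℕ∞) f p) : dx (dy f) p = dy (dx f) p := by
  have hs : IsSymmSndFDerivAt ℝ f p := hf.isSymmSndFDerivAt (by
    simpa using WithTop.coe_le_coe.2 (le_top : (2 : ℕ∞) ≤ ⊤))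
  have hd : DifferentiableAt ℝ (fderiv ℝ f) p :=
    (hf.fderiv_right (m := ((⊤ : ℕ∞) : WithTop ℕ∞)) (by norm_cast)).differentiableAt (by simp)
  have e : ∀ a b : ℝ × ℝ, fderiv ℝ (fun q => fderiv ℝ f q a) p b = fderiv ℝ (fderiv ℝ f) p b a := by
    intro a b
    have := (hd.hasFDerivAt.clm_apply (hasFDerivAt_const a p)).fderiv
    rw [this]; simp
  unfold dx dy
  rw [e, e]
  exact hs _ _

/-- Functions agreeing on the strip have the same tangential derivatives there. -/
lemma dx_congr_strip (hf : SmoothStrip h f) (hg : SmoothStrip h g)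
    (hfg : ∀ p : ℝ × ℝ, p.2 ∈ Icc 0 h → f p = g p) (hp : p.2 ∈ Icc 0 h) : dx f p = dx g p := by
  have h1 := hasDerivAt_dx (hf.diff hp)
  have h2 := hasDerivAt_dx (hg.diff hp)
  have : (fun x => f (x, p.2)) = fun x => g (x, p.2) := by
    ext x; exact hfg _ hp
  rw [this] at h1
  exact h1.unique h2

lemma iterate_dx_congr_strip (hf : SmoothStrip h f) (hg : SmoothStrip h g)
    (hfg : ∀ p : ℝ × ℝ, p.2 ∈ Icc 0 h → f p = g p) (k : ℕ) :
    ∀ p : ℝ × ℝ, p.2 ∈ Icc 0 h → dx^[k] f p = dx^[k] g p := by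
  induction k with
  | zero => exact hfg
  | succ k ih =>
    intro p hp
    rw [Function.iterate_succ_apply', Function.iterate_succ_apply']
    exact dx_congr_strip (hf.iterate_dx k) (hg.iterate_dx k) ih hp

/-- Tangential derivatives on a horizontal line are the derivatives of the restriction. -/
lemma iteratedDeriv_slice (hf : SmoothStrip h f) {y : ℝ} (hy : y ∈ Icc 0 h) (k : ℕ) :
    iteratedDeriv k (fun x => f (x, y)) = fun x => dx^[k] f (x, y) := by
  induction k with
  | zero => simp
  | succ k ih =>
    rw [iteratedDeriv_succ, ih]
    ext x
    rw [Function.iterate_succ_apply']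
    exact (hasDerivAt_dx (p := (x, y)) ((hf.iterate_dx k).diff hy)).deriv

/-- Leibniz rule for iterated tangential derivatives. -/
lemma iterate_dx_mul (hf : SmoothStrip h f) (hg : SmoothStrip h g) (k : ℕ) (hp : p.2 ∈ Icc 0 h) :
    dx^[k] (f * g) p = ∑ j ∈ Finset.range (k + 1), (k.choose j : ℝ) * dx^[j] f p * dx^[k - j] g p := by
  have hs : ∀ {f}, SmoothStrip h f → ContDiffAt ℝ k (fun x => f (x, p.2)) p.1 := by
    intro f hf
    have h1 : ContDiffAt ℝ k f (p.1, p.2) := (hf p hp).of_le (by exact_mod_cast le_top)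
    exact h1.comp p.1 (contDiffAt_id.prodMk contDiffAt_const)
  have h1 := iteratedDeriv_mul (hs hf) (hs hg)
  have e := fun k => congrFun (iteratedDeriv_slice hf hp k) p.1
  have e2 := fun k => congrFun (iteratedDeriv_slice hg hp k) p.1
  have e3 := congrFun (iteratedDeriv_slice (hf.mul hg) hp k) p.1
  simp only [e, e2] at h1
  rw [← h1]
  exact e3.symm

end Partial

/-- The integral over the rectangle `[0, ℓ] × [y₀, h]`. -/
def rectInt (ℓ y₀ h : ℝ) (f : ℝ × ℝ → ℝ) : ℝ := ∫ p in Set.Icc ((0 : ℝ), y₀) (ℓ, h), f p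

section RectInt
open Set Filter Topology

variable {f g : ℝ × ℝ → ℝ} {h ℓ y₀ : ℝ}

lemma rect_subset_strip (hy : 0 ≤ y₀) : Icc ((0 : ℝ), y₀) (ℓ, h) ⊆ {p : ℝ × ℝ | p.2 ∈ Icc 0 h} :=
  fun _ hp => ⟨hy.trans hp.1.2, hp.2.2⟩

lemma integrableOn_rect (hy : 0 ≤ y₀) (hf : ContinuousOn f {p | p.2 ∈ Icc 0 h}) :
    IntegrableOn f (Icc ((0 : ℝ), y₀) (ℓ, h)) :=
  (hf.mono (rect_subset_strip hy)).integrableOn_compact isCompact_Icc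

lemma rectInt_mono (hy : 0 ≤ y₀) (hf : ContinuousOn f {p | p.2 ∈ Icc 0 h})
    (hg : ContinuousOn g {p | p.2 ∈ Icc 0 h})
    (hfg : ∀ p ∈ Icc ((0 : ℝ), y₀) (ℓ, h), f p ≤ g p) : rectInt ℓ y₀ h f ≤ rectInt ℓ y₀ h g :=
  setIntegral_mono_on (integrableOn_rect hy hf) (integrableOn_rect hy hg) measurableSet_Icc hfg

lemma rectInt_nonneg (hf : ∀ p ∈ Icc ((0 : ℝ), y₀) (ℓ, h), 0 ≤ f p) : 0 ≤ rectInt ℓ y₀ h f :=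
  setIntegral_nonneg measurableSet_Icc hf

lemma rectInt_congr (hfg : ∀ p ∈ Icc ((0 : ℝ), y₀) (ℓ, h), f p = g p) :
    rectInt ℓ y₀ h f = rectInt ℓ y₀ h g := setIntegral_congr_fun measurableSet_Icc hfg

lemma rectInt_add (hy : 0 ≤ y₀) (hf : ContinuousOn f {p | p.2 ∈ Icc 0 h})
    (hg : ContinuousOn g {p | p.2 ∈ Icc 0 h}) :
    rectInt ℓ y₀ h (fun p => f p + g p) = rectInt ℓ y₀ h f + rectInt ℓ y₀ h g :=
  integral_add (integrableOn_rect hy hf) (integrableOn_rect hy hg)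

lemma rectInt_const_mul (c : ℝ) : rectInt ℓ y₀ h (fun p => c * f p) = c * rectInt ℓ y₀ h f :=
  integral_const_mul c _

lemma rectInt_sum {ι : Type*} (s : Finset ι) (F : ι → ℝ × ℝ → ℝ) (hy : 0 ≤ y₀)
    (hF : ∀ i ∈ s, ContinuousOn (F i) {p | p.2 ∈ Icc 0 h}) :
    rectInt ℓ y₀ h (fun p => ∑ i ∈ s, F i p) = ∑ i ∈ s, rectInt ℓ y₀ h (F i) :=
  integral_finsetSum s (fun i hi => integrableOn_rect hy (hF i hi))

lemma rectInt_le_of_nonneg (hy : 0 ≤ y₀) (hf : ContinuousOn f {p | p.2 ∈ Icc 0 h})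
    (h0 : ∀ p ∈ Icc ((0 : ℝ), (0 : ℝ)) (ℓ, h), 0 ≤ f p) : rectInt ℓ y₀ h f ≤ rectInt ℓ 0 h f := by
  refine setIntegral_mono_set (integrableOn_rect le_rfl hf) ?_ ?_
  · exact (ae_restrict_iff' measurableSet_Icc).mpr (ae_of_all _ h0)
  · exact (Icc_subset_Icc_left (by exact ⟨le_rfl, hy⟩)).eventuallyLE

lemma rectInt_mul_le {a b M : ℝ} (hy : 0 ≤ y₀) (hf : ContinuousOn f {p | p.2 ∈ Icc 0 h})
    (hg : ContinuousOn g {p | p.2 ∈ Icc 0 h}) (ha : 0 < a) (hb : 0 < b)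
    (h1 : rectInt ℓ y₀ h (fun p => f p ^ 2) ≤ M * a ^ 2)
    (h2 : rectInt ℓ y₀ h (fun p => g p ^ 2) ≤ M * b ^ 2) :
    rectInt ℓ y₀ h (fun p => |f p| * |g p|) ≤ M * (a * b) := by
  have : rectInt ℓ y₀ h (fun p => |f p| * |g p|) ≤
      rectInt ℓ y₀ h (fun p => (b / a / 2) * f p ^ 2 + (a / b / 2) * g p ^ 2) := by
    refine rectInt_mono hy (hf.abs.mul hg.abs) (by fun_prop) (fun p _ => ?_)
    have key : 0 ≤ (b * |f p| - a * |g p|) ^ 2 := sq_nonneg _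
    have e : (b / a / 2) * f p ^ 2 + (a / b / 2) * g p ^ 2 - |f p| * |g p| =
        (b * |f p| - a * |g p|) ^ 2 / (2 * a * b) := by
      rw [← sq_abs (f p), ← sq_abs (g p)]
      field_simp
      ring
    have : 0 ≤ (b * |f p| - a * |g p|) ^ 2 / (2 * a * b) := by positivity
    linarith
  rw [rectInt_add hy (by fun_prop) (by fun_prop), rectInt_const_mul, rectInt_const_mul] at this
  refine this.trans ?_
  calc _ ≤ b / a / 2 * (M * a ^ 2) + a / b / 2 * (M * b ^ 2) := by gcongr
    _ = _ := by field_simp; ring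

/-- Divergence theorem on a rectangle, for fields periodic in the first variable. -/
lemma rectInt_divergence {P Q : ℝ × ℝ → ℝ} (hℓ : 0 ≤ ℓ) (hy : 0 ≤ y₀) (hyh : y₀ ≤ h)
    (hP : SmoothStrip h P) (hQ : SmoothStrip h Q) (hPp : PeriodicX ℓ P) :
    rectInt ℓ y₀ h (fun p => dx P p + dy Q p) =
      (∫ x in (0 : ℝ)..ℓ, Q (x, h)) - ∫ x in (0 : ℝ)..ℓ, Q (x, y₀) := by
  have hin : ∀ p ∈ Ioo (0 : ℝ) ℓ ×ˢ Ioo y₀ h, p.2 ∈ Icc 0 h :=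
    fun p hp => ⟨hy.trans hp.2.1.le, hp.2.2.le⟩
  have := integral_divergence_prod_Icc_of_hasFDerivAt_of_le P Q (fderiv ℝ P) (fderiv ℝ Q)
    (0, y₀) (ℓ, h) ⟨hℓ, hyh⟩ (hP.cont.mono (rect_subset_strip hy))
    (hQ.cont.mono (rect_subset_strip hy))
    (fun p hp => (hP.diff (hin p hp)).hasFDerivAt) (fun p hp => (hQ.diff (hin p hp)).hasFDerivAt)
    (integrableOn_rect hy (hP.dx.cont.add hQ.dy.cont))
  have e : ∀ y, P (ℓ, y) = P (0, y) := fun y => by simpa using hPp 0 y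
  unfold rectInt
  simp only [e] at this
  simp only [dx, dy]
  rw [this]; ring

end RectInt

section Energy
open Set Filter Topology

variable {w : ℝ × ℝ → ℝ} {h ℓ y₀ : ℝ}

lemma hasFDerivAt_weight (h : ℝ) (n : ℕ) (p : ℝ × ℝ) :
    dx (fun p => (h - p.2) ^ n) p = 0 ∧ dy (fun p => (h - p.2) ^ n) p = -(n * (h - p.2) ^ (n - 1)) := by
  have hd : DifferentiableAt ℝ (fun p : ℝ × ℝ => (h - p.2) ^ n) p := by fun_prop
  constructor
  · exact (hasDerivAt_dx hd).unique (hasDerivAt_const p.1 ((h - p.2) ^ n))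
  · refine (hasDerivAt_dy hd).unique ?_
    have := ((hasDerivAt_id' p.2).const_sub h).fun_pow n
    simpa using this

lemma smoothStrip_weight (h' : ℝ) (n : ℕ) : SmoothStrip h (fun p => (h' - p.2) ^ n) :=
  ContDiff.smoothStrip (by fun_prop)

lemma periodicX_weight (h' : ℝ) (n : ℕ) : PeriodicX ℓ (fun p => (h' - p.2) ^ n) := fun _ _ => rfl

/-- Weighted energy (Caccioppoli) inequality. -/
lemma caccioppoli (hℓ : 0 ≤ ℓ) (hh : 0 ≤ h) (hw : SmoothStrip h w) (hp : PeriodicX ℓ w)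
    (h0 : ∀ x, dy w (x, 0) = 0) (k : ℕ) :
    rectInt ℓ 0 h (fun p => (h - p.2) ^ (2 * k + 2) * (dx w p ^ 2 + dy w p ^ 2)) ≤
      2 * rectInt ℓ 0 h (fun p => (h - p.2) ^ (2 * k + 2) * (|w p| * |dx (dx w) p + dy (dy w) p|)) +
      4 * (k + 1) ^ 2 * rectInt ℓ 0 h (fun p => (h - p.2) ^ (2 * k) * w p ^ 2) := by
  set d : ℝ × ℝ → ℝ := fun p => (h - p.2) ^ (2 * k + 2) with hd
  have hds : SmoothStrip h d := smoothStrip_weight h _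
  have hwc := hw.cont
  have hxc := hw.dx.cont
  have hyc := hw.dy.cont
  have hxxc := hw.dx.dx.cont
  have hyyc := hw.dy.dy.cont
  have hdiv := rectInt_divergence (P := d * (w * dx w)) (Q := d * (w * dy w)) hℓ le_rfl hh
    (hds.mul (hw.mul hw.dx)) (hds.mul (hw.mul hw.dy))
    ((periodicX_weight h _).mul (hp.mul hp.dx))
  have hb1 : ∀ x, (d * (w * dy w)) (x, h) = 0 := fun x => by simp [hd]
  have hb2 : ∀ x, (d * (w * dy w)) (x, 0) = 0 := fun x => by simp [h0]
  simp only [hb1, hb2, intervalIntegral.integral_zero, sub_zero] at hdiv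
  have e : ∀ p ∈ Icc ((0 : ℝ), (0 : ℝ)) (ℓ, h),
      dx (d * (w * dx w)) p + dy (d * (w * dy w)) p =
      (h - p.2) ^ (2 * k + 2) * (dx w p ^ 2 + dy w p ^ 2) +
      ((h - p.2) ^ (2 * k + 2) * (w p * (dx (dx w) p + dy (dy w) p)) -
       (2 * k + 2 : ℝ) * ((h - p.2) ^ (2 * k + 1) * (w p * dy w p))) := by
    intro p hp'
    have hps := rect_subset_strip le_rfl hp'
    rw [dx_mul (hds.diff hps) ((hw.mul hw.dx).diff hps),
      dy_mul (hds.diff hps) ((hw.mul hw.dy).diff hps), dx_mul (hw.diff hps) (hw.dx.diff hps),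
      dy_mul (hw.diff hps) (hw.dy.diff hps), (hasFDerivAt_weight h _ p).1,
      (hasFDerivAt_weight h _ p).2]
    simp only [Pi.mul_apply, hd]
    push_cast
    ring
  have hle : rectInt ℓ 0 h (fun p => (h - p.2) ^ (2 * k + 2) * (dx w p ^ 2 + dy w p ^ 2)) ≤
    rectInt ℓ 0 h (fun p => 2 * (dx (d * (w * dx w)) p + dy (d * (w * dy w)) p) +
      (2 * ((h - p.2) ^ (2 * k + 2) * (|w p| * |dx (dx w) p + dy (dy w) p|)) +
      4 * (k + 1) ^ 2 * ((h - p.2) ^ (2 * k) * w p ^ 2))) := by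
    refine rectInt_mono le_rfl (by fun_prop) ?_ (fun p hp' => ?_)
    · have h1 := (hds.mul (hw.mul hw.dx)).dx.cont
      have h2 := (hds.mul (hw.mul hw.dy)).dy.cont
      fun_prop
    rw [e p hp']
    have hd0 : 0 ≤ h - p.2 := by linarith [hp'.2.2]
    have h1 : -(w p * (dx (dx w) p + dy (dy w) p)) ≤ |w p| * |dx (dx w) p + dy (dy w) p| := by
      rw [← abs_mul]; exact neg_le_abs _
    have h2 := mul_le_mul_of_nonneg_left h1 (pow_nonneg hd0 (2 * k + 2))
    have h3 : 0 ≤ (h - p.2) ^ (2 * k) * ((h - p.2) * dy w p - (2 * k + 2) * w p) ^ 2 := by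
      have := pow_nonneg hd0 (2 * k); positivity
    have e2 : (h - p.2) ^ (2 * k + 2) = (h - p.2) ^ (2 * k) * (h - p.2) ^ 2 := by ring
    have e1 : (h - p.2) ^ (2 * k + 1) = (h - p.2) ^ (2 * k) * (h - p.2) := by ring
    have h4 : 0 ≤ (h - p.2) ^ (2 * k) * (h - p.2) ^ 2 * dx w p ^ 2 := by
      have := pow_nonneg hd0 (2 * k); positivity
    rw [e2] at h2 ⊢
    rw [e1]
    nlinarith
  rw [rectInt_add le_rfl, rectInt_const_mul, hdiv, rectInt_add le_rfl, rectInt_const_mul,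
    rectInt_const_mul] at hle
  · linarith
  · fun_prop
  · fun_prop
  · have h1 := (hds.mul (hw.mul hw.dx)).dx.cont
    have h2 := (hds.mul (hw.mul hw.dy)).dy.cont
    fun_prop
  · fun_prop

/-- Weighted trace inequality. -/
lemma trace_le (hℓ : 0 ≤ ℓ) (hy : 0 ≤ y₀) (hyh : y₀ ≤ h) (h1 : h ≤ 1) (hw : SmoothStrip h w)
    (k : ℕ) :
    (h - y₀) ^ (2 * k + 2) * (∫ x in (0 : ℝ)..ℓ, w (x, y₀) ^ 2) ≤
      (2 * k + 3) * rectInt ℓ 0 h (fun p => (h - p.2) ^ (2 * k) * w p ^ 2) +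
        rectInt ℓ 0 h (fun p => (h - p.2) ^ (2 * k + 2) * dy w p ^ 2) := by
  set d : ℝ × ℝ → ℝ := fun p => (h - p.2) ^ (2 * k + 2) with hd
  have hds : SmoothStrip h d := smoothStrip_weight h _
  have hwc := hw.cont
  have hyc := hw.dy.cont
  have hdiv := rectInt_divergence (P := fun _ => 0) (Q := d * (w * w)) hℓ hy hyh
    (ContDiff.smoothStrip contDiff_const) (hds.mul (hw.mul hw)) (fun _ _ => rfl)
  have hb1 : ∀ x, (d * (w * w)) (x, h) = 0 := fun x => by simp [hd]
  have hb2 : ∀ x, (d * (w * w)) (x, y₀) = (h - y₀) ^ (2 * k + 2) * w (x, y₀) ^ 2 :=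
    fun x => by simp only [Pi.mul_apply, hd]; ring
  simp only [hb1, hb2, intervalIntegral.integral_zero, zero_sub,
    intervalIntegral.integral_const_mul] at hdiv
  have hle : rectInt ℓ y₀ h (fun p => (-1) * (dx (fun _ => 0) p + dy (d * (w * w)) p)) ≤
      rectInt ℓ y₀ h (fun p => (2 * k + 3) * ((h - p.2) ^ (2 * k) * w p ^ 2) +
        (h - p.2) ^ (2 * k + 2) * dy w p ^ 2) := by
    refine rectInt_mono hy ?_ (by fun_prop) (fun p hp' => ?_)
    · have h2 := (hds.mul (hw.mul hw)).dy.cont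
      have h3 : ContinuousOn (dx fun _ => (0 : ℝ)) {p : ℝ × ℝ | p.2 ∈ Icc 0 h} :=
        (ContDiff.smoothStrip contDiff_const : SmoothStrip h _).dx.cont
      fun_prop
    have hps := rect_subset_strip hy hp'
    rw [dy_mul (hds.diff hps) ((hw.mul hw).diff hps), dy_mul (hw.diff hps) (hw.diff hps),
      (hasFDerivAt_weight h _ p).2]
    have hd0 : 0 ≤ h - p.2 := by linarith [hp'.2.2]
    have hd1 : h - p.2 ≤ 1 := by linarith [hps.1]
    have : dx (fun _ => (0 : ℝ)) p = 0 := by simp [dx]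
    rw [this]
    simp only [Pi.mul_apply, hd]
    have e2 : (h - p.2) ^ (2 * k + 2) = (h - p.2) ^ (2 * k) * (h - p.2) ^ 2 := by ring
    have e1 : (h - p.2) ^ (2 * k + 2 - 1) = (h - p.2) ^ (2 * k) * (h - p.2) := by
      rw [show 2 * k + 2 - 1 = 2 * k + 1 by omega]; ring
    rw [e2, e1]
    set D := (h - p.2) ^ (2 * k) with hD
    have hDn : 0 ≤ D := pow_nonneg hd0 _
    set t := h - p.2
    have k0 : (0 : ℝ) ≤ k := by positivity
    push_cast
    have a1 : 0 ≤ D * ((1 - t) * ((2 * k + 2) * w p ^ 2)) := by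
      have : 0 ≤ 1 - t := by linarith
      positivity
    have a2 : 0 ≤ D * (t * dy w p + t * w p) ^ 2 := by positivity
    have a3 : 0 ≤ D * ((1 - t ^ 2) * w p ^ 2) := by
      have : 0 ≤ 1 - t ^ 2 := by nlinarith
      positivity
    nlinarith
  rw [rectInt_const_mul, hdiv] at hle
  refine le_trans (by linarith) (hle.trans ?_)
  rw [← rectInt_const_mul (f := fun p => (h - p.2) ^ (2 * k) * w p ^ 2),
    ← rectInt_add le_rfl (by fun_prop) (by fun_prop)]
  refine rectInt_le_of_nonneg hy (by fun_prop) (fun p hp' => ?_)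
  have hd0 : 0 ≤ h - p.2 := by linarith [hp'.2.2]
  positivity

/-- One-dimensional Sobolev inequality. -/
lemma sq_le_of_periodic {f f' : ℝ → ℝ} (hℓ : 0 < ℓ) (hf : ∀ x, HasDerivAt f (f' x) x)
    (hf' : Continuous f') (hp : Function.Periodic f ℓ) (x : ℝ) :
    f x ^ 2 ≤ (1 / ℓ + 1) * (∫ t in (0 : ℝ)..ℓ, f t ^ 2) + ∫ t in (0 : ℝ)..ℓ, f' t ^ 2 := by
  have hfc : Continuous f := continuous_iff_continuousAt.mpr fun x => (hf x).continuousAt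
  wlog hx : x ∈ Icc 0 ℓ generalizing x
  · have := this (toIcoMod hℓ 0 x) (by
      have := toIcoMod_mem_Ico hℓ 0 x
      rw [zero_add] at this
      exact Ico_subset_Icc_self this)
    rwa [toIcoMod, hp.sub_zsmul_eq] at this
  obtain ⟨c, hc, hmin⟩ := isCompact_Icc.exists_isMinOn (nonempty_Icc.mpr hℓ.le)
    (hfc.pow 2).continuousOn (s := Icc 0 ℓ)
  have hmean : f c ^ 2 ≤ 1 / ℓ * ∫ t in (0 : ℝ)..ℓ, f t ^ 2 := by
    have : ∫ t in (0 : ℝ)..ℓ, f c ^ 2 ≤ ∫ t in (0 : ℝ)..ℓ, f t ^ 2 :=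
      intervalIntegral.integral_mono_on hℓ.le (by simp) ((hfc.pow 2).intervalIntegrable _ _)
        (fun t ht => hmin ht)
    simp only [intervalIntegral.integral_const, sub_zero, smul_eq_mul] at this
    rw [one_div, ← div_eq_inv_mul, le_div_iff₀ hℓ]
    linarith
  have hftc : f x ^ 2 - f c ^ 2 = ∫ t in c..x, 2 * f t * f' t := by
    rw [intervalIntegral.integral_eq_sub_of_hasDerivAt (f := fun t => f t ^ 2)]
    · intro t _
      have := (hf t).fun_pow 2
      simpa using this
    · exact (by fun_prop : Continuous fun t => 2 * f t * f' t).intervalIntegrable _ _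
  have hbound : (∫ t in c..x, 2 * f t * f' t) ≤ ∫ t in (0 : ℝ)..ℓ, (f t ^ 2 + f' t ^ 2) := by
    refine (Real.le_norm_self _).trans ?_
    refine (intervalIntegral.norm_integral_le_integral_norm_uIoc).trans ?_
    simp only [Real.norm_eq_abs]
    rw [intervalIntegral.integral_of_le hℓ.le]
    have hsub : uIoc c x ⊆ Ioc 0 ℓ := by
      intro t ht
      rw [mem_uIoc] at ht
      rcases ht with ht | ht
      · exact ⟨lt_of_le_of_lt hc.1 ht.1, ht.2.trans hx.2⟩
      · exact ⟨lt_of_le_of_lt hx.1 ht.1, ht.2.trans hc.2⟩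
    have hi : IntegrableOn (fun t => f t ^ 2 + f' t ^ 2) (Ioc 0 ℓ) :=
      ((by fun_prop : Continuous fun t => f t ^ 2 + f' t ^ 2).integrableOn_Icc).mono_set
        Ioc_subset_Icc_self
    refine (setIntegral_mono_on (g := fun t => f t ^ 2 + f' t ^ 2) ?_ (hi.mono_set hsub)
      measurableSet_uIoc (fun t _ => ?_)).trans
      (setIntegral_mono_set hi (ae_of_all _ fun t => by positivity) hsub.eventuallyLE)
    · exact ((by fun_prop : Continuous fun t => |2 * f t * f' t|).integrableOn_Icc).mono_set
        (hsub.trans Ioc_subset_Icc_self)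
    · rw [abs_le]; constructor <;> nlinarith [sq_nonneg (f t + f' t), sq_nonneg (f t - f' t)]
  rw [intervalIntegral.integral_add
    ((by fun_prop : Continuous fun t => f t ^ 2).intervalIntegrable _ _)
    ((by fun_prop : Continuous fun t => f' t ^ 2).intervalIntegrable _ _)] at hbound
  linarith

end Energy

/-- The growth sequence `(A (k + λ)) ^ k` controlling tangential derivatives. -/
def growth (A lam : ℝ) (k : ℕ) : ℝ := (A * (k + lam)) ^ k

/-- A periodic solution of `Δv + λ² p v = 0` on the strip `0 ≤ y ≤ h` with Neumann data on
`y = 0`, where `p` has controlled tangential derivatives. -/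
structure StripSolution (ℓ h C lam : ℝ) (p v : ℝ × ℝ → ℝ) : Prop where
  smooth_v : SmoothStrip h v
  smooth_p : SmoothStrip h p
  periodic : PeriodicX ℓ v
  eqn : ∀ q : ℝ × ℝ, q.2 ∈ Set.Icc 0 h → dx (dx v) q + dy (dy v) q = -lam ^ 2 * (p q * v q)
  neumann : ∀ x, dy v (x, 0) = 0
  bound : ∀ j (q : ℝ × ℝ), q.2 ∈ Set.Icc 0 h → |dx^[j] p q| ≤ C ^ (j + 1) * j.factorial

section Growth
variable {A lam C : ℝ}

lemma growth_pos (hA : 0 < A) (hl : 0 < lam) (k : ℕ) : 0 < growth A lam k := by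
  unfold growth; positivity

lemma growth_zero (A lam : ℝ) : growth A lam 0 = 1 := by simp [growth]

lemma pow_mul_growth_le (hA : 0 < A) (hl : 0 < lam) {j k : ℕ} (hj : j ≤ k) (m : ℕ) :
    A ^ j * (k : ℝ) ^ j * growth A lam (k - j + m) ≤ growth A lam (k + m) := by
  unfold growth
  have e : k + m = j + (k - j + m) := by omega
  have hx : ((k - j + m : ℕ) : ℝ) ≤ ((k + m : ℕ) : ℝ) := by norm_cast; omega
  have hy : (k : ℝ) ≤ ((k + m : ℕ) : ℝ) := by norm_cast; omega
  rw [← mul_pow]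
  calc (A * k) ^ j * (A * (((k - j + m : ℕ) : ℝ) + lam)) ^ (k - j + m)
      ≤ (A * (((k + m : ℕ) : ℝ) + lam)) ^ j * (A * (((k + m : ℕ) : ℝ) + lam)) ^ (k - j + m) := by
        gcongr
        linarith
    _ = _ := by rw [← pow_add, ← e]

lemma sum_mul_growth_le (hA : 0 < A) (hl : 0 < lam) (hC : 0 ≤ C) (hAC : 2 * C ≤ A) (k m : ℕ) :
    ∑ j ∈ Finset.range (k + 1), C ^ (j + 1) * (k : ℝ) ^ j * growth A lam (k - j + m) ≤
      2 * C * growth A lam (k + m) := by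
  have h1 : ∀ j ∈ Finset.range (k + 1), C ^ (j + 1) * (k : ℝ) ^ j * growth A lam (k - j + m) ≤
      (1 / 2) ^ j * (C * growth A lam (k + m)) := by
    intro j hj
    have h2 := pow_mul_growth_le hA hl (Nat.lt_succ_iff.mp (Finset.mem_range.mp hj)) m
    have hg := (growth_pos hA hl (k - j + m)).le
    have h3 : C ^ j ≤ (1 / 2) ^ j * A ^ j := by
      rw [← mul_pow]
      exact pow_le_pow_left₀ hC (by linarith) j
    calc C ^ (j + 1) * (k : ℝ) ^ j * growth A lam (k - j + m)
        = C ^ j * (C * ((k : ℝ) ^ j * growth A lam (k - j + m))) := by ring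
      _ ≤ ((1 / 2) ^ j * A ^ j) * (C * ((k : ℝ) ^ j * growth A lam (k - j + m))) := by gcongr
      _ = (1 / 2) ^ j * (C * (A ^ j * (k : ℝ) ^ j * growth A lam (k - j + m))) := by ring
      _ ≤ _ := by gcongr
  refine (Finset.sum_le_sum h1).trans ?_
  rw [← Finset.sum_mul]
  have := (growth_pos hA hl (k + m)).le
  calc _ ≤ 2 * (C * growth A lam (k + m)) := by
        gcongr
        exact sum_geometric_two_le _
    _ = _ := by ring

lemma growth_add_two_ge (hA : 0 < A) (hl : 0 < lam) (m : ℕ) :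
    (A * lam) ^ 2 * growth A lam m ≤ growth A lam (m + 2) := by
  unfold growth
  rw [pow_add, mul_comm]
  push_cast
  have hm : (0 : ℝ) ≤ m := by positivity
  gcongr <;> linarith

lemma growth_succ_ge (hA : 0 < A) (hl : 0 < lam) (m : ℕ) :
    (A * (m + 1 + lam)) * growth A lam m ≤ growth A lam (m + 1) := by
  unfold growth
  rw [pow_succ, mul_comm]
  push_cast
  gcongr
  linarith

lemma factorial_le_growth (hA : 0 < A) (hl : 0 < lam) (k : ℕ) :
    k.factorial * A ^ k ≤ growth A lam k := by
  unfold growth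
  rw [mul_pow, mul_comm]
  gcongr
  have : (k.factorial : ℝ) ≤ (k : ℝ) ^ k := by exact_mod_cast Nat.factorial_le_pow k
  refine this.trans ?_
  gcongr
  linarith

lemma growth_le (hA : 0 < A) (hl : 0 < lam) (k : ℕ) :
    growth A lam k ≤ k.factorial * (A * Real.exp 1) ^ k * Real.exp lam := by
  unfold growth
  have h1 : ((k : ℝ) + lam) ^ k ≤ k.factorial * Real.exp (k + lam) := by
    have := Real.pow_div_factorial_le_exp (k + lam) (by positivity) k
    rw [div_le_iff₀ (by positivity)] at this
    linarith
  rw [mul_pow, mul_pow]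
  have : Real.exp 1 ^ k = Real.exp k := by rw [← Real.exp_nat_mul]; simp
  rw [this]
  calc _ ≤ A ^ k * (k.factorial * Real.exp (k + lam)) := by gcongr
    _ = _ := by rw [Real.exp_add]; ring

end Growth

section Solution
open Set Filter Topology

variable {v p : ℝ × ℝ → ℝ} {ℓ h C lam A : ℝ}

lemma iterate_dx_dy {f : ℝ × ℝ → ℝ} (hf : SmoothStrip h f) (k : ℕ) :
    ∀ q : ℝ × ℝ, q.2 ∈ Icc 0 h → dx^[k] (dy f) q = dy (dx^[k] f) q := by
  induction k with
  | zero => intro q _; rfl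
  | succ k ih =>
    intro q hq
    rw [Function.iterate_succ_apply', Function.iterate_succ_apply',
      dx_congr_strip (hf.dy.iterate_dx k) (hf.iterate_dx k).dy ih hq,
      dx_dy_comm ((hf.iterate_dx k) q hq)]

lemma iterate_dx_dy_dy (hf : SmoothStrip h v) (k : ℕ) (q : ℝ × ℝ) (hq : q.2 ∈ Icc 0 h)
    (hy : 0 < h) : dx^[k] (dy (dy v)) q = dy (dy (dx^[k] v)) q := by
  rw [iterate_dx_dy hf.dy k q hq]
  have h1 := hasDerivAt_dy (p := q) ((hf.dy.iterate_dx k).diff hq)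
  have h2 := hasDerivAt_dy (p := q) ((hf.iterate_dx k).dy.diff hq)
  have hU : UniqueDiffWithinAt ℝ (Icc 0 h) q.2 := uniqueDiffOn_Icc hy _ hq
  refine hU.eq_deriv (s := Icc 0 h) h1.hasDerivWithinAt
    ((h2.hasDerivWithinAt).congr (fun y hy => ?_) ?_)
  · exact iterate_dx_dy hf k (q.1, y) hy
  · exact iterate_dx_dy hf k q hq

lemma iterate_dx_add {f g : ℝ × ℝ → ℝ} (hf : SmoothStrip h f) (hg : SmoothStrip h g) (k : ℕ) :
    ∀ q : ℝ × ℝ, q.2 ∈ Icc 0 h → dx^[k] (f + g) q = dx^[k] f q + dx^[k] g q := by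
  induction k with
  | zero => intro q _; rfl
  | succ k ih =>
    intro q hq
    simp only [Function.iterate_succ_apply']
    rw [dx_congr_strip ((hf.add hg).iterate_dx k) ((hf.iterate_dx k).add (hg.iterate_dx k)) ih hq,
      dx_add ((hf.iterate_dx k).diff hq) ((hg.iterate_dx k).diff hq)]

lemma iterate_dx_const_mul {f : ℝ × ℝ → ℝ} (hf : SmoothStrip h f) (c : ℝ) (k : ℕ)
    (q : ℝ × ℝ) (hq : q.2 ∈ Icc 0 h) : dx^[k] (fun q => c * f q) q = c * dx^[k] f q := by
  have h1 := congrFun (iteratedDeriv_slice hf hq k) q.1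
  have h2 := congrFun (iteratedDeriv_slice
    ((contDiff_const.smoothStrip : SmoothStrip h fun _ => c).mul hf) hq k) q.1
  have h3 := iteratedDeriv_const_mul_field (n := k) (x := q.1) c (fun x => f (x, q.2))
  rw [h1] at h3
  exact h2.symm.trans h3

namespace StripSolution

lemma lap_iterate (S : StripSolution ℓ h C lam p v) (hh : 0 < h) (k : ℕ) (q : ℝ × ℝ)
    (hq : q.2 ∈ Icc 0 h) :
    dx (dx (dx^[k] v)) q + dy (dy (dx^[k] v)) q =
      -lam ^ 2 * ∑ j ∈ Finset.range (k + 1), (k.choose j : ℝ) * dx^[j] p q * dx^[k - j] v q := by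
  have hv := S.smooth_v
  have e := iterate_dx_congr_strip (hv.dx.dx.add hv.dy.dy)
    (((contDiff_const.smoothStrip : SmoothStrip h fun _ => -lam ^ 2)).mul (S.smooth_p.mul hv))
    (fun q hq => S.eqn q hq) k q hq
  rw [iterate_dx_add hv.dx.dx hv.dy.dy k q hq, iterate_dx_dy_dy hv k q hq hh] at e
  rw [← iterate_dx_mul S.smooth_p hv k hq, ← iterate_dx_const_mul (S.smooth_p.mul hv) _ k q hq,
    ← Function.iterate_succ_apply' dx k v, ← Function.iterate_succ_apply' dx (k + 1) v,
    Function.iterate_succ_apply, Function.iterate_succ_apply]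
  exact e

lemma abs_lap_iterate_le (S : StripSolution ℓ h C lam p v) (hh : 0 < h) (hC : 0 ≤ C) (k : ℕ)
    (q : ℝ × ℝ) (hq : q.2 ∈ Icc 0 h) :
    |dx (dx (dx^[k] v)) q + dy (dy (dx^[k] v)) q| ≤
      lam ^ 2 * ∑ j ∈ Finset.range (k + 1), C ^ (j + 1) * (k : ℝ) ^ j * |dx^[k - j] v q| := by
  rw [S.lap_iterate hh k q hq, abs_mul, abs_neg, abs_of_nonneg (sq_nonneg lam)]
  refine mul_le_mul_of_nonneg_left ?_ (sq_nonneg lam)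
  refine (Finset.abs_sum_le_sum_abs _ _).trans (Finset.sum_le_sum fun j _ => ?_)
  rw [abs_mul, abs_mul, Nat.abs_cast]
  have h1 : (k.choose j : ℝ) * j.factorial ≤ (k : ℝ) ^ j := by
    have : k.descFactorial j ≤ k ^ j := Nat.descFactorial_le_pow k j
    rw [Nat.descFactorial_eq_factorial_mul_choose, mul_comm] at this
    exact_mod_cast this
  refine mul_le_mul_of_nonneg_right ?_ (abs_nonneg _)
  calc _ ≤ (k.choose j : ℝ) * (C ^ (j + 1) * j.factorial) := by
        gcongr; exact S.bound j q hq
    _ = C ^ (j + 1) * ((k.choose j : ℝ) * j.factorial) := by ring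
    _ ≤ _ := by gcongr

lemma energy_step (S : StripSolution ℓ h C lam p v) (hℓ : 0 ≤ ℓ) (hh : 0 < h) (h1 : h ≤ 1)
    (hl : 0 < lam) (hC : 0 ≤ C) (hA : 0 < A) (hAC : 2 * C ≤ A) (hA2 : 4 * C + 4 ≤ A ^ 2) {M : ℝ}
    (hM : 0 ≤ M) (k : ℕ)
    (ih : ∀ j ≤ k, rectInt ℓ 0 h (fun q => (h - q.2) ^ (2 * j) * dx^[j] v q ^ 2) ≤
      M * growth A lam j ^ 2) :
    rectInt ℓ 0 h (fun q => (h - q.2) ^ (2 * k + 2) *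
      (dx (dx^[k] v) q ^ 2 + dy (dx^[k] v) q ^ 2)) ≤ M * growth A lam (k + 1) ^ 2 := by
  have hs := fun k => S.smooth_v.iterate_dx k
  have hc := fun k => (hs k).cont
  have hn : ∀ x, dy (dx^[k] v) (x, 0) = 0 := by
    intro x
    have hq : ((x, 0) : ℝ × ℝ).2 ∈ Icc 0 h := ⟨le_rfl, hh.le⟩
    rw [← iterate_dx_dy S.smooth_v k _ hq, ← congrFun (iteratedDeriv_slice S.smooth_v.dy hq k) x]
    simp only [S.neumann]
    simp
  have hcac := caccioppoli hℓ hh.le (hs k) (S.periodic.iterate_dx k) hn k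
  have hxx := (hs k).dx.dx.cont
  have hyy := (hs k).dy.dy.cont
  have hF : rectInt ℓ 0 h (fun q => (h - q.2) ^ (2 * k + 2) *
      (|dx^[k] v q| * |dx (dx (dx^[k] v)) q + dy (dy (dx^[k] v)) q|)) ≤
      2 * C * lam ^ 2 * M * growth A lam k ^ 2 := by
    have hc1 : ∀ j, ContinuousOn (fun q : ℝ × ℝ => (h - q.2) ^ j * dx^[j] v q)
        {q | q.2 ∈ Icc 0 h} := fun j => by have := hc j; fun_prop
    have hc2 : ∀ j ∈ Finset.range (k + 1), ContinuousOn (fun q : ℝ × ℝ => C ^ (j + 1) *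
        (k : ℝ) ^ j * (|(h - q.2) ^ k * dx^[k] v q| * |(h - q.2) ^ (k - j) * dx^[k - j] v q|))
        {q | q.2 ∈ Icc 0 h} := fun j _ =>
      continuousOn_const.mul ((hc1 k).abs.mul (hc1 (k - j)).abs)
    have step1 : rectInt ℓ 0 h (fun q => (h - q.2) ^ (2 * k + 2) *
      (|dx^[k] v q| * |dx (dx (dx^[k] v)) q + dy (dy (dx^[k] v)) q|)) ≤
      rectInt ℓ 0 h (fun q => lam ^ 2 * ∑ j ∈ Finset.range (k + 1), C ^ (j + 1) * (k : ℝ) ^ j *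
        (|(h - q.2) ^ k * dx^[k] v q| * |(h - q.2) ^ (k - j) * dx^[k - j] v q|)) := by
      refine rectInt_mono le_rfl ?_ ?_ (fun q hq => ?_)
      · have := hc k
        fun_prop
      · exact continuousOn_const.mul (continuousOn_finsetSum _ hc2)
      · have hq' := rect_subset_strip le_rfl hq
        have hd0 : 0 ≤ h - q.2 := by linarith [hq'.2]
        have hd1 : h - q.2 ≤ 1 := by linarith [hq'.1]
        calc _ ≤ (h - q.2) ^ (2 * k + 2) * (|dx^[k] v q| * (lam ^ 2 *
                ∑ j ∈ Finset.range (k + 1), C ^ (j + 1) * (k : ℝ) ^ j * |dx^[k - j] v q|)) := by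
              gcongr
              exact S.abs_lap_iterate_le hh hC k q hq'
          _ = lam ^ 2 * ∑ j ∈ Finset.range (k + 1), C ^ (j + 1) * (k : ℝ) ^ j *
                ((h - q.2) ^ (2 * k + 2) * (|dx^[k] v q| * |dx^[k - j] v q|)) := by
              simp only [Finset.mul_sum]
              refine Finset.sum_congr rfl fun j _ => ?_
              ring
          _ ≤ _ := by
              refine mul_le_mul_of_nonneg_left (Finset.sum_le_sum fun j _ =>
                mul_le_mul_of_nonneg_left ?_ (by positivity)) (sq_nonneg _)
              rw [abs_mul, abs_mul, abs_of_nonneg (pow_nonneg hd0 _),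
                abs_of_nonneg (pow_nonneg hd0 _)]
              calc _ ≤ (h - q.2) ^ (k + (k - j)) * (|dx^[k] v q| * |dx^[k - j] v q|) := by
                    refine mul_le_mul_of_nonneg_right
                      (pow_le_pow_of_le_one hd0 hd1 (by omega)) (by positivity)
                _ = _ := by rw [pow_add]; ring
    refine step1.trans ?_
    rw [rectInt_const_mul, rectInt_sum _ _ le_rfl hc2]
    have hsq : ∀ j ≤ k, rectInt ℓ 0 h (fun q => ((h - q.2) ^ j * dx^[j] v q) ^ 2) ≤
        M * growth A lam j ^ 2 := by
      intro j hj
      refine le_trans (le_of_eq (rectInt_congr fun q _ => ?_)) (ih j hj)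
      ring
    have step2 : ∀ j ∈ Finset.range (k + 1), rectInt ℓ 0 h (fun q => C ^ (j + 1) * (k : ℝ) ^ j *
        (|(h - q.2) ^ k * dx^[k] v q| * |(h - q.2) ^ (k - j) * dx^[k - j] v q|)) ≤
        (M * growth A lam k) * (C ^ (j + 1) * (k : ℝ) ^ j * growth A lam (k - j + 0)) := by
      intro j _
      rw [rectInt_const_mul]
      calc _ ≤ C ^ (j + 1) * (k : ℝ) ^ j * (M * (growth A lam k * growth A lam (k - j))) := by
            gcongr
            exact rectInt_mul_le le_rfl (hc1 k) (hc1 (k - j)) (growth_pos hA hl _)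
              (growth_pos hA hl _) (hsq k le_rfl) (hsq _ (by omega))
        _ = _ := by rw [add_zero]; ring
    have hg := growth_pos hA hl k
    calc _ ≤ lam ^ 2 * ((M * growth A lam k) * (2 * C * growth A lam (k + 0))) := by
          gcongr
          refine (Finset.sum_le_sum step2).trans ?_
          rw [← Finset.mul_sum]
          gcongr
          exact sum_mul_growth_le hA hl hC hAC k 0
      _ = _ := by rw [add_zero]; ring
  have hgs := growth_succ_ge hA hl k
  have hg := growth_pos hA hl k
  have hgs2 : (A * (k + 1 + lam) * growth A lam k) ^ 2 ≤ growth A lam (k + 1) ^ 2 := by gcongr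
  calc _ ≤ _ := hcac
    _ ≤ 2 * (2 * C * lam ^ 2 * M * growth A lam k ^ 2) +
        4 * (k + 1) ^ 2 * (M * growth A lam k ^ 2) := by
      gcongr
      exact ih k le_rfl
    _ = M * growth A lam k ^ 2 * (4 * C * lam ^ 2 + 4 * (k + 1) ^ 2) := by ring
    _ ≤ M * growth A lam k ^ 2 * (A ^ 2 * (k + 1 + lam) ^ 2) := by
      gcongr
      have hk : (0 : ℝ) ≤ k := by positivity
      have : (4 * C + 4) * (k + 1 + lam) ^ 2 ≤ A ^ 2 * (k + 1 + lam) ^ 2 := by gcongr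
      have h3 : 0 ≤ C * ((k + 1) ^ 2 + 2 * (k + 1) * lam) := by positivity
      have h4 : 0 ≤ lam ^ 2 + 2 * (k + 1) * lam := by positivity
      nlinarith
    _ = M * (A * (k + 1 + lam) * growth A lam k) ^ 2 := by ring
    _ ≤ _ := by gcongr

lemma energy_le (S : StripSolution ℓ h C lam p v) (hℓ : 0 ≤ ℓ) (hh : 0 < h) (h1 : h ≤ 1)
    (hl : 0 < lam) (hC : 0 ≤ C) (hA : 0 < A) (hAC : 2 * C ≤ A) (hA2 : 4 * C + 4 ≤ A ^ 2) (k : ℕ) :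
    rectInt ℓ 0 h (fun q => (h - q.2) ^ (2 * k) * dx^[k] v q ^ 2) ≤
      rectInt ℓ 0 h (fun q => v q ^ 2) * growth A lam k ^ 2 := by
  have hM : 0 ≤ rectInt ℓ 0 h (fun q => v q ^ 2) := rectInt_nonneg fun _ _ => sq_nonneg _
  induction k using Nat.strong_induction_on with
  | _ k ih =>
    rcases k with _ | k
    · simp [growth_zero]
    · have hst := S.energy_step hℓ hh h1 hl hC hA hAC hA2 hM k
        (fun j hj => ih j (Nat.lt_succ_of_le hj))
      refine le_trans (rectInt_mono le_rfl ?_ ?_ fun q hq => ?_) hst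
      · have := (S.smooth_v.iterate_dx (k + 1)).cont
        fun_prop
      · have := (S.smooth_v.iterate_dx k).dx.cont
        have := (S.smooth_v.iterate_dx k).dy.cont
        fun_prop
      · have hd0 : 0 ≤ h - q.2 := by linarith [hq.2.2]
        rw [Function.iterate_succ_apply', show 2 * (k + 1) = 2 * k + 2 by ring]
        gcongr
        linarith [sq_nonneg (dy (dx^[k] v) q)]

end StripSolution
end Solution

section InteriorBound
open Set Filter Topology

variable {v p : ℝ × ℝ → ℝ} {ℓ h C lam A : ℝ}

namespace StripSolution

lemma trace_iterate_le (S : StripSolution ℓ h C lam p v) (hℓ : 0 ≤ ℓ) (hh : 0 < h) (h1 : h ≤ 1)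
    (hl : 0 < lam) (hC : 0 ≤ C) (hA : 0 < A) (hAC : 2 * C ≤ A) (hA2 : 4 * C + 4 ≤ A ^ 2) (k : ℕ)
    {y : ℝ} (hy : y ∈ Icc 0 (h / 2)) :
    ∫ x in (0 : ℝ)..ℓ, dx^[k] v (x, y) ^ 2 ≤
      rectInt ℓ 0 h (fun q => v q ^ 2) * (2 * (growth A lam (k + 1) * (2 / h) ^ (k + 1)) ^ 2) := by
  set M := rectInt ℓ 0 h (fun q => v q ^ 2) with hMdef
  have hM : 0 ≤ M := rectInt_nonneg fun _ _ => sq_nonneg _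
  have hw := S.smooth_v.iterate_dx k
  have htr := trace_le (w := dx^[k] v) hℓ hy.1 (by linarith [hy.2]) h1 hw k
  have he := S.energy_le hℓ hh h1 hl hC hA hAC hA2
  have hst := S.energy_step hℓ hh h1 hl hC hA hAC hA2 hM k (fun j _ => he j)
  have hdy : rectInt ℓ 0 h (fun q => (h - q.2) ^ (2 * k + 2) * dy (dx^[k] v) q ^ 2) ≤
      M * growth A lam (k + 1) ^ 2 := by
    refine le_trans (rectInt_mono le_rfl ?_ ?_ fun q hq => ?_) hst
    · have := hw.dy.cont
      fun_prop
    · have := hw.dx.cont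
      have := hw.dy.cont
      fun_prop
    · have hd0 : 0 ≤ h - q.2 := by linarith [hq.2.2]
      gcongr
      linarith [sq_nonneg (dx (dx^[k] v) q)]
  have hgk : (2 * k + 3) * growth A lam k ^ 2 ≤ growth A lam (k + 1) ^ 2 := by
    have hg := growth_pos hA hl k
    have h2 : (A * (k + 1 + lam) * growth A lam k) ^ 2 ≤ growth A lam (k + 1) ^ 2 := by
      gcongr
      exact growth_succ_ge hA hl k
    refine le_trans ?_ h2
    have hk : (0 : ℝ) ≤ k := by positivity
    have h3 : (2 * k + 3 : ℝ) ≤ A ^ 2 * (k + 1 + lam) ^ 2 := by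
      have : (4 : ℝ) * (k + 1) ^ 2 ≤ A ^ 2 * (k + 1 + lam) ^ 2 := by
        exact mul_le_mul (by linarith) (pow_le_pow_left₀ (by positivity) (by linarith) 2)
          (by positivity) (by positivity)
      nlinarith
    calc _ ≤ (A ^ 2 * (k + 1 + lam) ^ 2) * growth A lam k ^ 2 := by gcongr
      _ = _ := by ring
  have hi_int : 0 ≤ ∫ x in (0 : ℝ)..ℓ, dx^[k] v (x, y) ^ 2 :=
    intervalIntegral.integral_nonneg hℓ fun _ _ => sq_nonneg _
  have hlow : (h / 2) ^ (2 * k + 2) * (∫ x in (0 : ℝ)..ℓ, dx^[k] v (x, y) ^ 2) ≤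
      M * (2 * growth A lam (k + 1) ^ 2) := by
    calc _ ≤ (h - y) ^ (2 * k + 2) * (∫ x in (0 : ℝ)..ℓ, dx^[k] v (x, y) ^ 2) := by
          gcongr
          linarith [hy.2]
      _ ≤ (2 * k + 3) * (M * growth A lam k ^ 2) + M * growth A lam (k + 1) ^ 2 :=
          htr.trans (by
            gcongr
            exact he k)
      _ = M * ((2 * k + 3) * growth A lam k ^ 2 + growth A lam (k + 1) ^ 2) := by ring
      _ ≤ M * (2 * growth A lam (k + 1) ^ 2) := by
          gcongr
          linarith
  have hpos : 0 < (h / 2) ^ (2 * k + 2) := by positivity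
  rw [← le_div_iff₀' hpos] at hlow
  refine hlow.trans (le_of_eq ?_)
  rw [div_eq_iff hpos.ne', mul_pow, ← pow_mul]
  have : (2 / h) ^ ((k + 1) * 2) * (h / 2) ^ (2 * k + 2) = 1 := by
    rw [show (k + 1) * 2 = 2 * k + 2 by ring, ← mul_pow]
    field_simp
    simp
  calc _ = M * (2 * growth A lam (k + 1) ^ 2) * 1 := by ring
    _ = _ := by rw [← this]; ring

lemma sq_iterate_le (S : StripSolution ℓ h C lam p v) (hℓ : 0 < ℓ) (hh : 0 < h) (h1 : h ≤ 1)
    (hl : 0 < lam) (hC : 0 ≤ C) (hA : 0 < A) (hAC : 2 * C ≤ A) (hA2 : 4 * C + 4 ≤ A ^ 2) (k : ℕ)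
    (q : ℝ × ℝ) (hy : q.2 ∈ Icc 0 (h / 2)) :
    dx^[k] v q ^ 2 ≤ rectInt ℓ 0 h (fun q => v q ^ 2) *
      (2 * (1 / ℓ + 2) * (growth A lam (k + 2) * (2 / h) ^ (k + 2)) ^ 2) := by
  set M := rectInt ℓ 0 h (fun q => v q ^ 2) with hMdef
  have hM : 0 ≤ M := rectInt_nonneg fun _ _ => sq_nonneg _
  have hq : q.2 ∈ Icc 0 h := ⟨hy.1, by linarith [hy.2]⟩
  have ht := fun k => S.trace_iterate_le hℓ.le hh h1 hl hC hA hAC hA2 k hy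
  have hcont : Continuous fun x => dx^[k + 1] v (x, q.2) :=
    (S.smooth_v.iterate_dx (k + 1)).cont.comp_continuous (by fun_prop) fun _ => hq
  have hs := sq_le_of_periodic (f := fun x => dx^[k] v (x, q.2))
    (f' := fun x => dx^[k + 1] v (x, q.2)) hℓ (fun x => by
      rw [Function.iterate_succ_apply']
      exact hasDerivAt_dx (p := (x, q.2)) ((S.smooth_v.iterate_dx k).diff hq)) hcont
      (fun x => S.periodic.iterate_dx k x q.2) q.1
  refine hs.trans ?_
  have hmono : growth A lam (k + 1) * (2 / h) ^ (k + 1) ≤ growth A lam (k + 2) * (2 / h) ^ (k + 2) := by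
    have hg := growth_pos hA hl (k + 1)
    have h2 := growth_succ_ge hA hl (k + 1)
    have h3 : 1 ≤ A * ((k + 1 : ℕ) + 1 + lam) := by
      have hA' : 2 ≤ A := by nlinarith
      have : (0 : ℝ) ≤ ((k + 1 : ℕ) : ℝ) := by positivity
      nlinarith
    have h4 : (1 : ℝ) ≤ 2 / h := by rw [le_div_iff₀ hh]; linarith
    refine mul_le_mul ?_ (pow_le_pow_right₀ h4 (by omega)) (by positivity)
      (growth_pos hA hl _).le
    nlinarith
  have hp1 : 0 ≤ growth A lam (k + 1) * (2 / h) ^ (k + 1) := by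
    have := growth_pos hA hl (k + 1)
    positivity
  calc _ ≤ (1 / ℓ + 1) * (M * (2 * (growth A lam (k + 2) * (2 / h) ^ (k + 2)) ^ 2)) +
        M * (2 * (growth A lam (k + 2) * (2 / h) ^ (k + 2)) ^ 2) := by
        gcongr
        · refine (ht k).trans ?_
          gcongr
        · exact ht (k + 1)
    _ = _ := by ring

end StripSolution

lemma succ_mul_succ_le_four_pow (k : ℕ) : (k + 1 + 1) * (k + 1) ≤ 2 * 4 ^ k := by
  induction k with
  | zero => norm_num
  | succ k ih => rw [pow_succ]; nlinarith

/-- Interior derivative estimates for strip solutions, with analytic growth. -/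
theorem exists_derivative_bound (hℓ : 0 < ℓ) (hh : 0 < h) (h1 : h ≤ 1) (hC : 0 ≤ C) :
    ∃ A₁ > 0, ∃ C₁ > 0, ∀ lam > 0, ∀ p v : ℝ × ℝ → ℝ, StripSolution ℓ h C lam p v →
      ∀ k (q : ℝ × ℝ), q.2 ∈ Icc 0 (h / 2) → |dx^[k] v q| ≤
        C₁ * Real.exp lam * √(rectInt ℓ 0 h (fun q => v q ^ 2)) * (k.factorial * A₁ ^ k) := by
  set A : ℝ := 2 * C + 2 with hAd
  have hA : 0 < A := by positivity
  have hAC : 2 * C ≤ A := by linarith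
  have hA2 : 4 * C + 4 ≤ A ^ 2 := by rw [hAd]; nlinarith
  set b : ℝ := 2 / h * (A * Real.exp 1) with hb
  have hb0 : 0 < b := by positivity
  refine ⟨4 * b, by positivity, √(2 * (1 / ℓ + 2)) * (2 * b ^ 2), by positivity, ?_⟩
  intro lam hl p v S k q hq
  set M := rectInt ℓ 0 h (fun q => v q ^ 2) with hMdef
  have hM : 0 ≤ M := rectInt_nonneg fun _ _ => sq_nonneg _
  have h2 := Real.abs_le_sqrt (S.sq_iterate_le hℓ hh h1 hl hC hA hAC hA2 k q hq)
  have hg := growth_pos hA hl (k + 2)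
  rw [Real.sqrt_mul hM, Real.sqrt_mul (by positivity), Real.sqrt_sq (by positivity)] at h2
  refine h2.trans ?_
  have hk : (((k + 2).factorial : ℕ) : ℝ) ≤ 2 * 4 ^ k * k.factorial := by
    have : (k + 2).factorial ≤ 2 * 4 ^ k * k.factorial := by
      rw [Nat.factorial_succ, Nat.factorial_succ, ← mul_assoc]
      exact Nat.mul_le_mul_right _ (succ_mul_succ_le_four_pow k)
    exact_mod_cast this
  have hgr : growth A lam (k + 2) * (2 / h) ^ (k + 2) ≤
      (2 * b ^ 2) * Real.exp lam * (k.factorial * (4 * b) ^ k) := by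
    calc _ ≤ ((k + 2).factorial * (A * Real.exp 1) ^ (k + 2) * Real.exp lam) *
          (2 / h) ^ (k + 2) := by
          gcongr
          exact growth_le hA hl _
      _ = (k + 2).factorial * b ^ (k + 2) * Real.exp lam := by
          have hbk : b ^ (k + 2) = (2 / h) ^ (k + 2) * (A * Real.exp 1) ^ (k + 2) := by
            rw [hb, mul_pow]
          rw [hbk]; ring
      _ ≤ (2 * 4 ^ k * k.factorial) * b ^ (k + 2) * Real.exp lam := by gcongr
      _ = _ := by rw [mul_pow 4 b k]; ring
  calc _ ≤ √M * (√(2 * (1 / ℓ + 2)) * ((2 * b ^ 2) * Real.exp lam *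
        (k.factorial * (4 * b) ^ k))) := by gcongr
    _ = _ := by ring

end InteriorBound

section CauchyKovalevskaya
open Set Filter Topology

variable {v p : ℝ × ℝ → ℝ} {ℓ h C lam A : ℝ}

lemma abs_le_of_deriv_two_le {f f₁ f₂ g g₁ g₂ : ℝ → ℝ} {h : ℝ}
    (hf : ∀ y ∈ Icc 0 h, HasDerivAt f (f₁ y) y) (hf₁ : ∀ y ∈ Icc 0 h, HasDerivAt f₁ (f₂ y) y)
    (hg : ∀ y, HasDerivAt g (g₁ y) y) (hg₁ : ∀ y, HasDerivAt g₁ (g₂ y) y)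
    (h0 : |f 0| ≤ g 0) (h1 : |f₁ 0| ≤ g₁ 0) (h2 : ∀ y ∈ Icc 0 h, |f₂ y| ≤ g₂ y) :
    ∀ y ∈ Icc 0 h, |f y| ≤ g y := by
  have key : ∀ y ∈ Icc 0 h, ‖f₁ y‖ ≤ g₁ y := fun y hy =>
    image_norm_le_of_norm_deriv_right_le_deriv_boundary
      (fun x hx => (hf₁ x hx).continuousAt.continuousWithinAt)
      (fun x hx => (hf₁ x ⟨hx.1, hx.2.le⟩).hasDerivWithinAt) h1 hg₁
      (fun x hx => h2 x ⟨hx.1, hx.2.le⟩) hy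
  exact fun y hy => image_norm_le_of_norm_deriv_right_le_deriv_boundary
      (fun x hx => (hf x hx).continuousAt.continuousWithinAt)
      (fun x hx => (hf x ⟨hx.1, hx.2.le⟩).hasDerivWithinAt) h0 hg
      (fun x hx => key x ⟨hx.1, hx.2.le⟩) hy

/-- The majorant in the Cauchy–Kovalevskaya iteration. -/
def majorant (A lam N M : ℝ) (n k : ℕ) (y : ℝ) : ℝ :=
  ∑ i ∈ Finset.range n, N * (2 ^ i * growth A lam (k + 2 * i)) * (y ^ (2 * i) / (2 * i).factorial) +
    M * (2 ^ n * growth A lam (k + 2 * n)) * (y ^ (2 * n) / (2 * n).factorial)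

lemma hasDerivAt_pow_div_factorial (n : ℕ) (y : ℝ) :
    HasDerivAt (fun y : ℝ => y ^ (n + 1) / (n + 1).factorial) (y ^ n / n.factorial) y := by
  refine ((hasDerivAt_pow (n + 1) y).div_const ((n + 1).factorial : ℝ)).congr_deriv ?_
  rw [Nat.factorial_succ]
  push_cast
  field_simp

lemma majorant_eq_deriv_two (A lam N M : ℝ) (n k : ℕ) : ∃ g₁ : ℝ → ℝ,
    (∀ y, HasDerivAt (majorant A lam N M (n + 1) k) (g₁ y) y) ∧ g₁ 0 = 0 ∧
    ∀ y, HasDerivAt g₁ (∑ i ∈ Finset.range n,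
      N * (2 ^ (i + 1) * growth A lam (k + 2 * i + 2)) * (y ^ (2 * i) / (2 * i).factorial) +
    M * (2 ^ (n + 1) * growth A lam (k + 2 * n + 2)) * (y ^ (2 * n) / (2 * n).factorial)) y := by
  refine ⟨fun y => ∑ i ∈ Finset.range n, N * (2 ^ (i + 1) * growth A lam (k + 2 * i + 2)) *
      (y ^ (2 * i + 1) / (2 * i + 1).factorial) +
    M * (2 ^ (n + 1) * growth A lam (k + 2 * n + 2)) *
      (y ^ (2 * n + 1) / (2 * n + 1).factorial), ?_, by simp, ?_⟩
  · intro y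
    have e : majorant A lam N M (n + 1) k = fun y =>
        (∑ i ∈ Finset.range n, N * (2 ^ (i + 1) * growth A lam (k + 2 * i + 2)) *
          (y ^ (2 * i + 1 + 1) / (2 * i + 1 + 1).factorial) +
        M * (2 ^ (n + 1) * growth A lam (k + 2 * n + 2)) *
          (y ^ (2 * n + 1 + 1) / (2 * n + 1 + 1).factorial)) +
        N * growth A lam k := by
      funext y
      unfold majorant
      rw [Finset.sum_range_succ', add_right_comm]
      congr 1
      simp
    rw [e]
    exact ((HasDerivAt.fun_sum fun i _ => (hasDerivAt_pow_div_factorial _ y).const_mul _).fun_add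
      ((hasDerivAt_pow_div_factorial _ y).const_mul _)).add_const _
  · intro y
    exact (HasDerivAt.fun_sum fun i _ => (hasDerivAt_pow_div_factorial _ y).const_mul _).fun_add
      ((hasDerivAt_pow_div_factorial _ y).const_mul _)

lemma majorant_zero_ge (N M : ℝ) (n k : ℕ) :
    N * growth A lam k ≤ majorant A lam N M (n + 1) k 0 := by
  unfold majorant
  rw [Finset.sum_range_succ']
  simp

lemma lam_sq_mul_sum_le (hA : 0 < A) (hl : 0 < lam) (hC : 0 ≤ C) (hAC : 2 * C ≤ A)
    (hA2 : 2 * C ≤ A ^ 2) (k m : ℕ) :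
    lam ^ 2 * ∑ j ∈ Finset.range (k + 1), C ^ (j + 1) * (k : ℝ) ^ j * growth A lam (k - j + m) ≤
      growth A lam (k + m + 2) := by
  have hg := growth_pos hA hl (k + m)
  calc _ ≤ lam ^ 2 * (2 * C * growth A lam (k + m)) := by
        gcongr
        exact sum_mul_growth_le hA hl hC hAC k m
    _ ≤ lam ^ 2 * (A ^ 2 * growth A lam (k + m)) := by gcongr
    _ = (A * lam) ^ 2 * growth A lam (k + m) := by ring
    _ ≤ _ := growth_add_two_ge hA hl _

lemma majorant_step (hA : 0 < A) (hl : 0 < lam) (hC : 0 ≤ C) (hAC : 2 * C ≤ A)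
    (hA2 : 2 * C ≤ A ^ 2) {N M : ℝ} (hN : 0 ≤ N) (hM : 0 ≤ M) (n k : ℕ) {y : ℝ} (hy : 0 ≤ y) :
    majorant A lam N M n (k + 2) y +
      lam ^ 2 * ∑ j ∈ Finset.range (k + 1), C ^ (j + 1) * (k : ℝ) ^ j *
        majorant A lam N M n (k - j) y ≤
    ∑ i ∈ Finset.range n,
      N * (2 ^ (i + 1) * growth A lam (k + 2 * i + 2)) * (y ^ (2 * i) / (2 * i).factorial) +
    M * (2 ^ (n + 1) * growth A lam (k + 2 * n + 2)) * (y ^ (2 * n) / (2 * n).factorial) := by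
  have e : lam ^ 2 * ∑ j ∈ Finset.range (k + 1), C ^ (j + 1) * (k : ℝ) ^ j *
        majorant A lam N M n (k - j) y =
      ∑ i ∈ Finset.range n, N * 2 ^ i * (lam ^ 2 * ∑ j ∈ Finset.range (k + 1),
        C ^ (j + 1) * (k : ℝ) ^ j * growth A lam (k - j + 2 * i)) *
          (y ^ (2 * i) / (2 * i).factorial) +
      M * 2 ^ n * (lam ^ 2 * ∑ j ∈ Finset.range (k + 1),
        C ^ (j + 1) * (k : ℝ) ^ j * growth A lam (k - j + 2 * n)) *
          (y ^ (2 * n) / (2 * n).factorial) := by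
    unfold majorant
    simp only [mul_add, Finset.sum_add_distrib, Finset.mul_sum, Finset.sum_mul]
    rw [Finset.sum_comm]
    congr 1
    · refine Finset.sum_congr rfl fun _ _ => Finset.sum_congr rfl fun _ _ => by ring
    · exact Finset.sum_congr rfl fun _ _ => by ring
  rw [e]
  unfold majorant
  have hb := lam_sq_mul_sum_le hA hl hC hAC hA2 k
  rw [add_add_add_comm, ← Finset.sum_add_distrib]
  refine add_le_add (Finset.sum_le_sum fun i _ => ?_) ?_
  · calc _ ≤ N * (2 ^ i * growth A lam (k + 2 + 2 * i)) * (y ^ (2 * i) / (2 * i).factorial) +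
        N * 2 ^ i * (growth A lam (k + 2 * i + 2)) * (y ^ (2 * i) / (2 * i).factorial) := by
          gcongr
          exact hb _
      _ = _ := by rw [show k + 2 + 2 * i = k + 2 * i + 2 by ring]; ring
  · calc _ ≤ M * (2 ^ n * growth A lam (k + 2 + 2 * n)) * (y ^ (2 * n) / (2 * n).factorial) +
        M * 2 ^ n * (growth A lam (k + 2 * n + 2)) * (y ^ (2 * n) / (2 * n).factorial) := by
          gcongr
          exact hb _
      _ = _ := by rw [show k + 2 + 2 * n = k + 2 * n + 2 by ring]; ring

lemma growth_add_le (hA : 0 < A) (hl : 0 < lam) (k m : ℕ) :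
    growth A lam (k + m) ≤ (k.factorial * (2 * A * Real.exp 1) ^ k * Real.exp lam) *
      (m.factorial * (2 * A * Real.exp 1) ^ m) := by
  refine (growth_le hA hl _).trans ?_
  have h1 : (k + m).factorial ≤ 2 ^ (k + m) * (k.factorial * m.factorial) := by
    rw [← Nat.add_choose_mul_factorial_mul_factorial, mul_assoc]
    exact Nat.mul_le_mul_right _ (Nat.choose_le_two_pow _ _)
  have h2 : (((k + m).factorial : ℕ) : ℝ) ≤ 2 ^ (k + m) * (k.factorial * m.factorial) := by
    exact_mod_cast h1
  calc _ ≤ (2 ^ (k + m) * (k.factorial * m.factorial)) * (A * Real.exp 1) ^ (k + m) *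
        Real.exp lam := by gcongr
    _ = _ := by
        rw [mul_assoc 2 A, mul_pow 2, mul_pow 2, pow_add, pow_add]; ring

lemma majorant_le (hA : 0 < A) (hl : 0 < lam) {N M : ℝ} (hN : 0 ≤ N) (hM : 0 ≤ M) (n k : ℕ)
    {y : ℝ} (hy : 0 ≤ y) (hy1 : 4 * A * Real.exp 1 * y ≤ 1) :
    majorant A lam N M n k y ≤ (k.factorial * (2 * A * Real.exp 1) ^ k * Real.exp lam) *
      (2 * N + M * (1 / 2) ^ n) := by
  set D := 2 * A * Real.exp 1 with hD
  have hD0 : 0 < D := by positivity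
  have hDy : 2 * (D * y) ^ 2 ≤ 1 / 2 := by
    have : D * y ≤ 1 / 2 := by rw [hD]; linarith
    have h0 : 0 ≤ D * y := by positivity
    nlinarith
  have hterm : ∀ i : ℕ, 2 ^ i * growth A lam (k + 2 * i) * (y ^ (2 * i) / (2 * i).factorial) ≤
      (k.factorial * D ^ k * Real.exp lam) * (1 / 2) ^ i := by
    intro i
    calc _ ≤ 2 ^ i * ((k.factorial * D ^ k * Real.exp lam) * ((2 * i).factorial * D ^ (2 * i))) *
          (y ^ (2 * i) / (2 * i).factorial) := by
          gcongr
          exact growth_add_le hA hl k _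
      _ = (k.factorial * D ^ k * Real.exp lam) * (2 * (D * y) ^ 2) ^ i := by
          rw [mul_pow 2 ((D * y) ^ 2), ← pow_mul, mul_pow D y]
          field_simp
      _ ≤ _ := by gcongr
  unfold majorant
  rw [mul_add]
  refine add_le_add ?_ ?_
  · calc _ ≤ ∑ i ∈ Finset.range n, N * (k.factorial * D ^ k * Real.exp lam) * (1 / 2) ^ i := by
          refine Finset.sum_le_sum fun i _ => ?_
          have := mul_le_mul_of_nonneg_left (hterm i) hN
          linarith
      _ = N * (k.factorial * D ^ k * Real.exp lam) * ∑ i ∈ Finset.range n, (1 / 2 : ℝ) ^ i := by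
          rw [Finset.mul_sum]
      _ ≤ N * (k.factorial * D ^ k * Real.exp lam) * 2 := by
          gcongr
          exact sum_geometric_two_le _
      _ = _ := by ring
  · have := mul_le_mul_of_nonneg_left (hterm n) hM
    linarith

namespace StripSolution

lemma iterate_le_majorant (S : StripSolution ℓ h C lam p v) (hh : 0 < h) (hC : 0 ≤ C)
    (hA : 0 < A) (hl : 0 < lam) (hAC : 2 * C ≤ A) (hA2 : 2 * C ≤ A ^ 2)
    {N M δ : ℝ} (hN : 0 ≤ N) (hM : 0 ≤ M) (hδ : δ ≤ h)
    (hv : ∀ k (q : ℝ × ℝ), q.2 ∈ Icc 0 δ → |dx^[k] v q| ≤ M * growth A lam k)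
    (hv0 : ∀ k x, |dx^[k] v (x, 0)| ≤ N * growth A lam k) (n : ℕ) :
    ∀ k (q : ℝ × ℝ), q.2 ∈ Icc 0 δ → |dx^[k] v q| ≤ majorant A lam N M n k q.2 := by
  induction n with
  | zero =>
    intro k q hq
    simpa [majorant] using hv k q hq
  | succ n ih =>
    intro k q hq
    obtain ⟨g₁, hg, hg0, hg₁⟩ := majorant_eq_deriv_two A lam N M n k
    have hsub : ∀ {y}, y ∈ Icc 0 δ → y ∈ Icc 0 h := fun hy => ⟨hy.1, hy.2.trans hδ⟩
    have hw := S.smooth_v.iterate_dx k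
    refine abs_le_of_deriv_two_le (f := fun y => dx^[k] v (q.1, y))
      (f₁ := fun y => dy (dx^[k] v) (q.1, y)) (f₂ := fun y => dy (dy (dx^[k] v)) (q.1, y))
      (fun y hy => hasDerivAt_dy (p := (q.1, y)) (hw.diff (hsub hy)))
      (fun y hy => hasDerivAt_dy (p := (q.1, y)) (hw.dy.diff (hsub hy))) hg hg₁
      ((hv0 k q.1).trans (majorant_zero_ge N M n k)) ?_ ?_ q.2 hq
    · have h0 : (0 : ℝ) ∈ Icc 0 h := ⟨le_rfl, hh.le⟩
      rw [← iterate_dx_dy S.smooth_v k (q.1, 0) h0, hg0]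
      have h1 := congrFun (iteratedDeriv_slice S.smooth_v.dy h0 k) q.1
      rw [← h1]
      have : (fun x => dy v (x, 0)) = fun _ => 0 := funext S.neumann
      rw [this]
      simp
    · intro y hy
      refine le_trans ?_ (majorant_step hA hl hC hAC hA2 hN hM n k hy.1)
      have h1 := S.abs_lap_iterate_le hh hC k (q.1, y) (hsub hy)
      have h2 := ih (k + 2) (q.1, y) hy
      rw [Function.iterate_succ_apply', Function.iterate_succ_apply'] at h2
      have h3 : ∑ j ∈ Finset.range (k + 1), C ^ (j + 1) * (k : ℝ) ^ j * |dx^[k - j] v (q.1, y)| ≤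
          ∑ j ∈ Finset.range (k + 1), C ^ (j + 1) * (k : ℝ) ^ j *
            majorant A lam N M n (k - j) y := by
        refine Finset.sum_le_sum fun j _ => ?_
        gcongr
        exact ih (k - j) (q.1, y) hy
      have h4 := mul_le_mul_of_nonneg_left h3 (sq_nonneg lam)
      have h5 := abs_sub (dx (dx (dx^[k] v)) (q.1, y) + dy (dy (dx^[k] v)) (q.1, y))
        (dx (dx (dx^[k] v)) (q.1, y))
      rw [add_sub_cancel_left] at h5
      dsimp only at h2 ⊢
      linarith

lemma iterate_le (S : StripSolution ℓ h C lam p v) (hh : 0 < h) (hC : 0 ≤ C)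
    (hA : 0 < A) (hl : 0 < lam) (hAC : 2 * C ≤ A) (hA2 : 2 * C ≤ A ^ 2)
    {N M δ : ℝ} (hN : 0 ≤ N) (hM : 0 ≤ M) (hδ : δ ≤ h) (hδ1 : 4 * A * Real.exp 1 * δ ≤ 1)
    (hv : ∀ k (q : ℝ × ℝ), q.2 ∈ Icc 0 δ → |dx^[k] v q| ≤ M * growth A lam k)
    (hv0 : ∀ k x, |dx^[k] v (x, 0)| ≤ N * growth A lam k)
    (k : ℕ) (q : ℝ × ℝ) (hq : q.2 ∈ Icc 0 δ) :
    |dx^[k] v q| ≤ (k.factorial * (2 * A * Real.exp 1) ^ k * Real.exp lam) * (2 * N) := by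
  have hlim : Tendsto (fun n : ℕ => (k.factorial * (2 * A * Real.exp 1) ^ k * Real.exp lam) *
      (2 * N + M * (1 / 2) ^ n)) atTop
      (𝓝 ((k.factorial * (2 * A * Real.exp 1) ^ k * Real.exp lam) * (2 * N + M * 0))) :=
    (((tendsto_pow_atTop_nhds_zero_of_lt_one (by norm_num) (by norm_num)).const_mul M).const_add
      _).const_mul _
  rw [mul_zero, add_zero] at hlim
  refine ge_of_tendsto' hlim fun n => ?_
  refine (S.iterate_le_majorant hh hC hA hl hAC hA2 hN hM hδ hv hv0 n k q hq).trans ?_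
  refine majorant_le hA hl hN hM n k hq.1 (le_trans ?_ hδ1)
  gcongr
  exact hq.2

end StripSolution

/-- Either a strip solution is uniformly small near `y = 0`, or its trace on `y = 0` has few
zeros. -/
theorem exists_strip_dichotomy (hℓ : 0 < ℓ) (hh : 0 < h) (h1 : h ≤ 1) (hC : 0 ≤ C) :
    ∃ δ > 0, δ ≤ h ∧ ∃ ρ > 0, ρ < 1 ∧ ∃ C₁ > 0, ∃ C₂ > 0, ∀ lam > 0, ∀ p v : ℝ × ℝ → ℝ,
      StripSolution ℓ h C lam p v → AnalyticOnNhd ℝ (fun x => v (x, 0)) univ → ∀ N > 0,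
      (∀ q : ℝ × ℝ, q.2 ∈ Icc 0 δ → |v q| ≤ C₂ * Real.exp (3 * lam) * N ∧
        |dx v q| ≤ C₂ * Real.exp (3 * lam) * N ∧ |dy v q| ≤ C₂ * Real.exp (3 * lam) * N) ∨
      (∀ (Z : Finset ℝ) (m : ℝ → ℕ), (∀ a ∈ Z, a ∈ Ico 0 ℓ) →
        (∀ a ∈ Z, ∀ i < m a, iteratedDeriv i (fun x => v (x, 0)) a = 0) →
        N ≤ C₁ * Real.exp lam * √(rectInt ℓ 0 h (fun q => v q ^ 2)) * ρ ^ (∑ a ∈ Z, m a)) := by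
  obtain ⟨A₁, hA₁, C₁, hC₁, hder⟩ := exists_derivative_bound hℓ hh h1 hC
  obtain ⟨ρ, hρ, hρ1, hcount⟩ := exists_zero_count_bound (r := 1 / A₁) (by positivity) hℓ
  set A : ℝ := 2 * C + 1 + 4 * A₁ with hAd
  have hA : 0 < A := by positivity
  have hAC : 2 * C ≤ A := by rw [hAd]; linarith
  have hA2 : 2 * C ≤ A ^ 2 := by rw [hAd]; nlinarith
  set D : ℝ := 2 * A * Real.exp 1 with hD
  have hD0 : 0 < D := by positivity
  set K : ℝ := 2 + 2 * D + 4 * D ^ 2 + 2 * C with hK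
  have hK0 : 0 < K := by positivity
  refine ⟨min (h / 2) (1 / (2 * D)), by positivity, (min_le_left _ _).trans (by linarith),
    ρ, hρ, hρ1, 2 * C₁, by positivity, K, hK0, ?_⟩
  intro lam hl p v S hu N hN
  set δ := min (h / 2) (1 / (2 * D)) with hδ
  have hδ0 : 0 < δ := by positivity
  have hδh : δ ≤ h / 2 := min_le_left _ _
  have hδD : 4 * A * Real.exp 1 * δ ≤ 1 := by
    have : δ ≤ 1 / (2 * D) := min_le_right _ _
    rw [le_div_iff₀ (by positivity)] at this
    rw [hD] at this
    linarith
  set M := C₁ * Real.exp lam * √(rectInt ℓ 0 h (fun q => v q ^ 2)) with hM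
  have hM0 : 0 ≤ M := by positivity
  have hd := hder lam hl p v S
  rw [← hM] at hd
  have hfac : ∀ k : ℕ, k.factorial * A₁ ^ k ≤ growth A lam k := fun k =>
    le_trans (by gcongr; rw [hAd]; linarith) (factorial_le_growth hA hl k)
  have h0 : (0 : ℝ) ∈ Icc 0 h := ⟨le_rfl, hh.le⟩
  by_cases hsmall : ∀ k x, |dx^[k] v (x, 0)| ≤ N * growth A lam k
  · left
    have hb := S.iterate_le hh hC hA hl hAC hA2 hN.le hM0 (by linarith) hδD
      (fun k q hq => (hd k q ⟨hq.1, hq.2.trans hδh⟩).trans (by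
        gcongr
        exact hfac k)) hsmall
    rw [← hD] at hb
    have he1 : Real.exp lam ≤ Real.exp (3 * lam) := Real.exp_le_exp.mpr (by linarith)
    have he2 : lam ^ 2 * Real.exp lam ≤ Real.exp (3 * lam) := by
      have : lam ≤ Real.exp lam := by linarith [Real.add_one_le_exp lam]
      calc _ ≤ Real.exp lam ^ 2 * Real.exp lam := by gcongr
        _ = Real.exp (3 * lam) := by
          rw [← pow_succ, ← Real.exp_nat_mul]; norm_num
    set E := Real.exp (3 * lam) with hE
    have hE0 : 0 < E := Real.exp_pos _
    have hv : ∀ q : ℝ × ℝ, q.2 ∈ Icc 0 δ → |v q| ≤ Real.exp lam * (2 * N) := fun q hq => by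
      simpa using hb 0 q hq
    have hv1 : ∀ q : ℝ × ℝ, q.2 ∈ Icc 0 δ → |dx v q| ≤ D * Real.exp lam * (2 * N) :=
      fun q hq => by simpa using hb 1 q hq
    have hv2 : ∀ q : ℝ × ℝ, q.2 ∈ Icc 0 δ →
        |dx (dx v) q| ≤ 2 * D ^ 2 * Real.exp lam * (2 * N) :=
      fun q hq => by simpa using hb 2 q hq
    have hyy : ∀ q : ℝ × ℝ, q.2 ∈ Icc 0 δ → |dy (dy v) q| ≤ K * E * N := by
      intro q hq
      have hqh : q.2 ∈ Icc 0 h := ⟨hq.1, hq.2.trans (by linarith)⟩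
      have h3 := S.abs_lap_iterate_le hh hC 0 q hqh
      simp only [zero_add, Finset.range_one, Finset.sum_singleton, pow_one, pow_zero, mul_one,
        Nat.sub_self, Function.iterate_zero, id_eq] at h3
      have h5 := abs_sub (dx (dx v) q + dy (dy v) q) (dx (dx v) q)
      rw [add_sub_cancel_left] at h5
      have h6 : lam ^ 2 * (C * |v q|) ≤ lam ^ 2 * (C * (Real.exp lam * (2 * N))) := by
        gcongr
        exact hv q hq
      have h7 : lam ^ 2 * (C * (Real.exp lam * (2 * N))) ≤ 2 * C * E * N := by
        calc _ = 2 * C * (lam ^ 2 * Real.exp lam) * N := by ring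
          _ ≤ _ := by gcongr
      have h8 : 2 * D ^ 2 * Real.exp lam * (2 * N) ≤ 4 * D ^ 2 * E * N := by
        calc _ = 4 * D ^ 2 * Real.exp lam * N := by ring
          _ ≤ _ := by gcongr
      have h9 : K * E * N = 2 * C * E * N + 4 * D ^ 2 * E * N + (2 + 2 * D) * E * N := by
        rw [hK]; ring
      have h10 : 0 ≤ (2 + 2 * D) * E * N := by positivity
      linarith [hv2 q hq]
    intro q hq
    refine ⟨?_, ?_, ?_⟩
    · refine (hv q hq).trans ?_
      calc _ = 2 * Real.exp lam * N := by ring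
        _ ≤ K * E * N := by
          gcongr
          rw [hK]; nlinarith
    · refine (hv1 q hq).trans ?_
      calc _ = 2 * D * Real.exp lam * N := by ring
        _ ≤ K * E * N := by
          gcongr
          rw [hK]; nlinarith
    · have hS := S.smooth_v.dy
      have := (convex_Icc (0 : ℝ) δ).norm_image_sub_le_of_norm_hasDerivWithin_le
        (f := fun y => dy v (q.1, y)) (f' := fun y => dy (dy v) (q.1, y)) (C := K * E * N)
        (fun y hy => (hasDerivAt_dy (p := (q.1, y))
          (hS.diff (show y ∈ Icc 0 h from ⟨hy.1, hy.2.trans (by linarith)⟩))).hasDerivWithinAt)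
        (fun y hy => hyy (q.1, y) hy) (x := 0) (y := q.2) ⟨le_rfl, hδ0.le⟩ hq
      rw [S.neumann, sub_zero, sub_zero, Real.norm_eq_abs, Real.norm_eq_abs,
        abs_of_nonneg hq.1] at this
      refine this.trans ?_
      have : q.2 ≤ 1 := by linarith [hq.2]
      calc _ ≤ K * E * N * 1 := by gcongr
        _ = _ := mul_one _
  · right
    push Not at hsmall
    obtain ⟨k, x, hkx⟩ := hsmall
    intro Z m hZ hm
    have hsl := fun k => iteratedDeriv_slice S.smooth_v h0 k
    have := hcount (fun x => v (x, 0)) M N hu (fun x => S.periodic x 0) (fun n x => ?_) x k ?_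
      Z m hZ hm
    · rw [hM] at this
      linarith
    · rw [hsl n]
      refine (hd n (x, 0) ⟨le_rfl, by positivity⟩).trans_eq ?_
      rw [div_pow, one_pow]
      field_simp
    · rw [hsl k]
      calc N * k.factorial = N * (k.factorial * (4 * A₁) ^ k) * (1 / A₁ / 4) ^ k := by
            rw [mul_assoc, mul_assoc, ← mul_pow]
            field_simp
            simp
        _ ≤ N * growth A lam k * (1 / A₁ / 4) ^ k := by
            gcongr
            refine le_trans ?_ (factorial_le_growth hA hl k)
            gcongr
            rw [hAd]; linarith
        _ ≤ _ := by
            gcongr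

end CauchyKovalevskaya

section Flat
open Set Filter Topology

variable {f g : ℝ × ℝ → ℝ} {c : ℝ × ℝ}

lemma AnalyticAt.partial_x (hf : AnalyticAt ℝ f c) : AnalyticAt ℝ (dx f) c :=
  ((ContinuousLinearMap.apply ℝ ℝ ((1 : ℝ), (0 : ℝ))).analyticAt _).comp hf.fderiv

lemma AnalyticAt.partial_y (hf : AnalyticAt ℝ f c) : AnalyticAt ℝ (dy f) c :=
  ((ContinuousLinearMap.apply ℝ ℝ ((0 : ℝ), (1 : ℝ))).analyticAt _).comp hf.fderiv

lemma Filter.EventuallyEq.partial_x (h : f =ᶠ[𝓝 c] g) : dx f =ᶠ[𝓝 c] dx g :=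
  h.fderiv.fun_comp fun L => L (1, 0)

lemma Filter.EventuallyEq.partial_y (h : f =ᶠ[𝓝 c] g) : dy f =ᶠ[𝓝 c] dy g :=
  h.fderiv.fun_comp fun L => L (0, 1)

lemma Filter.EventuallyEq.partial_x_iterate (h : f =ᶠ[𝓝 c] g) (k : ℕ) : dx^[k] f =ᶠ[𝓝 c] dx^[k] g := by
  induction k with
  | zero => exact h
  | succ k ih => simpa only [Function.iterate_succ_apply'] using ih.partial_x

lemma AnalyticAt.partial_x_iterate (hf : AnalyticAt ℝ f c) (k : ℕ) : AnalyticAt ℝ (dx^[k] f) c := by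
  induction k with
  | zero => exact hf
  | succ k ih => simpa only [Function.iterate_succ_apply'] using ih.partial_x

lemma AnalyticAt.partial_comm (hf : AnalyticAt ℝ f c) : dx (dy f) =ᶠ[𝓝 c]
    dy (dx f) := by
  filter_upwards [hf.eventually_analyticAt] with z hz
  exact dx_dy_comm hz.contDiffAt

lemma AnalyticAt.partial_x_add (hf : AnalyticAt ℝ f c) (hg : AnalyticAt ℝ g c) :
    dx (f + g) =ᶠ[𝓝 c] dx f + dx g := by
  filter_upwards [hf.eventually_analyticAt, hg.eventually_analyticAt] with z hz hz'
  exact dx_add hz.differentiableAt hz'.differentiableAt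

lemma AnalyticAt.partial_y_add (hf : AnalyticAt ℝ f c) (hg : AnalyticAt ℝ g c) :
    dy (f + g) =ᶠ[𝓝 c] dy f + dy g := by
  filter_upwards [hf.eventually_analyticAt, hg.eventually_analyticAt] with z hz hz'
  exact dy_add hz.differentiableAt hz'.differentiableAt

lemma AnalyticAt.partial_x_iterate_add (hf : AnalyticAt ℝ f c) (hg : AnalyticAt ℝ g c) (k : ℕ) :
    dx^[k] (f + g) =ᶠ[𝓝 c] dx^[k] f + dx^[k] g := by
  induction k with
  | zero => rfl
  | succ k ih =>
    simp only [Function.iterate_succ_apply']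
    exact ih.partial_x.trans ((hf.partial_x_iterate k).partial_x_add (hg.partial_x_iterate k))

lemma AnalyticAt.partial_x_mul (hf : AnalyticAt ℝ f c) (hg : AnalyticAt ℝ g c) :
    dx (f * g) =ᶠ[𝓝 c] dx f * g + f * dx g := by
  filter_upwards [hf.eventually_analyticAt, hg.eventually_analyticAt] with z hz hz'
  have := dx_mul hz.differentiableAt hz'.differentiableAt
  simpa using this

lemma AnalyticAt.partial_y_mul (hf : AnalyticAt ℝ f c) (hg : AnalyticAt ℝ g c) :
    dy (f * g) =ᶠ[𝓝 c] dy f * g + f * dy g := by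
  filter_upwards [hf.eventually_analyticAt, hg.eventually_analyticAt] with z hz hz'
  have := dy_mul hz.differentiableAt hz'.differentiableAt
  simpa using this

/-- All partial derivatives of order less than `n` vanish at `c`. -/
def FlatAt (c : ℝ × ℝ) : ℕ → (ℝ × ℝ → ℝ) → Prop
  | 0, _ => True
  | n + 1, f => f c = 0 ∧ FlatAt c n (dx f) ∧ FlatAt c n (dy f)

lemma FlatAt.congr {n : ℕ} (hf : FlatAt c n f) (h : f =ᶠ[𝓝 c] g) : FlatAt c n g := by
  induction n generalizing f g with
  | zero => trivial
  | succ n ih => exact ⟨h.eq_of_nhds ▸ hf.1, ih hf.2.1 h.partial_x, ih hf.2.2 h.partial_y⟩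

lemma FlatAt.mono {n : ℕ} (hf : FlatAt c (n + 1) f) : FlatAt c n f := by
  induction n generalizing f with
  | zero => trivial
  | succ n ih => exact ⟨hf.1, ih hf.2.1, ih hf.2.2⟩

lemma FlatAt.add {n : ℕ} (hf : FlatAt c n f) (hg : FlatAt c n g) (ha : AnalyticAt ℝ f c)
    (hb : AnalyticAt ℝ g c) : FlatAt c n (f + g) := by
  induction n generalizing f g with
  | zero => trivial
  | succ n ih =>
    refine ⟨by simp [hf.1, hg.1], ?_, ?_⟩
    · exact (ih hf.2.1 hg.2.1 ha.partial_x hb.partial_x).congr (ha.partial_x_add hb).symm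
    · exact (ih hf.2.2 hg.2.2 ha.partial_y hb.partial_y).congr (ha.partial_y_add hb).symm

lemma FlatAt.mul_left {n : ℕ} (hf : FlatAt c n f) (ha : AnalyticAt ℝ f c)
    (hb : AnalyticAt ℝ g c) : FlatAt c n (g * f) := by
  induction n generalizing f g with
  | zero => trivial
  | succ n ih =>
    refine ⟨by simp [hf.1], ?_, ?_⟩
    · exact ((ih hf.mono ha hb.partial_x).add (ih hf.2.1 ha.partial_x hb) (hb.partial_x.mul ha) (hb.mul ha.partial_x)).congr
        (hb.partial_x_mul ha).symm
    · exact ((ih hf.mono ha hb.partial_y).add (ih hf.2.2 ha.partial_y hb) (hb.partial_y.mul ha) (hb.mul ha.partial_y)).congr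
        (hb.partial_y_mul ha).symm

lemma FlatAt.iterate_dx_eq_zero {n : ℕ} (hf : FlatAt c n f) {k : ℕ} (hk : k < n) :
    dx^[k] f c = 0 := by
  induction n generalizing f k with
  | zero => omega
  | succ n ih =>
    cases k with
    | zero => exact hf.1
    | succ k => exact ih hf.2.1 (by omega)

lemma FlatAt.exists_le {n : ℕ} (hf : FlatAt c n f) (ha : AnalyticAt ℝ f c) :
    ∃ C ≥ 0, ∀ᶠ z in 𝓝 c, |f z| ≤ C * ‖z - c‖ ^ n := by
  induction n generalizing f with
  | zero =>
    refine ⟨|f c| + 1, by positivity, ?_⟩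
    have := ha.continuousAt.abs.eventually (gt_mem_nhds (lt_add_one |f c|))
    filter_upwards [this] with z hz
    simpa using hz.le
  | succ n ih =>
    obtain ⟨C₁, h1, hx⟩ := ih hf.2.1 ha.partial_x
    obtain ⟨C₂, h2, hy⟩ := ih hf.2.2 ha.partial_y
    refine ⟨C₁ + C₂, by positivity, ?_⟩
    obtain ⟨ε, hε, hball⟩ := Metric.eventually_nhds_iff_ball.mp
      (hx.and (hy.and ha.eventually_analyticAt))
    filter_upwards [Metric.ball_mem_nhds c hε] with z hz
    have hsub : segment ℝ c z ⊆ Metric.ball c ε :=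
      (convex_ball c ε).segment_subset (Metric.mem_ball_self hε) hz
    have := (convex_segment c z).norm_image_sub_le_of_norm_fderiv_le (𝕜 := ℝ) (f := f)
      (C := (C₁ + C₂) * ‖z - c‖ ^ n) (fun w hw => (hball w (hsub hw)).2.2.differentiableAt)
      (fun w hw => ?_) (left_mem_segment ℝ c z) (right_mem_segment ℝ c z)
    · rw [hf.1, sub_zero, Real.norm_eq_abs] at this
      rw [pow_succ, ← mul_assoc]
      exact this
    · obtain ⟨hwx, hwy, -⟩ := hball w (hsub hw)
      have hwz : ‖w - c‖ ≤ ‖z - c‖ := by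
        rw [segment_eq_image'] at hw
        obtain ⟨t, ht, rfl⟩ := hw
        rw [add_sub_cancel_left, norm_smul, Real.norm_eq_abs, abs_of_nonneg ht.1]
        exact mul_le_of_le_one_left (norm_nonneg _) ht.2
      refine ContinuousLinearMap.opNorm_le_bound _ (by positivity) fun a => ?_
      rw [fderiv_eq_partial]
      have ha1 : |a.1| ≤ ‖a‖ := norm_fst_le a
      have ha2 : |a.2| ≤ ‖a‖ := norm_snd_le a
      have hp : ‖w - c‖ ^ n ≤ ‖z - c‖ ^ n := by gcongr
      have e1 : |dx f w| ≤ C₁ * ‖z - c‖ ^ n := hwx.trans (by gcongr)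
      have e2 : |dy f w| ≤ C₂ * ‖z - c‖ ^ n := hwy.trans (by gcongr)
      refine (abs_add_le _ _).trans ?_
      rw [abs_mul, abs_mul]
      calc _ ≤ ‖a‖ * (C₁ * ‖z - c‖ ^ n) + ‖a‖ * (C₂ * ‖z - c‖ ^ n) := by gcongr
        _ = _ := by ring

/-- Flatness from Cauchy data and a flat Laplacian. -/
lemma flatAt_of_laplacian {n : ℕ} (ha : AnalyticAt ℝ f c) (hg : AnalyticAt ℝ g c)
    (heq : dx (dx f) + dy (dy f) =ᶠ[𝓝 c] g) (h0 : ∀ i < n, dx^[i] f c = 0)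
    (h1 : ∀ i, i + 1 < n → dx^[i] (dy f) c = 0) (hflat : FlatAt c (n - 2) g) : FlatAt c n f := by
  induction n generalizing f g with
  | zero => trivial
  | succ n ih =>
    have hflat' : FlatAt c (n - 2) (dx g) ∧ FlatAt c (n - 2) (dy g) := by
      rcases Nat.lt_or_ge n 2 with h | h
      · rw [Nat.sub_eq_zero_of_le h.le]
        exact ⟨trivial, trivial⟩
      · rw [show n + 1 - 2 = n - 2 + 1 by omega] at hflat
        exact hflat.2
    have hxx := ha.partial_x.partial_x
    have hyy := ha.partial_y.partial_y
    refine ⟨h0 0 (by omega), ?_, ?_⟩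
    · refine ih ha.partial_x hg.partial_x ?_ (fun i hi => h0 (i + 1) (by omega))
        (fun i hi => ?_) hflat'.1
      · refine EventuallyEq.trans ?_ ((hxx.partial_x_add hyy).symm.trans heq.partial_x)
        refine EventuallyEq.rfl.add ?_
        exact ha.partial_comm.symm.partial_y.trans ha.partial_y.partial_comm.symm
      · rw [(ha.partial_comm.symm.partial_x_iterate i).eq_of_nhds]
        exact h1 (i + 1) (by omega)
    · refine ih ha.partial_y hg.partial_y ?_ (fun i hi => h1 i (by omega))
        (fun i hi => ?_) hflat'.2
      · refine EventuallyEq.trans ?_ ((hxx.partial_y_add hyy).symm.trans heq.partial_y)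
        refine EventuallyEq.add ?_ EventuallyEq.rfl
        exact ha.partial_comm.partial_x.trans ha.partial_x.partial_comm
      · have e := ((hxx.partial_x_iterate_add hyy i).symm.trans
          (heq.partial_x_iterate i)).eq_of_nhds
        have e2 := hflat.iterate_dx_eq_zero (k := i) (by omega)
        have e3 := h0 (i + 2) (by omega)
        rw [Function.iterate_succ_apply, Function.iterate_succ_apply] at e3
        rw [e2, Pi.add_apply, e3, zero_add] at e
        exact e

end Flat

section ComplexParts
open Set Filter Topology

/-- The point `x + i y` of the complex plane. -/
def toC (z : ℝ × ℝ) : ℂ := z.1 + z.2 * Complex.I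

/-- The real part of a complex function, in real coordinates. -/
def rePart (F : ℂ → ℂ) (z : ℝ × ℝ) : ℝ := (F (toC z)).re

/-- The imaginary part of a complex function, in real coordinates. -/
def imPart (F : ℂ → ℂ) (z : ℝ × ℝ) : ℝ := (F (toC z)).im

variable {F : ℂ → ℂ} {z : ℝ × ℝ}

@[simp] lemma toC_re (z : ℝ × ℝ) : (toC z).re = z.1 := by simp [toC]

@[simp] lemma toC_im (z : ℝ × ℝ) : (toC z).im = z.2 := by simp [toC]

/-- `toC` as a continuous linear map. -/
def toCL : ℝ × ℝ →L[ℝ] ℂ :=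
  (Complex.ofRealCLM.comp (ContinuousLinearMap.fst ℝ ℝ ℝ)) +
    (Complex.I • Complex.ofRealCLM.comp (ContinuousLinearMap.snd ℝ ℝ ℝ))

lemma toCL_apply (z : ℝ × ℝ) : toCL z = toC z := by simp [toCL, toC, mul_comm]

lemma hasFDerivAt_toC (z : ℝ × ℝ) : HasFDerivAt toC toCL z := by
  have : toC = toCL := funext fun z => (toCL_apply z).symm
  rw [this]
  exact toCL.hasFDerivAt

lemma hasFDerivAt_comp_toC (h : DifferentiableAt ℂ F (toC z)) :
    HasFDerivAt (fun z => F (toC z)) ((deriv F (toC z)) • toCL) z := by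
  have := (h.hasDerivAt.hasFDerivAt.restrictScalars ℝ).comp z (hasFDerivAt_toC z)
  refine this.congr_fderiv ?_
  ext <;> simp [toCL_apply, mul_comm]

lemma hasFDerivAt_rePart (h : DifferentiableAt ℂ F (toC z)) :
    HasFDerivAt (rePart F) (Complex.reCLM.comp ((deriv F (toC z)) • toCL)) z :=
  Complex.reCLM.hasFDerivAt.comp z (hasFDerivAt_comp_toC h)

lemma hasFDerivAt_imPart (h : DifferentiableAt ℂ F (toC z)) :
    HasFDerivAt (imPart F) (Complex.imCLM.comp ((deriv F (toC z)) • toCL)) z :=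
  Complex.imCLM.hasFDerivAt.comp z (hasFDerivAt_comp_toC h)

lemma dx_rePart (h : DifferentiableAt ℂ F (toC z)) : dx (rePart F) z = rePart (deriv F) z := by
  rw [dx, (hasFDerivAt_rePart h).fderiv]
  simp [toCL_apply, rePart, toC]

lemma dy_rePart (h : DifferentiableAt ℂ F (toC z)) : dy (rePart F) z = -imPart (deriv F) z := by
  rw [dy, (hasFDerivAt_rePart h).fderiv]
  simp [toCL_apply, imPart, toC]

lemma dx_imPart (h : DifferentiableAt ℂ F (toC z)) : dx (imPart F) z = imPart (deriv F) z := by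
  rw [dx, (hasFDerivAt_imPart h).fderiv]
  simp [toCL_apply, imPart, toC]

lemma dy_imPart (h : DifferentiableAt ℂ F (toC z)) : dy (imPart F) z = rePart (deriv F) z := by
  rw [dy, (hasFDerivAt_imPart h).fderiv]
  simp [toCL_apply, rePart, toC]

lemma analyticAt_toC (z : ℝ × ℝ) : AnalyticAt ℝ toC z := by
  have : toC = toCL := funext fun z => (toCL_apply z).symm
  rw [this]
  exact toCL.analyticAt z

lemma analyticAt_rePart (h : AnalyticAt ℂ F (toC z)) : AnalyticAt ℝ (rePart F) z :=
  (Complex.reCLM.analyticAt _).comp ((h.restrictScalars (𝕜 := ℝ)).comp (analyticAt_toC z))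

lemma analyticAt_imPart (h : AnalyticAt ℂ F (toC z)) : AnalyticAt ℝ (imPart F) z :=
  (Complex.imCLM.analyticAt _).comp ((h.restrictScalars (𝕜 := ℝ)).comp (analyticAt_toC z))

/-- The holomorphic monomial `(w - s) ^ m`. -/
def monomialC (s : ℝ) (m : ℕ) (w : ℂ) : ℂ := (w - s) ^ m

lemma hasDerivAt_monomialC (s : ℝ) (m : ℕ) (w : ℂ) :
    HasDerivAt (monomialC s m) (m * monomialC s (m - 1) w) w :=
  (((hasDerivAt_id w).sub_const (s : ℂ)).fun_pow m).congr_deriv (by simp [monomialC])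

lemma analyticAt_monomialC (s : ℝ) (m : ℕ) (w : ℂ) : AnalyticAt ℂ (monomialC s m) w := by
  unfold monomialC; fun_prop

lemma dx_rePart_monomialC (s : ℝ) (m : ℕ) :
    dx (rePart (monomialC s m)) = fun z => m * rePart (monomialC s (m - 1)) z := by
  funext z
  rw [dx_rePart (hasDerivAt_monomialC s m _).differentiableAt, rePart,
    (hasDerivAt_monomialC s m _).deriv]
  simp [rePart]

lemma dy_rePart_monomialC (s : ℝ) (m : ℕ) :
    dy (rePart (monomialC s m)) = fun z => -(m * imPart (monomialC s (m - 1)) z) := by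
  funext z
  rw [dy_rePart (hasDerivAt_monomialC s m _).differentiableAt, imPart,
    (hasDerivAt_monomialC s m _).deriv]
  simp [imPart]

lemma dx_imPart_monomialC (s : ℝ) (m : ℕ) :
    dx (imPart (monomialC s m)) = fun z => m * imPart (monomialC s (m - 1)) z := by
  funext z
  rw [dx_imPart (hasDerivAt_monomialC s m _).differentiableAt, imPart,
    (hasDerivAt_monomialC s m _).deriv]
  simp [imPart]

lemma dy_imPart_monomialC (s : ℝ) (m : ℕ) :
    dy (imPart (monomialC s m)) = fun z => m * rePart (monomialC s (m - 1)) z := by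
  funext z
  rw [dy_imPart (hasDerivAt_monomialC s m _).differentiableAt, rePart,
    (hasDerivAt_monomialC s m _).deriv]
  simp [rePart]

lemma dx_const_mul (c : ℝ) (f : ℝ × ℝ → ℝ) : dx (fun z => c * f z) = fun z => c * dx f z := by
  funext z
  have : (fun z => c * f z) = c • f := rfl
  simp [dx, this, fderiv_const_smul_field]

lemma dy_const_mul (c : ℝ) (f : ℝ × ℝ → ℝ) : dy (fun z => c * f z) = fun z => c * dy f z := by
  funext z
  have : (fun z => c * f z) = c • f := rfl
  simp [dy, this, fderiv_const_smul_field]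

lemma iterate_dx_rePart_monomialC (s : ℝ) (m i : ℕ) :
    dx^[i] (rePart (monomialC s m)) =
      fun z => m.descFactorial i * rePart (monomialC s (m - i)) z := by
  induction i with
  | zero => simp
  | succ i ih =>
    rw [Function.iterate_succ_apply', ih, dx_const_mul, dx_rePart_monomialC]
    funext z
    rw [Nat.descFactorial_succ, Nat.sub_sub]
    push_cast
    ring

lemma iterate_dx_imPart_monomialC (s : ℝ) (m i : ℕ) :
    dx^[i] (imPart (monomialC s m)) =
      fun z => m.descFactorial i * imPart (monomialC s (m - i)) z := by
  induction i with
  | zero => simp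
  | succ i ih =>
    rw [Function.iterate_succ_apply', ih, dx_const_mul, dx_imPart_monomialC]
    funext z
    rw [Nat.descFactorial_succ, Nat.sub_sub]
    push_cast
    ring

lemma laplacian_rePart_monomialC (s : ℝ) (m : ℕ) :
    dx (dx (rePart (monomialC s m))) + dy (dy (rePart (monomialC s m))) = 0 := by
  have : (fun z => -(m * imPart (monomialC s (m - 1)) z)) =
      fun z => (-m : ℝ) * imPart (monomialC s (m - 1)) z := by funext z; ring
  rw [dx_rePart_monomialC, dy_rePart_monomialC, this, dx_const_mul, dy_const_mul,
    dx_rePart_monomialC, dy_imPart_monomialC]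
  funext z
  simp only [Pi.add_apply, Pi.zero_apply]
  ring

lemma monomialC_real (s x : ℝ) (m : ℕ) : monomialC s m (toC (x, 0)) = ((x - s) ^ m : ℝ) := by
  simp [monomialC, toC]

end ComplexParts

section NormalForm
open Set Filter Topology

variable {v g : ℝ × ℝ → ℝ} {s : ℝ} {m : ℕ}

/-- Leading-order normal form of a solution of `Δv = g v` with vanishing normal derivative at a
boundary zero of order `m`. -/
lemma exists_leading_term (hv : AnalyticAt ℝ v (s, 0)) (hg : AnalyticAt ℝ g (s, 0))
    (heq : dx (dx v) + dy (dy v) =ᶠ[𝓝 (s, 0)] g * v) (h0 : ∀ i < m, dx^[i] v (s, 0) = 0)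
    (hm : dx^[m] v (s, 0) ≠ 0) (hN : ∀ i, dx^[i] (dy v) (s, 0) = 0) :
    ∃ a ≠ 0, FlatAt (s, 0) (m + 1) (v + fun z => -a * rePart (monomialC s m) z) := by
  have hflat : ∀ n ≤ m, FlatAt (s, 0) n v := by
    intro n
    induction n using Nat.strong_induction_on with
    | _ n ih =>
      intro hn
      refine flatAt_of_laplacian hv (hg.mul hv) heq (fun i hi => h0 i (by omega))
        (fun i _ => hN i) ?_
      rcases Nat.eq_zero_or_pos n with rfl | hpos
      · trivial
      · exact (ih (n - 2) (by omega) (by omega)).mul_left hv hg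
  have hfac : (m.factorial : ℝ) ≠ 0 := by positivity
  refine ⟨dx^[m] v (s, 0) / m.factorial, by positivity, ?_⟩
  set a := dx^[m] v (s, 0) / m.factorial with ha
  have hP := analyticAt_rePart (z := (s, 0)) (analyticAt_monomialC s m _)
  have hP' : AnalyticAt ℝ (fun z => -a * rePart (monomialC s m) z) (s, 0) :=
    analyticAt_const.mul hP
  have hit : ∀ i, dx^[i] (fun z => -a * rePart (monomialC s m) z) =
      fun z => -a * dx^[i] (rePart (monomialC s m)) z := by
    intro i
    induction i with
    | zero => rfl
    | succ i ih => simp only [Function.iterate_succ_apply', ih, dx_const_mul]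
  refine flatAt_of_laplacian (hv.add hP') (hg.mul hv) ?_ (fun i hi => ?_) (fun i hi => ?_)
    ((hflat (m + 1 - 2) (by omega)).mul_left hv hg)
  · have e1 := (hv.partial_x_add hP').partial_x.trans (hv.partial_x.partial_x_add hP'.partial_x)
    have e2 := (hv.partial_y_add hP').partial_y.trans (hv.partial_y.partial_y_add hP'.partial_y)
    refine (e1.add e2).trans ?_
    rw [dx_const_mul, dx_const_mul, dy_const_mul, dy_const_mul]
    filter_upwards [heq] with z hz
    have := congrFun (laplacian_rePart_monomialC s m) z
    simp only [Pi.add_apply, Pi.zero_apply] at hz this ⊢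
    rw [← hz]
    linear_combination (-a) * this
  · rw [(hv.partial_x_iterate_add hP' i).eq_of_nhds, Pi.add_apply, hit,
      iterate_dx_rePart_monomialC]
    simp only [rePart, monomialC_real, sub_self, Complex.ofReal_re]
    rcases Nat.lt_or_ge i m with h | h
    · rw [h0 i h, zero_pow (by omega)]; simp
    · obtain rfl : i = m := by omega
      rw [Nat.sub_self, Nat.descFactorial_self, ha]
      field_simp
      simp
  · rw [((hv.partial_y_add hP').partial_x_iterate i).eq_of_nhds,
      (hv.partial_y.partial_x_iterate_add hP'.partial_y i).eq_of_nhds, Pi.add_apply, hN i,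
      zero_add, dy_const_mul, dy_rePart_monomialC]
    have e : (fun z => -a * -(m * imPart (monomialC s (m - 1)) z)) =
        fun z => (a * m) * imPart (monomialC s (m - 1)) z := by funext z; ring
    have hit' : ∀ i, dx^[i] (fun z => (a * m) * imPart (monomialC s (m - 1)) z) =
        fun z => (a * m) * dx^[i] (imPart (monomialC s (m - 1))) z := by
      intro i
      induction i with
      | zero => rfl
      | succ i ih => simp only [Function.iterate_succ_apply', ih, dx_const_mul]
    rw [e, hit', iterate_dx_imPart_monomialC]
    simp only [imPart, monomialC_real, Complex.ofReal_im, mul_zero]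

end NormalForm

section RootCurve
open Set Filter Topology

/-- A sign-changing family that is strictly decreasing in `θ` has a continuous root curve. -/
lemma exists_root_curve {g : ℝ → ℝ → ℝ} {r₀ α β : ℝ} (hαβ : α ≤ β)
    (hanti : ∀ r ∈ Ioo 0 r₀, StrictAntiOn (g r) (Icc α β))
    (hα : ∀ r ∈ Ioo 0 r₀, 0 < g r α) (hβ : ∀ r ∈ Ioo 0 r₀, g r β < 0)
    (hc : ∀ r ∈ Ioo 0 r₀, ContinuousOn (g r) (Icc α β))
    (hc' : ∀ θ, ContinuousOn (fun r => g r θ) (Ioo 0 r₀)) :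
    ∃ ϑ : ℝ → ℝ, ContinuousOn ϑ (Ioo 0 r₀) ∧ (∀ r ∈ Ioo 0 r₀, ϑ r ∈ Icc α β ∧ g r (ϑ r) = 0) ∧
      ∀ r ∈ Ioo 0 r₀, ∀ θ ∈ Icc α β, g r θ = 0 → θ = ϑ r := by
  have hex : ∀ r ∈ Ioo 0 r₀, ∃ θ ∈ Icc α β, g r θ = 0 := fun r hr =>
    intermediate_value_Icc' hαβ (hc r hr) ⟨(hβ r hr).le, (hα r hr).le⟩
  choose! ϑ hϑ hϑ0 using hex
  refine ⟨ϑ, ?_, fun r hr => ⟨hϑ r hr, hϑ0 r hr⟩, fun r hr θ hθ h0 =>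
    (hanti r hr).injOn hθ (hϑ r hr) (h0.trans (hϑ0 r hr).symm)⟩
  intro r hr
  rw [ContinuousWithinAt, tendsto_order]
  constructor
  · intro t ht
    rcases lt_or_ge t α with h | h
    · filter_upwards [self_mem_nhdsWithin] with x hx
      exact h.trans_le (hϑ x hx).1
    · have ht' : t ∈ Icc α β := ⟨h, ht.le.trans (hϑ r hr).2⟩
      have hpos : 0 < g r t := by
        have := hanti r hr ht' (hϑ r hr) ht
        rwa [hϑ0 r hr] at this
      filter_upwards [self_mem_nhdsWithin, (hc' t r hr).eventually (lt_mem_nhds hpos)] with x hx hx'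
      by_contra! hle
      have := (hanti x hx).antitoneOn (hϑ x hx) ht' hle
      rw [hϑ0 x hx] at this
      linarith
  · intro t ht
    rcases lt_or_ge β t with h | h
    · filter_upwards [self_mem_nhdsWithin] with x hx
      exact (hϑ x hx).2.trans_lt h
    · have ht' : t ∈ Icc α β := ⟨(hϑ r hr).1.trans ht.le, h⟩
      have hneg : g r t < 0 := by
        have := hanti r hr (hϑ r hr) ht' ht
        rwa [hϑ0 r hr] at this
      filter_upwards [self_mem_nhdsWithin, (hc' t r hr).eventually (gt_mem_nhds hneg)] with x hx hx'
      by_contra! hle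
      have := (hanti x hx).antitoneOn ht' (hϑ x hx) hle
      rw [hϑ0 x hx] at this
      linarith

/-- Zero set of a perturbation of `a r ^ m cos (m θ)`, `0 < θ < π`. -/
lemma exists_root_curves {G D : ℝ → ℝ → ℝ} {r₀ a C : ℝ} {m : ℕ} (hm : 0 < m) (ha : a ≠ 0)
    (hr₀ : C * r₀ < |a| / 2)
    (hG : ∀ r ∈ Ioo 0 r₀, ∀ θ, |G r θ - a * r ^ m * cos (m * θ)| ≤ C * r ^ (m + 1))
    (hD : ∀ r ∈ Ioo 0 r₀, ∀ θ, HasDerivAt (G r) (D r θ) θ)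
    (hD' : ∀ r ∈ Ioo 0 r₀, ∀ θ, |D r θ + a * m * r ^ m * sin (m * θ)| ≤ C * r ^ (m + 1))
    (hc : ∀ θ, ContinuousOn (fun r => G r θ) (Ioo 0 r₀)) (hC : 0 ≤ C) :
    ∃ ϑ : Fin m → ℝ → ℝ, (∀ j, ContinuousOn (ϑ j) (Ioo 0 r₀)) ∧
      (∀ j, ∀ r ∈ Ioo 0 r₀, ϑ j r ∈ Ioo 0 π ∧ G r (ϑ j r) = 0) ∧
      ∀ r ∈ Ioo 0 r₀, ∀ θ ∈ Ioo 0 π, G r θ = 0 → ∃ j, θ = ϑ j r := by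
  have hm' : (0 : ℝ) < m := by exact_mod_cast hm
  have hm1 : (1 : ℝ) ≤ m := by exact_mod_cast hm
  have hpi := Real.pi_pos
  have hsmall : ∀ r ∈ Ioo 0 r₀, C * r ^ (m + 1) < |a| / 2 * r ^ m := by
    intro r hr
    have : 0 < r ^ m := pow_pos hr.1 _
    calc C * r ^ (m + 1) = C * r * r ^ m := by ring
      _ ≤ C * r₀ * r ^ m := by
        have := hr.2.le
        gcongr
      _ < _ := by gcongr
  have hsq : ∀ j : ℕ, ((-1 : ℝ) ^ j) * (-1) ^ j = 1 := fun j => by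
    rw [← mul_pow]; norm_num
  have hcos : ∀ (j : ℕ) (t : ℝ), cos (m * ((j * π + t) / m)) = (-1) ^ j * cos t := by
    intro j t
    rw [mul_div_cancel₀ _ hm'.ne', add_comm, Real.cos_add_nat_mul_pi]
  have hsin : ∀ (j : ℕ) (t : ℝ), sin (m * ((j * π + t) / m)) = (-1) ^ j * sin t := by
    intro j t
    rw [mul_div_cancel₀ _ hm'.ne', add_comm, Real.sin_add_nat_mul_pi]
  have hsin3 : ∀ t ∈ Icc (π / 3) (2 * π / 3), 1 / 2 ≤ sin t := by
    intro t ht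
    rw [← Real.cos_sub_pi_div_two, ← Real.cos_abs, ← Real.cos_pi_div_three]
    refine Real.cos_le_cos_of_nonneg_of_le_pi (abs_nonneg _) (by linarith) ?_
    rw [abs_le]
    constructor <;> linarith [ht.1, ht.2]
  have hcos23 : cos (2 * π / 3) = -(1 / 2) := by
    rw [show 2 * π / 3 = π - π / 3 by ring, Real.cos_pi_sub, Real.cos_pi_div_three]
  have habs : ∀ j : ℕ, |(-1 : ℝ) ^ j * a| = |a| := fun j => by
    rw [abs_mul, abs_pow, abs_neg, abs_one, one_pow, one_mul]
  have ha2 : 0 < a * a := mul_self_pos.mpr ha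
  have haa : a * a = |a| * |a| := (abs_mul_abs_self a).symm
  have ha0 : 0 < |a| := by positivity
  have key : ∀ j : ℕ, ∃ ϑ : ℝ → ℝ, ContinuousOn ϑ (Ioo 0 r₀) ∧
      (∀ r ∈ Ioo 0 r₀, ϑ r ∈ Icc ((j * π + π / 3) / m) ((j * π + 2 * π / 3) / m) ∧
        (-1) ^ j * a * G r (ϑ r) = 0) ∧
      ∀ r ∈ Ioo 0 r₀, ∀ θ ∈ Icc ((j * π + π / 3) / m) ((j * π + 2 * π / 3) / m),
        (-1) ^ j * a * G r θ = 0 → θ = ϑ r := by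
    intro j
    refine exists_root_curve (g := fun r θ => (-1) ^ j * a * G r θ) (by gcongr; linarith) ?_ ?_ ?_
      ?_ ?_
    · intro r hr
      refine strictAntiOn_of_deriv_neg (convex_Icc _ _)
        (fun θ _ => ((hD r hr θ).const_mul _).continuousAt.continuousWithinAt) fun θ hθ => ?_
      rw [((hD r hr θ).const_mul _).deriv]
      rw [interior_Icc] at hθ
      obtain ⟨t, rfl⟩ : ∃ t, θ = (j * π + t) / m := ⟨m * θ - j * π, by field_simp; ring⟩
      have ht1 : π / 3 < t := by
        have := (div_lt_div_iff_of_pos_right hm').mp hθ.1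
        linarith
      have ht2 : t < 2 * π / 3 := by
        have := (div_lt_div_iff_of_pos_right hm').mp hθ.2
        linarith
      have h1 := hsin3 t ⟨ht1.le, ht2.le⟩
      have h2 := hD' r hr ((j * π + t) / m)
      rw [hsin] at h2
      have h3 := hsmall r hr
      set X := D r ((j * π + t) / m) with hX
      have h4 : |(-1 : ℝ) ^ j * a * (X + a * m * r ^ m * ((-1) ^ j * sin t))| ≤
          |a| * (C * r ^ (m + 1)) := by
        rw [abs_mul, habs]; gcongr
      have h5 : (-1 : ℝ) ^ j * a * (X + a * m * r ^ m * ((-1) ^ j * sin t)) =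
          (-1) ^ j * a * X + a * a * m * r ^ m * sin t := by
        linear_combination (a * a * m * r ^ m * sin t) * hsq j
      rw [h5] at h4
      have h6 : |a| * (C * r ^ (m + 1)) < |a| * (|a| / 2 * r ^ m) := by gcongr
      have hrm : 0 < r ^ m := pow_pos hr.1 _
      have h7 : a * a * 1 * r ^ m * (1 / 2) ≤ a * a * m * r ^ m * sin t := by gcongr
      have h8 := (abs_le.mp h4).2
      have h9 : |a| * (|a| / 2 * r ^ m) = a * a * 1 * r ^ m * (1 / 2) := by rw [haa]; ring
      linarith
    · intro r hr
      have h2 := hG r hr ((j * π + π / 3) / m)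
      rw [hcos, Real.cos_pi_div_three] at h2
      have h3 := hsmall r hr
      set X := G r ((j * π + π / 3) / m)
      have h4 : |(-1 : ℝ) ^ j * a * (X - a * r ^ m * ((-1) ^ j * (1 / 2)))| ≤
          |a| * (C * r ^ (m + 1)) := by
        rw [abs_mul, habs]; gcongr
      have h5 : (-1 : ℝ) ^ j * a * (X - a * r ^ m * ((-1) ^ j * (1 / 2))) =
          (-1) ^ j * a * X - a * a * r ^ m * (1 / 2) := by
        linear_combination (-a * a * r ^ m * (1 / 2)) * hsq j
      rw [h5] at h4
      have h6 : |a| * (C * r ^ (m + 1)) < |a| * (|a| / 2 * r ^ m) := by gcongr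
      have h8 := (abs_le.mp h4).1
      have h9 : |a| * (|a| / 2 * r ^ m) = a * a * r ^ m * (1 / 2) := by rw [haa]; ring
      linarith
    · intro r hr
      have h2 := hG r hr ((j * π + 2 * π / 3) / m)
      rw [hcos, hcos23] at h2
      have h3 := hsmall r hr
      set X := G r ((j * π + 2 * π / 3) / m)
      have h4 : |(-1 : ℝ) ^ j * a * (X - a * r ^ m * ((-1) ^ j * (-(1 / 2))))| ≤
          |a| * (C * r ^ (m + 1)) := by
        rw [abs_mul, habs]; gcongr
      have h5 : (-1 : ℝ) ^ j * a * (X - a * r ^ m * ((-1) ^ j * (-(1 / 2)))) =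
          (-1) ^ j * a * X + a * a * r ^ m * (1 / 2) := by
        linear_combination (a * a * r ^ m * (1 / 2)) * hsq j
      rw [h5] at h4
      have h6 : |a| * (C * r ^ (m + 1)) < |a| * (|a| / 2 * r ^ m) := by gcongr
      have h8 := (abs_le.mp h4).2
      have h9 : |a| * (|a| / 2 * r ^ m) = a * a * r ^ m * (1 / 2) := by rw [haa]; ring
      linarith
    · exact fun r hr θ _ => ((hD r hr θ).const_mul _).continuousAt.continuousWithinAt
    · exact fun θ => continuousOn_const.mul (hc θ)
  have hne : ∀ j : ℕ, (-1 : ℝ) ^ j * a ≠ 0 := fun j => by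
    rw [← abs_ne_zero, habs]; exact ha0.ne'
  choose ϑ hϑc hϑ hϑu using key
  refine ⟨fun j => ϑ j, fun j => hϑc j, fun j r hr => ⟨?_, ?_⟩, ?_⟩
  · obtain ⟨⟨h1, h2⟩, -⟩ := hϑ j r hr
    refine ⟨lt_of_lt_of_le (by positivity) h1, lt_of_le_of_lt h2 ?_⟩
    rw [div_lt_iff₀ hm']
    have hj : ((j : ℕ) : ℝ) + 1 ≤ m := by exact_mod_cast j.2
    nlinarith
  · exact (mul_eq_zero.mp (hϑ j r hr).2).resolve_left (hne j)
  · intro r hr θ hθ h0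
    have h1 := hG r hr θ
    have h3 := hsmall r hr
    have hrm : 0 < r ^ m := pow_pos hr.1 _
    rw [h0, zero_sub, abs_neg, abs_mul, abs_mul, abs_of_pos hrm] at h1
    have hcs : |cos (m * θ)| < 1 / 2 := by
      have h4 := h1.trans_lt h3
      have h5 : |a| * r ^ m * |cos (m * θ)| < |a| * r ^ m * (1 / 2) := by linarith
      exact lt_of_mul_lt_mul_left h5 (by positivity)
    set j := ⌊m * θ / π⌋₊ with hj
    have hx0 : 0 ≤ m * θ / π := by
      have := hθ.1.le
      positivity
    have hj1 : (j : ℝ) * π ≤ m * θ := (le_div_iff₀ hpi).mp (Nat.floor_le hx0)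
    have hj2 : m * θ < (j + 1) * π := (div_lt_iff₀ hpi).mp (Nat.lt_floor_add_one _)
    have hjm : j < m := by
      have : (j : ℝ) * π < m * π := hj1.trans_lt (by gcongr; exact hθ.2)
      exact_mod_cast lt_of_mul_lt_mul_right this hpi.le
    obtain ⟨t, ht⟩ : ∃ t, θ = (j * π + t) / m := ⟨m * θ - j * π, by field_simp; ring⟩
    have hmt : m * θ = j * π + t := by rw [ht]; field_simp
    rw [ht, hcos, abs_mul, abs_pow, abs_neg, abs_one, one_pow, one_mul, abs_lt] at hcs
    have ht0 : 0 ≤ t := by linarith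
    have htp : t ≤ π := by linarith
    refine ⟨⟨j, hjm⟩, hϑu j r hr θ ?_ (by rw [h0, mul_zero])⟩
    rw [ht]
    constructor
    · gcongr
      by_contra! hlt
      have := Real.cos_le_cos_of_nonneg_of_le_pi ht0 (by linarith) hlt.le
      rw [Real.cos_pi_div_three] at this
      linarith
    · gcongr
      by_contra! hlt
      have := Real.cos_le_cos_of_nonneg_of_le_pi (by positivity) htp hlt.le
      rw [hcos23] at this
      linarith

end RootCurve

section LocalArcs
open Set Filter Topology

variable {v g : ℝ × ℝ → ℝ} {s : ℝ} {m : ℕ}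

/-- Polar coordinates around the boundary point `(s, 0)`. -/
def polarPt (s r θ : ℝ) : ℝ × ℝ := (s + r * cos θ, r * sin θ)

lemma norm_polarPt_sub_le {r : ℝ} (hr : 0 ≤ r) (s θ : ℝ) : ‖polarPt s r θ - (s, 0)‖ ≤ r := by
  rw [Prod.norm_def]
  simp only [polarPt, Prod.fst_sub, Prod.snd_sub, add_sub_cancel_left, sub_zero, norm_mul,
    Real.norm_eq_abs, abs_of_nonneg hr]
  exact max_le (mul_le_of_le_one_right hr (Real.abs_cos_le_one θ))
    (mul_le_of_le_one_right hr (Real.abs_sin_le_one θ))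

lemma rePart_monomialC_polarPt (s r θ : ℝ) (m : ℕ) :
    rePart (monomialC s m) (polarPt s r θ) = r ^ m * cos (m * θ) := by
  have : toC (polarPt s r θ) - s = r * Complex.exp (θ * Complex.I) := by
    rw [Complex.exp_mul_I]
    simp [toC, polarPt]
    ring
  rw [rePart, monomialC, this, mul_pow, ← Complex.exp_nat_mul, ← mul_assoc, ← Complex.ofReal_pow,
    Complex.re_ofReal_mul]
  congr 1
  have : (m : ℂ) * θ = ((m * θ : ℝ) : ℂ) := by push_cast; ring
  rw [this, Complex.exp_ofReal_mul_I_re]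

lemma hasDerivAt_polarPt (s r θ : ℝ) :
    HasDerivAt (polarPt s r) (r * -sin θ, r * cos θ) θ :=
  (((Real.hasDerivAt_cos θ).const_mul r).const_add s).prodMk ((Real.hasDerivAt_sin θ).const_mul r)

lemma hasDerivAt_comp_polarPt {f : ℝ × ℝ → ℝ} {r θ : ℝ}
    (hf : DifferentiableAt ℝ f (polarPt s r θ)) :
    HasDerivAt (fun θ => f (polarPt s r θ))
      (r * -sin θ * dx f (polarPt s r θ) + r * cos θ * dy f (polarPt s r θ)) θ := by
  refine (hf.hasFDerivAt.comp_hasDerivAt θ (hasDerivAt_polarPt s r θ)).congr_deriv ?_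
  rw [fderiv_eq_partial]

lemma hasDerivAt_rePart_monomialC_polarPt (s r θ : ℝ) (m : ℕ) :
    HasDerivAt (fun θ => rePart (monomialC s m) (polarPt s r θ))
      (-(m * r ^ m * sin (m * θ))) θ := by
  have e : (fun θ => rePart (monomialC s m) (polarPt s r θ)) = fun θ => r ^ m * cos (m * θ) :=
    funext fun θ => rePart_monomialC_polarPt s r θ m
  rw [e]
  refine (((Real.hasDerivAt_cos _).comp θ ((hasDerivAt_id θ).const_mul (m : ℝ))).const_mul
    (r ^ m)).congr_deriv ?_
  simp only [id, mul_one]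
  ring

/-- Near a boundary zero of order `m`, the nodal set in the open half plane consists of `m`
connected arcs. -/
theorem exists_local_arcs (hv : AnalyticAt ℝ v (s, 0)) (hg : AnalyticAt ℝ g (s, 0))
    (heq : dx (dx v) + dy (dy v) =ᶠ[𝓝 (s, 0)] g * v) (h0 : ∀ i < m, dx^[i] v (s, 0) = 0)
    (hm : dx^[m] v (s, 0) ≠ 0) (hN : ∀ i, dx^[i] (dy v) (s, 0) = 0) {ε : ℝ} (hε : 0 < ε) :
    ∃ γ : Fin m → Set (ℝ × ℝ), (∀ j, IsPreconnected (γ j)) ∧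
      (∀ j, ∀ z ∈ γ j, 0 < z.2 ∧ z.2 < ε ∧ v z = 0) ∧
      ∀ᶠ z in 𝓝 (s, (0 : ℝ)), 0 < z.2 → v z = 0 → ∃ j, z ∈ γ j := by
  rcases Nat.eq_zero_or_pos m with rfl | hpos
  · refine ⟨fun _ => ∅, fun j => j.elim0, fun j => j.elim0, ?_⟩
    filter_upwards [hv.continuousAt.eventually_ne hm] with z hz _ h
    exact absurd h hz
  obtain ⟨a, ha, hflat⟩ := exists_leading_term hv hg heq h0 hm hN
  set P := rePart (monomialC s m) with hP
  have hPa : ∀ z, AnalyticAt ℝ P z := fun z => analyticAt_rePart (analyticAt_monomialC s m _)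
  set H : ℝ × ℝ → ℝ := v + fun z => -a * P z with hH
  have hHa : AnalyticAt ℝ H (s, 0) := hv.add (analyticAt_const.mul (hPa _))
  obtain ⟨C₀, hC₀, hb₀⟩ := hflat.exists_le hHa
  obtain ⟨C₁, hC₁, hb₁⟩ := FlatAt.exists_le hflat.2.1 hHa.partial_x
  obtain ⟨C₂, hC₂, hb₂⟩ := FlatAt.exists_le hflat.2.2 hHa.partial_y
  obtain ⟨δ, hδ, hball⟩ := Metric.eventually_nhds_iff_ball.mp
    (hb₀.and (hb₁.and (hb₂.and (hv.eventually_analyticAt.and hHa.eventually_analyticAt))))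
  set C := C₀ + C₁ + C₂ with hC
  have hC0 : 0 ≤ C := by positivity
  have ha0 : 0 < |a| := abs_pos.mpr ha
  set r₀ := min (min δ ε) (|a| / (4 * (C + 1))) with hr₀
  have hr₀0 : 0 < r₀ := by positivity
  have hmem : ∀ r ∈ Ioo 0 r₀, ∀ θ, polarPt s r θ ∈ Metric.ball (s, (0 : ℝ)) δ := by
    intro r hr θ
    rw [mem_ball_iff_norm]
    exact (norm_polarPt_sub_le hr.1.le s θ).trans_lt
      (hr.2.trans_le ((min_le_left _ _).trans (min_le_left _ _)))
  have hpow : ∀ (r : ℝ) (_ : r ∈ Ioo 0 r₀) (θ : ℝ) (n : ℕ),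
      ‖polarPt s r θ - (s, 0)‖ ^ n ≤ r ^ n := fun r hr θ n => by
    gcongr
    exact norm_polarPt_sub_le hr.1.le s θ
  have hCr : C * r₀ < |a| / 2 := by
    have h1 : r₀ ≤ |a| / (4 * (C + 1)) := min_le_right _ _
    rw [le_div_iff₀ (by positivity)] at h1
    nlinarith
  have hvH : ∀ z, v z = H z + a * P z := fun z => by simp [hH]
  have hG : ∀ r ∈ Ioo 0 r₀, ∀ θ, |v (polarPt s r θ) - a * r ^ m * cos (m * θ)| ≤
      C * r ^ (m + 1) := by
    intro r hr θ
    have h1 := (hball _ (hmem r hr θ)).1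
    have hPp : P (polarPt s r θ) = r ^ m * cos (m * θ) := rePart_monomialC_polarPt s r θ m
    rw [hvH, hPp]
    rw [show ∀ x, x + a * (r ^ m * cos (m * θ)) - a * r ^ m * cos (m * θ) = x by intro x; ring]
    refine h1.trans ?_
    have h2 := hpow r hr θ (m + 1)
    have hr' := hr.1.le
    calc _ ≤ C₀ * r ^ (m + 1) := by gcongr
      _ ≤ _ := by gcongr; linarith
  have hD : ∀ r ∈ Ioo 0 r₀, ∀ θ, HasDerivAt (fun θ => v (polarPt s r θ))
      (r * -sin θ * dx H (polarPt s r θ) + r * cos θ * dy H (polarPt s r θ) +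
        a * -(m * r ^ m * sin (m * θ))) θ := by
    intro r hr θ
    have h1 := (hball _ (hmem r hr θ)).2.2.2.2
    have := (hasDerivAt_comp_polarPt h1.differentiableAt).fun_add
      ((hasDerivAt_rePart_monomialC_polarPt s r θ m).const_mul a)
    exact this.congr_of_eventuallyEq (Eventually.of_forall fun θ => hvH _)
  have hD' : ∀ r ∈ Ioo 0 r₀, ∀ θ,
      |r * -sin θ * dx H (polarPt s r θ) + r * cos θ * dy H (polarPt s r θ) +
        a * -(m * r ^ m * sin (m * θ)) + a * m * r ^ m * sin (m * θ)| ≤ C * r ^ (m + 1) := by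
    intro r hr θ
    obtain ⟨-, h1, h2, -⟩ := hball _ (hmem r hr θ)
    have h3 := hpow r hr θ m
    have hr' := hr.1.le
    rw [show ∀ x : ℝ, x + a * -(m * r ^ m * sin (m * θ)) + a * m * r ^ m * sin (m * θ) = x by
      intro x; ring]
    refine (abs_add_le _ _).trans ?_
    simp only [abs_mul, abs_neg, abs_of_nonneg hr']
    have e1 : |dx H (polarPt s r θ)| ≤ C₁ * r ^ m := h1.trans (by gcongr)
    have e2 : |dy H (polarPt s r θ)| ≤ C₂ * r ^ m := h2.trans (by gcongr)
    calc _ ≤ r * 1 * (C₁ * r ^ m) + r * 1 * (C₂ * r ^ m) := by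
          gcongr
          · exact Real.abs_sin_le_one θ
          · exact Real.abs_cos_le_one θ
      _ = (C₁ + C₂) * r ^ (m + 1) := by ring
      _ ≤ _ := by gcongr; linarith
  have hcont : ∀ θ, ContinuousOn (fun r => v (polarPt s r θ)) (Ioo 0 r₀) := by
    intro θ r hr
    have h1 := (hball _ (hmem r hr θ)).2.2.2.1.continuousAt
    refine ContinuousAt.continuousWithinAt (ContinuousAt.comp (g := v) h1 ?_)
    unfold polarPt
    fun_prop
  obtain ⟨ϑ, hϑc, hϑ, hϑu⟩ := exists_root_curves hpos ha hCr hG hD hD' hcont hC0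
  refine ⟨fun j => (fun r => polarPt s r (ϑ j r)) '' Ioo 0 r₀, fun j => ?_, ?_, ?_⟩
  · refine isPreconnected_Ioo.image _ ?_
    have := hϑc j
    unfold polarPt
    fun_prop
  · rintro j _ ⟨r, hr, rfl⟩
    obtain ⟨h1, h2⟩ := hϑ j r hr
    have hs : 0 < sin (ϑ j r) := Real.sin_pos_of_pos_of_lt_pi h1.1 h1.2
    refine ⟨mul_pos hr.1 hs, ?_, h2⟩
    have : r < ε := hr.2.trans_le ((min_le_left _ _).trans (min_le_right _ _))
    exact (mul_le_of_le_one_right hr.1.le (Real.sin_le_one _)).trans_lt this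
  · have hct : ContinuousAt (fun z : ℝ × ℝ => ‖toC z - s‖) (s, 0) :=
      ((analyticAt_toC _).continuousAt.sub continuousAt_const).norm
    have hz0 : ‖toC (s, 0) - s‖ < r₀ := by simpa [toC] using hr₀0
    filter_upwards [hct.eventually (gt_mem_nhds hz0)] with z hz hzp hvz
    set w := toC z - s with hw
    have hwim : 0 < w.im := by simpa [hw] using hzp
    have hwr : 0 < ‖w‖ := norm_pos_iff.mpr fun h => by simp [h] at hwim
    have hzw : z = polarPt s ‖w‖ w.arg := by
      ext
      · simp only [polarPt, Complex.norm_mul_cos_arg]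
        simp [hw]
      · simp only [polarPt, Complex.norm_mul_sin_arg]
        simp [hw]
    have harg : w.arg ∈ Ioo 0 π := by
      refine ⟨lt_of_le_of_ne (Complex.arg_nonneg_iff.mpr hwim.le) fun h => ?_,
        lt_of_le_of_ne (Complex.arg_le_pi w) fun h => ?_⟩
      · have := (Complex.arg_eq_zero_iff.mp h.symm).2
        exact hwim.ne' this
      · have := (Complex.arg_eq_pi_iff.mp h).2
        exact hwim.ne' this
    obtain ⟨j, hj⟩ := hϑu ‖w‖ ⟨hwr, hz⟩ w.arg harg (by
      rw [← hzw, hvz])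
    refine ⟨j, ‖w‖, ⟨hwr, hz⟩, ?_⟩
    dsimp only
    rw [← hj, ← hzw]

end LocalArcs

section Stability
open Set Filter Topology

/-- Smooth compactly supported functions on the plane. -/
def IsTestFun (f : ℝ × ℝ → ℝ) : Prop :=
  ContDiff ℝ ((⊤ : ℕ∞) : WithTop ℕ∞) f ∧ HasCompactSupport f

namespace IsTestFun

variable {f g : ℝ × ℝ → ℝ}

lemma diff (hf : IsTestFun f) (p) : DifferentiableAt ℝ f p :=
  hf.1.differentiable (by simp) p

lemma cont (hf : IsTestFun f) : Continuous f := hf.1.continuous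

lemma integrable (hf : IsTestFun f) : Integrable f :=
  hf.cont.integrable_of_hasCompactSupport hf.2

protected lemma dx (hf : IsTestFun f) : IsTestFun (dx f) :=
  ⟨((hf.1.fderiv_right (m := ((⊤ : ℕ∞) : WithTop ℕ∞)) (by simp)).clm_apply contDiff_const),
    hf.2.fderiv_apply ℝ _⟩

protected lemma dy (hf : IsTestFun f) : IsTestFun (dy f) :=
  ⟨((hf.1.fderiv_right (m := ((⊤ : ℕ∞) : WithTop ℕ∞)) (by simp)).clm_apply contDiff_const),
    hf.2.fderiv_apply ℝ _⟩

protected lemma mul_left (hf : IsTestFun f) (hg : ContDiff ℝ ((⊤ : ℕ∞) : WithTop ℕ∞) g) :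
    IsTestFun (g * f) := ⟨hg.mul hf.1, hf.2.mul_left⟩

protected lemma mul (hg : IsTestFun g) (hf : IsTestFun f) : IsTestFun (g * f) := hf.mul_left hg.1

protected lemma add (hf : IsTestFun f) (hg : IsTestFun g) : IsTestFun (f + g) :=
  ⟨hf.1.add hg.1, hf.2.add hg.2⟩

protected lemma const_mul (hf : IsTestFun f) (c : ℝ) : IsTestFun (fun z => c * f z) :=
  hf.mul_left contDiff_const

lemma integral_dx_eq_zero (hf : IsTestFun f) : ∫ z, dx f z = 0 := by
  have := integral_mul_fderiv_eq_neg_fderiv_mul_of_integrable (μ := volume)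
    (f := fun _ : ℝ × ℝ => (1 : ℝ)) (g := f) (v := (1, 0)) (by simp)
    (by simpa using! hf.dx.integrable) (by simpa using hf.integrable) (by simp)
    (fun x _ => hf.diff x)
  simpa [dx] using this

lemma integral_dy_eq_zero (hf : IsTestFun f) : ∫ z, dy f z = 0 := by
  have := integral_mul_fderiv_eq_neg_fderiv_mul_of_integrable (μ := volume)
    (f := fun _ : ℝ × ℝ => (1 : ℝ)) (g := f) (v := (0, 1)) (by simp)
    (by simpa using! hf.dy.integrable) (by simpa using hf.integrable) (by simp)
    (fun x _ => hf.diff x)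
  simpa [dy] using this

lemma integrable_mul (hf : IsTestFun f) (hg : IsTestFun g) : Integrable (fun z => f z * g z) :=
  (hf.mul hg).integrable

lemma integrable_sq (hf : IsTestFun f) : Integrable (fun z => f z ^ 2) := by
  simpa only [pow_two] using hf.integrable_mul hf

end IsTestFun

lemma hasFDerivAt_fst' (z : ℝ × ℝ) : HasFDerivAt (fun z : ℝ × ℝ => z.1)
    (ContinuousLinearMap.fst ℝ ℝ ℝ) z := hasFDerivAt_fst

lemma dx_fst (z : ℝ × ℝ) : dx (fun z => z.1) z = 1 := by
  rw [dx, (hasFDerivAt_fst' z).fderiv]; rfl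

/-- A Poincaré inequality for test functions. -/
lemma IsTestFun.poincare {w : ℝ × ℝ → ℝ} (hw : IsTestFun w) {R : ℝ}
    (hR : ∀ z, w z ≠ 0 → |z.1| ≤ R) : ∫ z, w z ^ 2 ≤ 4 * R ^ 2 * ∫ z, dx w z ^ 2 := by
  have hfst : ContDiff ℝ ((⊤ : ℕ∞) : WithTop ℕ∞) (fun z : ℝ × ℝ => z.1) := contDiff_fst
  have h1 := ((hw.mul hw).mul_left hfst).integral_dx_eq_zero
  have h2 : ∀ z, dx ((fun z : ℝ × ℝ => z.1) * (w * w)) z = w z ^ 2 + 2 * (z.1 * w z) * dx w z := by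
    intro z
    rw [dx_mul (hasFDerivAt_fst' z).differentiableAt ((hw.mul hw).diff z), dx_fst,
      dx_mul (hw.diff z) (hw.diff z)]
    simp; ring
  have i1 := hw.integrable_sq
  have i2 := hw.dx.integrable_sq
  have h3 : ∫ z, (w z ^ 2 - 4 * R ^ 2 * dx w z ^ 2) ≤ ∫ z, 2 * dx ((fun z => z.1) * (w * w)) z := by
    refine integral_mono (i1.sub (i2.const_mul _))
      ((((hw.mul hw).mul_left hfst).dx.integrable).const_mul 2) fun z => ?_
    simp only [h2]
    have h4 : (z.1 * w z) ^ 2 ≤ R ^ 2 * w z ^ 2 := by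
      by_cases h : w z = 0
      · simp [h]
      · rw [mul_pow]
        have := sq_le_sq' (neg_le_of_abs_le (hR z h)) (le_of_abs_le (hR z h))
        gcongr
    rcases eq_or_ne R 0 with hR0 | hR0
    · have : z.1 * w z = 0 := by
        have : (z.1 * w z) ^ 2 ≤ 0 := by simpa [hR0] using h4
        nlinarith
      rw [this, hR0]; nlinarith [sq_nonneg (w z)]
    · have h5 : 0 ≤ (w z + 4 * (z.1 * dx w z) ) ^ 2 := sq_nonneg _
      by_cases h : w z = 0
      · simp [h]; positivity
      have h6 : z.1 ^ 2 ≤ R ^ 2 := sq_le_sq' (neg_le_of_abs_le (hR z h)) (le_of_abs_le (hR z h))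
      nlinarith [sq_nonneg (w z + 2 * (z.1 * dx w z)), mul_le_mul_of_nonneg_right h6 (sq_nonneg (dx w z))]
  rw [integral_sub i1 (i2.const_mul _), integral_const_mul, integral_const_mul, h1] at h3
  linarith


lemma IsTestFun.integral_mul_dx {w : ℝ × ℝ → ℝ} (hw : IsTestFun w) :
    ∫ z, w z * dx w z = 0 := by
  have h := (hw.mul hw).integral_dx_eq_zero
  have e : ∀ z, dx (w * w) z = 2 * (w z * dx w z) := fun z => by
    rw [dx_mul (hw.diff z) (hw.diff z)]; ring
  simp only [e, integral_const_mul] at h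
  linarith

lemma IsTestFun.integral_dx_mul_dy_dy {w : ℝ × ℝ → ℝ} (hw : IsTestFun w) :
    ∫ z, dx w z * dy (dy w) z = 0 := by
  have h := (hw.dx.mul hw.dy).integral_dy_eq_zero
  have e : ∀ z, dy (dx w * dy w) z = dx w z * dy (dy w) z + dy w z * dx (dy w) z := fun z => by
    rw [dy_mul (hw.dx.diff z) (hw.dy.diff z), dx_dy_comm hw.1.contDiffAt]; ring
  simp only [e] at h
  rw [integral_add (hw.dx.integrable_mul hw.dy.dy) (hw.dy.integrable_mul hw.dy.dx),
    hw.dy.integral_mul_dx, add_zero] at h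
  exact h

lemma dx_const (c : ℝ) : dx (fun _ => c) = fun _ => 0 := by ext; simp [dx]

lemma dy_const (c : ℝ) : dy (fun _ => c) = fun _ => 0 := by ext; simp [dy]

lemma dx_exp_fst (z : ℝ × ℝ) : dx (fun z => Real.exp z.1) z = Real.exp z.1 := by
  rw [dx, (hasFDerivAt_fst' z).exp.fderiv]; simp

lemma dy_exp_fst (z : ℝ × ℝ) : dy (fun z => Real.exp z.1) z = 0 := by
  rw [dy, (hasFDerivAt_fst' z).exp.fderiv]; simp

/-- Uniform invertibility of `Δ + κ` on test functions with support in a fixed vertical strip. -/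
theorem IsTestFun.integral_sq_le {f : ℝ × ℝ → ℝ} (hf : IsTestFun f) {R : ℝ}
    (hR : ∀ z, f z ≠ 0 → |z.1| ≤ R) (κ : ℝ) :
    ∫ z, f z ^ 2 ≤
      R ^ 2 * Real.exp (4 * R) * ∫ z, (dx (dx f) z + dy (dy f) z + κ * f z) ^ 2 := by
  set e : ℝ × ℝ → ℝ := fun z => Real.exp z.1 with he
  have hes : ContDiff ℝ ((⊤ : ℕ∞) : WithTop ℕ∞) e := contDiff_fst.exp
  have hed : ∀ z, DifferentiableAt ℝ e z := fun z => hes.differentiable (by simp) z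
  set w : ℝ × ℝ → ℝ := e * f with hw'
  have hw : IsTestFun w := hf.mul_left hes
  have hwx : dx w = e * (f + dx f) := by
    ext z
    rw [hw', dx_mul (hed z) (hf.diff z), dx_exp_fst]
    simp only [Pi.mul_apply, Pi.add_apply, he]; ring
  have hwy : dy w = e * dy f := by
    ext z
    rw [hw', dy_mul (hed z) (hf.diff z), dy_exp_fst]
    simp only [Pi.mul_apply, he]; ring
  have hwxx : ∀ z, dx (dx w) z = e z * (f z + 2 * dx f z + dx (dx f) z) := by
    intro z
    rw [hwx, dx_mul (hed z) ((hf.add hf.dx).diff z), dx_exp_fst, dx_add (hf.diff z) (hf.dx.diff z)]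
    simp only [Pi.add_apply, he]; ring
  have hwyy : ∀ z, dy (dy w) z = e z * dy (dy f) z := by
    intro z
    rw [hwy, dy_mul (hed z) (hf.dy.diff z), dy_exp_fst]
    ring
  set g : ℝ × ℝ → ℝ := dx (dx f) + dy (dy f) + fun z => κ * f z with hg
  have hgt : IsTestFun g := (hf.dx.dx.add hf.dy.dy).add (hf.const_mul κ)
  have hG : IsTestFun (e * g) := hgt.mul_left hes
  have key : ∀ z, (e * g) z = dx (dx w) z + dy (dy w) z - 2 * dx w z + (1 + κ) * w z := by
    intro z
    rw [hwxx, hwyy, hwx]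
    simp only [hg, hw', Pi.mul_apply, Pi.add_apply]; ring
  have h1 : ∫ z, dx w z * (e * g) z = -2 * ∫ z, dx w z ^ 2 := by
    have i1 := hw.dx.integrable_mul hw.dx.dx
    have i2 := hw.dx.integrable_mul hw.dy.dy
    have i3 := hw.dx.integrable_sq
    have i4 := hw.integrable_mul hw.dx
    have i12 : Integrable fun z => dx w z * dx (dx w) z + dx w z * dy (dy w) z := i1.add i2
    have i123 : Integrable fun z => dx w z * dx (dx w) z + dx w z * dy (dy w) z +
      (-2) * dx w z ^ 2 := i12.add (i3.const_mul _)
    calc ∫ z, dx w z * (e * g) z = ∫ z, (dx w z * dx (dx w) z + dx w z * dy (dy w) z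
          + (-2) * dx w z ^ 2 + (1 + κ) * (w z * dx w z)) := by
          congr 1; ext z; rw [key]; ring
      _ = _ := by
          rw [integral_add i123 (i4.const_mul _),
            integral_add i12 (i3.const_mul _), integral_add i1 i2, integral_const_mul,
            integral_const_mul, hw.dx.integral_mul_dx, hw.integral_dx_mul_dy_dy,
            hw.integral_mul_dx]
          ring
  have h2 : ∫ z, dx w z ^ 2 ≤ (1 / 4) * ∫ z, (e * g) z ^ 2 := by
    have : 0 ≤ ∫ z, (dx w z ^ 2 + dx w z * (e * g) z + (1 / 4) * (e * g) z ^ 2) :=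
      integral_nonneg fun z => by
        change 0 ≤ dx w z ^ 2 + dx w z * (e * g) z + (1 / 4) * (e * g) z ^ 2
        nlinarith [sq_nonneg (dx w z + (1 / 2) * (e * g) z)]
    have i12 : Integrable fun z => dx w z ^ 2 + dx w z * (e * g) z :=
      hw.dx.integrable_sq.add (hw.dx.integrable_mul hG)
    rw [integral_add i12
      (hG.integrable_sq.const_mul _), integral_add hw.dx.integrable_sq (hw.dx.integrable_mul hG),
      integral_const_mul, h1] at this
    linarith
  have h3 := hw.poincare (R := R) fun z hz => hR z fun h => hz (by simp [hw', h])
  have h4 : ∫ z, (e * g) z ^ 2 ≤ Real.exp (2 * R) * ∫ z, g z ^ 2 := by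
    rw [← integral_const_mul]
    refine integral_mono hG.integrable_sq (hgt.integrable_sq.const_mul _) fun z => ?_
    by_cases hz : z ∈ tsupport f
    · have hzR : |z.1| ≤ R := by
        have hcl : IsClosed {z : ℝ × ℝ | |z.1| ≤ R} := isClosed_le (by fun_prop) (by fun_prop)
        exact closure_minimal (fun z hz => hR z hz) hcl hz
      simp only [Pi.mul_apply, mul_pow, he, ← Real.exp_nat_mul]
      refine mul_le_mul_of_nonneg_right (Real.exp_le_exp.mpr ?_) (sq_nonneg _)
      push_cast
      linarith [le_of_abs_le hzR]
    · have h0 : g z = 0 := by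
        have h0 : f =ᶠ[𝓝 z] fun _ => 0 := notMem_tsupport_iff_eventuallyEq.mp hz
        have hx : dx (dx f) z = 0 := by
          rw [(h0.partial_x.partial_x).eq_of_nhds, dx_const, dx_const]
        have hy : dy (dy f) z = 0 := by
          rw [(h0.partial_y.partial_y).eq_of_nhds, dy_const, dy_const]
        simp [hg, hx, hy, h0.eq_of_nhds]
      simp [h0]
  have h5 : Real.exp (-(2 * R)) * ∫ z, f z ^ 2 ≤ ∫ z, w z ^ 2 := by
    rw [← integral_const_mul]
    refine integral_mono (hf.integrable_sq.const_mul _) hw.integrable_sq fun z => ?_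
    by_cases hz : f z = 0
    · simp [hw', hz]
    · simp only [hw', Pi.mul_apply, mul_pow, he, ← Real.exp_nat_mul]
      gcongr
      push_cast
      linarith [neg_le_of_abs_le (hR z hz)]
  have h6 : ∫ z, f z ^ 2 ≤ Real.exp (2 * R) * ∫ z, w z ^ 2 := by
    rw [Real.exp_neg, inv_mul_le_iff₀ (Real.exp_pos _)] at h5
    exact h5
  have hg' : ∀ z, g z = dx (dx f) z + dy (dy f) z + κ * f z := fun z => rfl
  simp only [← hg']
  calc _ ≤ Real.exp (2 * R) * (4 * R ^ 2 * (1 / 4 * (Real.exp (2 * R) * ∫ z, g z ^ 2))) := by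
        refine h6.trans ?_
        gcongr
        refine h3.trans ?_
        gcongr
        exact h2.trans (by gcongr)
    _ = _ := by
        rw [show 4 * R = 2 * R + 2 * R by ring, Real.exp_add]; ring

end Stability

section CollarMap
open Set Filter Topology

/-- A complex function as a map of the plane, in real coordinates. -/
def planeMap (Q : ℂ → ℂ) (z : ℝ × ℝ) : ℝ × ℝ := (rePart Q z, imPart Q z)

/-- The Jacobian `|Q'|²` of a holomorphic map, in real coordinates. -/
def jac (Q : ℂ → ℂ) : ℝ × ℝ → ℝ :=
  rePart (deriv Q) * rePart (deriv Q) + imPart (deriv Q) * imPart (deriv Q)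

/-- Conformal collar coordinates of a plane domain: `Q` maps the strip `0 ≤ y ≤ h`, modulo
translation by `ℓ`, injectively onto a neighbourhood of the boundary relative to the closure. -/
structure Collar (D : Set (ℝ × ℝ)) (ℓ h : ℝ) (Q : ℂ → ℂ) : Prop where
  len_pos : 0 < ℓ
  h_pos : 0 < h
  h_le : h ≤ 1
  analytic : ∀ z : ℂ, |z.im| ≤ 2 * h → AnalyticAt ℂ Q z
  periodic : ∀ z : ℂ, Q (z + ℓ) = Q z
  deriv_ne : ∀ z : ℂ, |z.im| ≤ h → deriv Q z ≠ 0
  inj : InjOn (planeMap Q) (Ico 0 ℓ ×ˢ Icc 0 h)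
  boundary : ∀ x, planeMap Q (x, 0) ∈ frontier D
  surj : ∀ w ∈ frontier D, ∃ x ∈ Ico 0 ℓ, planeMap Q (x, 0) = w
  inside : ∀ z : ℝ × ℝ, 0 < z.2 → z.2 ≤ h → planeMap Q z ∈ D
  outside : ∀ z : ℝ × ℝ, -h ≤ z.2 → z.2 < 0 → planeMap Q z ∉ D
  isOpen : IsOpen D
  isPreconnected : IsPreconnected D
  isBounded : Bornology.IsBounded D

variable {D : Set (ℝ × ℝ)} {ℓ h : ℝ} {Q F : ℂ → ℂ}

lemma jac_eq (Q : ℂ → ℂ) (z : ℝ × ℝ) : jac Q z = ‖deriv Q (toC z)‖ ^ 2 := by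
  rw [← Complex.normSq_eq_norm_sq, Complex.normSq_apply]; rfl

lemma jac_nonneg (Q : ℂ → ℂ) (z : ℝ × ℝ) : 0 ≤ jac Q z := by rw [jac_eq]; positivity

lemma continuous_toC : Continuous toC :=
  continuous_iff_continuousAt.mpr fun z => (analyticAt_toC z).continuousAt

lemma toC_add (x y ℓ : ℝ) : toC (x + ℓ, y) = toC (x, y) + ℓ := by simp [toC]; ring

lemma PeriodicX.of_complex (hF : ∀ z : ℂ, F (z + ℓ) = F z) :
    PeriodicX ℓ (rePart F) ∧ PeriodicX ℓ (imPart F) :=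
  ⟨fun x y => by rw [rePart, toC_add, hF]; rfl, fun x y => by rw [imPart, toC_add, hF]; rfl⟩

lemma deriv_periodic (hF : ∀ z : ℂ, F (z + ℓ) = F z) (z : ℂ) : deriv F (z + ℓ) = deriv F z := by
  rw [← deriv_comp_add_const]
  congr 1
  exact funext hF

lemma exists_int_add_mem_Ico (hℓ : 0 < ℓ) (x : ℝ) : ∃ n : ℤ, x + n * ℓ ∈ Ico 0 ℓ := by
  refine ⟨-⌊x / ℓ⌋, ?_⟩
  have h1 := Int.floor_le (x / ℓ)
  have h2 := Int.lt_floor_add_one (x / ℓ)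
  rw [le_div_iff₀ hℓ] at h1
  rw [div_lt_iff₀ hℓ] at h2
  push_cast
  constructor <;> nlinarith

lemma periodic_int {α : Type*} {F : ℂ → α} (hF : ∀ z : ℂ, F (z + ℓ) = F z) (z : ℂ) (n : ℤ) :
    F (z + ((n * ℓ : ℝ) : ℂ)) = F z := by
  have : Function.Periodic F (ℓ : ℂ) := hF
  have h := this.int_mul n z
  push_cast
  exact h

/-- A continuous periodic function is bounded on closed strips. -/
lemma exists_norm_le_strip (hℓ : 0 < ℓ) {R : ℝ} (hc : ∀ z : ℂ, |z.im| ≤ R → ContinuousAt F z)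
    (hF : ∀ z : ℂ, F (z + ℓ) = F z) : ∃ M > 0, ∀ z : ℂ, |z.im| ≤ R → ‖F z‖ ≤ M := by
  have hK : IsCompact (toC '' (Icc 0 ℓ ×ˢ Icc (-R) R)) :=
    (isCompact_Icc.prod isCompact_Icc).image continuous_toC
  have hcK : ContinuousOn F (toC '' (Icc 0 ℓ ×ˢ Icc (-R) R)) := by
    rintro _ ⟨w, hw, rfl⟩
    exact (hc _ (by rw [toC_im]; exact abs_le.mpr hw.2)).continuousWithinAt
  obtain ⟨M, hM⟩ := hK.exists_bound_of_continuousOn hcK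
  refine ⟨max M 1, by positivity, fun z hz => le_trans ?_ (le_max_left _ _)⟩
  obtain ⟨n, hn⟩ := exists_int_add_mem_Ico hℓ z.re
  rw [← periodic_int hF z n]
  refine hM _ ⟨(z.re + n * ℓ, z.im), ⟨Ico_subset_Icc_self hn, abs_le.mp hz⟩, ?_⟩
  apply Complex.ext <;> simp

lemma exists_pos_le_norm_strip (hℓ : 0 < ℓ) {R : ℝ} (hc : ∀ z : ℂ, |z.im| ≤ R → ContinuousAt F z)
    (h0 : ∀ z : ℂ, |z.im| ≤ R → F z ≠ 0) (hF : ∀ z : ℂ, F (z + ℓ) = F z) :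
    ∃ c > 0, ∀ z : ℂ, |z.im| ≤ R → c ≤ ‖F z‖ := by
  obtain ⟨M, hM, hb⟩ := exists_norm_le_strip (F := fun z => (F z)⁻¹) hℓ
    (fun z hz => (hc z hz).inv₀ (h0 z hz)) (fun z => by rw [hF])
  refine ⟨M⁻¹, by positivity, fun z hz => ?_⟩
  have := hb z hz
  rw [norm_inv] at this
  exact inv_le_of_inv_le₀ (norm_pos_iff.mpr (h0 z hz)) this

lemma iterate_dx_parts {R : ℝ} (hF : ∀ z : ℂ, |z.im| < R → AnalyticAt ℂ F z) (j : ℕ) :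
    ∀ z : ℝ × ℝ, |z.2| < R → dx^[j] (rePart F) z = rePart (iteratedDeriv j F) z ∧
      dx^[j] (imPart F) z = imPart (iteratedDeriv j F) z := by
  induction j with
  | zero => intro z _; simp
  | succ j ih =>
    intro z hz
    have ho : ∀ᶠ w : ℝ × ℝ in 𝓝 z, |w.2| < R :=
      (isOpen_lt (by fun_prop) (by fun_prop)).mem_nhds hz
    have hd := ((hF (toC z) (by rwa [toC_im])).iteratedDeriv' j).differentiableAt
    have e1 : dx^[j] (rePart F) =ᶠ[𝓝 z] rePart (iteratedDeriv j F) := by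
      filter_upwards [ho] with w hw using (ih w hw).1
    have e2 : dx^[j] (imPart F) =ᶠ[𝓝 z] imPart (iteratedDeriv j F) := by
      filter_upwards [ho] with w hw using (ih w hw).2
    rw [Function.iterate_succ_apply', Function.iterate_succ_apply', e1.partial_x.eq_of_nhds,
      e2.partial_x.eq_of_nhds, iteratedDeriv_succ]
    exact ⟨dx_rePart hd, dx_imPart hd⟩

lemma norm_iteratedDeriv_strip_le {M : ℝ} (hh : 0 < h)
    (hF : ∀ z : ℂ, |z.im| ≤ 2 * h → AnalyticAt ℂ F z) (hM : ∀ z : ℂ, |z.im| ≤ 2 * h → ‖F z‖ ≤ M)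
    (j : ℕ) {z : ℂ} (hz : |z.im| ≤ h) : ‖iteratedDeriv j F z‖ ≤ j.factorial * M / h ^ j := by
  have hcl : ∀ w ∈ Metric.closedBall z h, |w.im| ≤ 2 * h := by
    intro w hw
    rw [mem_closedBall_iff_norm] at hw
    have h1 := (Complex.abs_im_le_norm (w - z)).trans hw
    rw [Complex.sub_im] at h1
    rw [abs_le] at *
    constructor <;> linarith
  refine Complex.norm_iteratedDeriv_le_of_forall_mem_sphere_norm_le j hh ?_ ?_
  · refine DifferentiableOn.diffContOnCl fun w hw => ?_
    rw [closure_ball z hh.ne'] at hw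
    exact (hF w (hcl w hw)).differentiableAt.differentiableWithinAt
  · intro w hw
    exact hM w (hcl w (Metric.sphere_subset_closedBall hw))

lemma abs_iterate_dx_mul_self_le {f : ℝ × ℝ → ℝ} {A r : ℝ} (hr : 0 < r) (hf : SmoothStrip h f)
    {q : ℝ × ℝ} (hq : q.2 ∈ Icc 0 h) (hb : ∀ j, |dx^[j] f q| ≤ j.factorial * A / r ^ j) (j : ℕ) :
    |dx^[j] (f * f) q| ≤ (j + 1) * (j.factorial * (A ^ 2 / r ^ j)) := by
  rw [iterate_dx_mul hf hf j hq]
  refine (Finset.abs_sum_le_sum_abs _ _).trans ?_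
  have : ∀ i ∈ Finset.range (j + 1), |(j.choose i : ℝ) * dx^[i] f q * dx^[j - i] f q| ≤
      j.factorial * (A ^ 2 / r ^ j) := by
    intro i hi
    have hij : i ≤ j := Nat.lt_succ_iff.mp (Finset.mem_range.mp hi)
    rw [abs_mul, abs_mul, Nat.abs_cast]
    have h0 : 0 ≤ (i.factorial : ℝ) * A / r ^ i := (abs_nonneg _).trans (hb i)
    calc _ ≤ (j.choose i : ℝ) * (i.factorial * A / r ^ i) * ((j - i).factorial * A / r ^ (j - i)) := by
          gcongr
          · exact hb i
          · exact hb (j - i)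
      _ = ((j.choose i * i.factorial * (j - i).factorial : ℕ) : ℝ) * (A ^ 2 / (r ^ i * r ^ (j - i))) := by
          push_cast
          field_simp
      _ = _ := by
          rw [Nat.choose_mul_factorial_mul_factorial hij, ← pow_add, Nat.add_sub_cancel' hij]
  calc _ ≤ ∑ i ∈ Finset.range (j + 1), (j.factorial * (A ^ 2 / r ^ j) : ℝ) := Finset.sum_le_sum this
    _ = _ := by simp

namespace Collar

variable (H : Collar D ℓ h Q)
include H

lemma analytic' {z : ℝ × ℝ} (hz : |z.2| ≤ 2 * h) : AnalyticAt ℂ Q (toC z) :=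
  H.analytic _ (by rwa [toC_im])

lemma smoothStrip_jac : SmoothStrip h (jac Q) := by
  intro z hz
  have hz' : |z.2| ≤ 2 * h := by rw [abs_of_nonneg hz.1]; linarith [hz.1, hz.2]
  have h1 := (H.analytic' hz').deriv
  have a1 := analyticAt_rePart h1
  have a2 := analyticAt_imPart h1
  exact ((a1.mul a1).add (a2.mul a2)).contDiffAt

lemma analyticAt_jac {z : ℝ × ℝ} (hz : |z.2| ≤ 2 * h) : AnalyticAt ℝ (jac Q) z := by
  have h1 := (H.analytic' hz).deriv
  have a1 := analyticAt_rePart h1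
  have a2 := analyticAt_imPart h1
  exact (a1.mul a1).add (a2.mul a2)

lemma exists_jac_bounds : ∃ c > 0, ∃ K > 0, ∀ z : ℝ × ℝ, |z.2| ≤ h → c ≤ jac Q z ∧ jac Q z ≤ K := by
  have hc : ∀ z : ℂ, |z.im| ≤ h → ContinuousAt (deriv Q) z := fun z hz =>
    (H.analytic z (by linarith [H.h_pos])).deriv.continuousAt
  obtain ⟨M, hM, hb⟩ := exists_norm_le_strip H.len_pos hc (deriv_periodic H.periodic)
  obtain ⟨c, hc0, hcb⟩ := exists_pos_le_norm_strip H.len_pos hc H.deriv_ne (deriv_periodic H.periodic)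
  refine ⟨c ^ 2, by positivity, M ^ 2, by positivity, fun z hz => ?_⟩
  rw [jac_eq]
  have hz' : |(toC z).im| ≤ h := by rwa [toC_im]
  have h1 := hb _ hz'
  have h2 := hcb _ hz'
  constructor <;> gcongr

lemma exists_iterate_dx_jac_le : ∃ C ≥ 0, ∀ j (q : ℝ × ℝ), q.2 ∈ Icc 0 h →
    |dx^[j] (jac Q) q| ≤ C ^ (j + 1) * j.factorial := by
  have hh := H.h_pos
  have ha : ∀ z : ℂ, |z.im| ≤ 2 * h → AnalyticAt ℂ (deriv Q) z := fun z hz => (H.analytic z hz).deriv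
  obtain ⟨M, hM, hb⟩ := exists_norm_le_strip H.len_pos (fun z hz => (ha z hz).continuousAt)
    (deriv_periodic H.periodic)
  have hM' := fun j z hz => norm_iteratedDeriv_strip_le hh ha hb j (z := z) hz
  have hs1 : SmoothStrip h (rePart (deriv Q)) := fun z hz =>
    (analyticAt_rePart (ha _ (by rw [toC_im, abs_of_nonneg hz.1]; linarith [hz.2]))).contDiffAt
  have hs2 : SmoothStrip h (imPart (deriv Q)) := fun z hz =>
    (analyticAt_imPart (ha _ (by rw [toC_im, abs_of_nonneg hz.1]; linarith [hz.2]))).contDiffAt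
  refine ⟨2 * M ^ 2 + 2 / h, by positivity, fun j q hq => ?_⟩
  have hq1 : |q.2| < 2 * h := by rw [abs_of_nonneg hq.1]; linarith [hq.2]
  have hq2 : |(toC q).im| ≤ h := by rw [toC_im, abs_of_nonneg hq.1]; exact hq.2
  have hp := fun j => iterate_dx_parts (R := 2 * h) (fun z hz => ha z hz.le) j q hq1
  have b1 := abs_iterate_dx_mul_self_le hh hs1 hq (fun j => by
    rw [(hp j).1]; exact (Complex.abs_re_le_norm _).trans (hM' j _ hq2)) j
  have b2 := abs_iterate_dx_mul_self_le hh hs2 hq (fun j => by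
    rw [(hp j).2]; exact (Complex.abs_im_le_norm _).trans (hM' j _ hq2)) j
  have e : dx^[j] (jac Q) q = dx^[j] (rePart (deriv Q) * rePart (deriv Q)) q +
      dx^[j] (imPart (deriv Q) * imPart (deriv Q)) q := by
    have a1 := analyticAt_rePart (ha _ (by rw [toC_im]; exact hq1.le))
    have a2 := analyticAt_imPart (ha _ (by rw [toC_im]; exact hq1.le))
    exact ((a1.mul a1).partial_x_iterate_add (a2.mul a2) j).eq_of_nhds
  rw [e]
  have h2 : (j + 1 : ℝ) ≤ 2 ^ j := by exact_mod_cast Nat.lt_two_pow_self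
  calc _ ≤ 2 ^ j * (j.factorial * (M ^ 2 / h ^ j)) + 2 ^ j * (j.factorial * (M ^ 2 / h ^ j)) := by
        refine (abs_add_le _ _).trans (add_le_add (b1.trans ?_) (b2.trans ?_)) <;> gcongr
    _ = (2 * M ^ 2) * (2 / h) ^ j * j.factorial := by rw [div_pow]; ring
    _ ≤ (2 * M ^ 2 + 2 / h) * (2 * M ^ 2 + 2 / h) ^ j * j.factorial := by
        gcongr
        · exact le_add_of_nonneg_right (by positivity)
        · exact le_add_of_nonneg_left (by positivity)
    _ = _ := by ring

end Collar

end CollarMap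

section CollarCalculus
open Set Filter Topology

variable {D : Set (ℝ × ℝ)} {ℓ h : ℝ} {Q : ℂ → ℂ} {Φ : ℝ × ℝ → ℝ} {z : ℝ × ℝ}

lemma planeMap_eq (Q : ℂ → ℂ) :
    planeMap Q = Complex.equivRealProdCLM ∘ Q ∘ Complex.equivRealProdCLM.symm := by
  funext z
  have : Complex.equivRealProdCLM.symm z = toC z := by apply Complex.ext <;> simp
  simp [planeMap, rePart, imPart, this, Complex.equivRealProdCLM_apply]

lemma map_nhds_planeMap (hQ : AnalyticAt ℂ Q (toC z)) (h0 : deriv Q (toC z) ≠ 0) :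
    map (planeMap Q) (𝓝 z) = 𝓝 (planeMap Q z) := by
  have e : Complex.equivRealProdCLM.symm z = toC z := by apply Complex.ext <;> simp
  have h1 : map Q (𝓝 (toC z)) = 𝓝 (Q (toC z)) := by
    have h2 : HasStrictDerivAt Q (deriv Q (toC z)) (toC z) := hQ.hasStrictDerivAt
    exact h2.map_nhds_eq h0
  rw [planeMap_eq, ← map_map, ← map_map]
  have h2 := Complex.equivRealProdCLM.symm.toHomeomorph.map_nhds_eq z
  have h3 := Complex.equivRealProdCLM.toHomeomorph.map_nhds_eq (Q (toC z))
  simp only [ContinuousLinearEquiv.coe_toHomeomorph] at h2 h3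
  rw [h2, e, h1, h3]
  simp [e]

lemma analyticAt_planeMap (hQ : AnalyticAt ℂ Q (toC z)) : AnalyticAt ℝ (planeMap Q) z :=
  (analyticAt_rePart hQ).prod (analyticAt_imPart hQ)

lemma hasFDerivAt_planeMap (hQ : DifferentiableAt ℂ Q (toC z)) :
    HasFDerivAt (planeMap Q) ((fderiv ℝ (rePart Q) z).prod (fderiv ℝ (imPart Q) z)) z :=
  (hasFDerivAt_rePart hQ).differentiableAt.hasFDerivAt.prodMk
    (hasFDerivAt_imPart hQ).differentiableAt.hasFDerivAt

lemma det_fderiv_planeMap (hQ : DifferentiableAt ℂ Q (toC z)) :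
    (fderiv ℝ (planeMap Q) z).det = jac Q z := by
  rw [(hasFDerivAt_planeMap hQ).fderiv, ContinuousLinearMap.det,
    ← LinearMap.det_toMatrix (Module.Basis.finTwoProd ℝ), Matrix.det_fin_two]
  simp only [LinearMap.toMatrix_apply]
  simp
  have h1 := dx_rePart hQ
  have h2 := dy_rePart hQ
  have h3 := dx_imPart hQ
  have h4 := dy_imPart hQ
  simp only [dx, dy] at h1 h2 h3 h4
  rw [h1, h2, h3, h4]
  simp [jac]

lemma dx_comp_planeMap (hQ : DifferentiableAt ℂ Q (toC z)) (hΦ : DifferentiableAt ℝ Φ (planeMap Q z)) :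
    dx (Φ ∘ planeMap Q) z = rePart (deriv Q) z * dx Φ (planeMap Q z) +
      imPart (deriv Q) z * dy Φ (planeMap Q z) := by
  rw [dx, (hΦ.hasFDerivAt.comp z (hasFDerivAt_planeMap hQ)).fderiv]
  simp only [ContinuousLinearMap.comp_apply, ContinuousLinearMap.prod_apply, fderiv_eq_partial (f := Φ)]
  have h1 := dx_rePart hQ
  have h3 := dx_imPart hQ
  simp only [dx] at h1 h3
  rw [h1, h3]

lemma dy_comp_planeMap (hQ : DifferentiableAt ℂ Q (toC z)) (hΦ : DifferentiableAt ℝ Φ (planeMap Q z)) :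
    dy (Φ ∘ planeMap Q) z = -imPart (deriv Q) z * dx Φ (planeMap Q z) +
      rePart (deriv Q) z * dy Φ (planeMap Q z) := by
  rw [dy, (hΦ.hasFDerivAt.comp z (hasFDerivAt_planeMap hQ)).fderiv]
  simp only [ContinuousLinearMap.comp_apply, ContinuousLinearMap.prod_apply, fderiv_eq_partial (f := Φ)]
  have h1 := dy_rePart hQ
  have h3 := dy_imPart hQ
  simp only [dy] at h1 h3
  rw [h1, h3]

/-- Conformal invariance of the Dirichlet form. -/
lemma grad_comp_planeMap {Ψ : ℝ × ℝ → ℝ} (hQ : DifferentiableAt ℂ Q (toC z))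
    (hΦ : DifferentiableAt ℝ Φ (planeMap Q z)) (hΨ : DifferentiableAt ℝ Ψ (planeMap Q z)) :
    dx (Φ ∘ planeMap Q) z * dx (Ψ ∘ planeMap Q) z + dy (Φ ∘ planeMap Q) z * dy (Ψ ∘ planeMap Q) z =
      jac Q z * (dx Φ (planeMap Q z) * dx Ψ (planeMap Q z) +
        dy Φ (planeMap Q z) * dy Ψ (planeMap Q z)) := by
  rw [dx_comp_planeMap hQ hΦ, dx_comp_planeMap hQ hΨ, dy_comp_planeMap hQ hΦ,
    dy_comp_planeMap hQ hΨ]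
  simp only [jac, Pi.add_apply, Pi.mul_apply]
  ring

/-- Conformal covariance of the Laplacian. -/
lemma lap_comp_planeMap (hQ : AnalyticAt ℂ Q (toC z)) (hΦ : AnalyticAt ℝ Φ (planeMap Q z)) :
    dx (dx (Φ ∘ planeMap Q)) z + dy (dy (Φ ∘ planeMap Q)) z =
      jac Q z * (dx (dx Φ) (planeMap Q z) + dy (dy Φ) (planeMap Q z)) := by
  have hT := analyticAt_planeMap hQ
  have eQ : ∀ᶠ w in 𝓝 z, AnalyticAt ℂ Q (toC w) :=
    (analyticAt_toC z).continuousAt.eventually hQ.eventually_analyticAt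
  have eΦ : ∀ᶠ w in 𝓝 z, AnalyticAt ℝ Φ (planeMap Q w) :=
    hT.continuousAt.eventually hΦ.eventually_analyticAt
  have e1 : dx (Φ ∘ planeMap Q) =ᶠ[𝓝 z] rePart (deriv Q) * (dx Φ ∘ planeMap Q) +
      imPart (deriv Q) * (dy Φ ∘ planeMap Q) := by
    filter_upwards [eQ, eΦ] with w h1 h2
    exact dx_comp_planeMap h1.differentiableAt h2.differentiableAt
  have e2 : dy (Φ ∘ planeMap Q) =ᶠ[𝓝 z] (fun w => (-1) * imPart (deriv Q) w) * (dx Φ ∘ planeMap Q) +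
      rePart (deriv Q) * (dy Φ ∘ planeMap Q) := by
    filter_upwards [eQ, eΦ] with w h1 h2
    rw [dy_comp_planeMap h1.differentiableAt h2.differentiableAt]
    simp
  have dQ := hQ.differentiableAt
  have dQ' := hQ.deriv.differentiableAt
  have a1 := (analyticAt_rePart hQ.deriv).differentiableAt
  have a2 := (analyticAt_imPart hQ.deriv).differentiableAt
  have p1 := hΦ.partial_x.differentiableAt
  have p2 := hΦ.partial_y.differentiableAt
  have c1 : DifferentiableAt ℝ (dx Φ ∘ planeMap Q) z := p1.comp z hT.differentiableAt
  have c2 : DifferentiableAt ℝ (dy Φ ∘ planeMap Q) z := p2.comp z hT.differentiableAt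
  have a3 : DifferentiableAt ℝ (fun w => (-1) * imPart (deriv Q) w) z := a2.const_mul _
  rw [e1.partial_x.eq_of_nhds, e2.partial_y.eq_of_nhds, dx_add (a1.mul c1) (a2.mul c2),
    dy_add (a3.mul c1) (a1.mul c2), dx_mul a1 c1, dx_mul a2 c2, dy_mul a3 c1, dy_mul a1 c2,
    dx_comp_planeMap dQ p1, dx_comp_planeMap dQ p2, dy_comp_planeMap dQ p1, dy_comp_planeMap dQ p2,
    dx_rePart dQ', dx_imPart dQ', dy_rePart dQ', dy_const_mul]
  beta_reduce
  rw [dy_imPart dQ', ← dx_dy_comm hΦ.contDiffAt]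
  simp only [jac, Pi.add_apply, Pi.mul_apply, Function.comp]
  ring

end CollarCalculus

/-- A nontrivial Neumann eigenfunction on a plane domain with collar coordinates `Q`. -/
structure CollarEigenfunction (D : Set (ℝ × ℝ)) (Q : ℂ → ℂ) (lam : ℝ) (Φ : ℝ × ℝ → ℝ) : Prop where
  analytic : ∀ w ∈ closure D, AnalyticAt ℝ Φ w
  eigen : ∀ w ∈ D, dx (dx Φ) w + dy (dy Φ) w = -lam ^ 2 * Φ w
  neumann : ∀ x, dy (Φ ∘ planeMap Q) (x, 0) = 0
  nontrivial : ∃ w ∈ D, Φ w ≠ 0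

section CollarEigen
open Set Filter Topology

variable {D : Set (ℝ × ℝ)} {ℓ h lam : ℝ} {Q : ℂ → ℂ} {Φ : ℝ × ℝ → ℝ} {z : ℝ × ℝ}

namespace Collar

lemma mem_closure (H : Collar D ℓ h Q) (hz : z.2 ∈ Icc 0 h) : planeMap Q z ∈ closure D := by
  rcases hz.1.eq_or_lt with h0 | h0
  · have : z = (z.1, 0) := Prod.ext rfl h0.symm
    rw [this]
    exact frontier_subset_closure (H.boundary z.1)
  · exact subset_closure (H.inside z h0 hz.2)

lemma map_nhds (H : Collar D ℓ h Q) (hz : |z.2| ≤ h) :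
    map (planeMap Q) (𝓝 z) = 𝓝 (planeMap Q z) :=
  map_nhds_planeMap (H.analytic' (by linarith [H.h_pos])) (H.deriv_ne _ (by rwa [toC_im]))

lemma abs_snd_le (H : Collar D ℓ h Q) (hz : z.2 ∈ Icc 0 h) : |z.2| ≤ 2 * h := by
  rw [abs_of_nonneg hz.1]; linarith [hz.2, H.h_pos]

lemma periodic_planeMap (H : Collar D ℓ h Q) (x y : ℝ) :
    planeMap Q (x + ℓ, y) = planeMap Q (x, y) :=
  Prod.ext ((PeriodicX.of_complex H.periodic).1 x y) ((PeriodicX.of_complex H.periodic).2 x y)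

end Collar

namespace CollarEigenfunction

variable (S : CollarEigenfunction D Q lam Φ)
include S

lemma eigen_nhds {w : ℝ × ℝ} (hw : w ∈ closure D) (hD : IsOpen D) :
    dx (dx Φ) + dy (dy Φ) =ᶠ[𝓝 w] fun w => -lam ^ 2 * Φ w := by
  obtain ⟨r, hr, hb⟩ := Metric.eventually_nhds_iff_ball.mp (S.analytic w hw).eventually_analyticAt
  have hA : AnalyticOnNhd ℝ (dx (dx Φ) + dy (dy Φ)) (Metric.ball w r) := fun u hu =>
    (hb u hu).partial_x.partial_x.add (hb u hu).partial_y.partial_y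
  have hB : AnalyticOnNhd ℝ (fun w => -lam ^ 2 * Φ w) (Metric.ball w r) := fun u hu =>
    analyticAt_const.mul (hb u hu)
  obtain ⟨u, hu, huD⟩ := mem_closure_iff_nhds.mp hw _ (Metric.ball_mem_nhds w hr)
  have := hA.eqOn_of_preconnected_of_eventuallyEq hB (convex_ball w r).isPreconnected hu
    (by filter_upwards [hD.mem_nhds huD] with y hy using S.eigen y hy)
  filter_upwards [Metric.ball_mem_nhds w hr] with y hy using this hy

lemma analyticAt_comp (H : Collar D ℓ h Q) (hz : z.2 ∈ Icc 0 h) :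
    AnalyticAt ℝ (Φ ∘ planeMap Q) z :=
  (S.analytic _ (H.mem_closure hz)).comp (analyticAt_planeMap (H.analytic' (H.abs_snd_le hz)))

lemma strip_eq (H : Collar D ℓ h Q) (hz : z.2 ∈ Icc 0 h) :
    dx (dx (Φ ∘ planeMap Q)) + dy (dy (Φ ∘ planeMap Q)) =ᶠ[𝓝 z]
      (fun w => -lam ^ 2 * jac Q w) * (Φ ∘ planeMap Q) := by
  have hQ := H.analytic' (H.abs_snd_le hz)
  have hT := (analyticAt_planeMap hQ).continuousAt
  filter_upwards [(analyticAt_toC z).continuousAt.eventually hQ.eventually_analyticAt,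
    hT.eventually (S.analytic _ (H.mem_closure hz)).eventually_analyticAt,
    hT.eventually (S.eigen_nhds (H.mem_closure hz) H.isOpen)] with w h1 h2 h3
  rw [Pi.add_apply, lap_comp_planeMap h1 h2]
  simp only [Pi.add_apply] at h3
  rw [h3]
  simp only [Pi.mul_apply, Function.comp]
  ring

lemma stripSolution (H : Collar D ℓ h Q) {C : ℝ} (hC : ∀ j (q : ℝ × ℝ), q.2 ∈ Icc 0 h →
    |dx^[j] (jac Q) q| ≤ C ^ (j + 1) * j.factorial) :
    StripSolution ℓ h C lam (jac Q) (Φ ∘ planeMap Q) where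
  smooth_v z hz := (S.analyticAt_comp H hz).contDiffAt
  smooth_p := H.smoothStrip_jac
  periodic x y := congrArg Φ (H.periodic_planeMap x y)
  eqn z hz := by
    have := (S.strip_eq H hz).eq_of_nhds
    simp only [Pi.add_apply, Pi.mul_apply] at this
    rw [this]; ring
  neumann := S.neumann
  bound := hC

lemma analyticOnNhd_trace (H : Collar D ℓ h Q) :
    AnalyticOnNhd ℝ (fun x => (Φ ∘ planeMap Q) (x, 0)) univ := fun x _ => by
  have h1 : AnalyticAt ℝ (Φ ∘ planeMap Q) (x, 0) := S.analyticAt_comp H ⟨le_rfl, H.h_pos.le⟩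
  exact h1.comp (f := fun x : ℝ => (x, (0 : ℝ))) (analyticAt_id.prod analyticAt_const)

/-- Unique continuation from the collar. -/
lemma exists_ne_zero (H : Collar D ℓ h Q) :
    ∃ z : ℝ × ℝ, z ∈ Ioo 0 ℓ ×ˢ Ioo 0 h ∧ (Φ ∘ planeMap Q) z ≠ 0 := by
  by_contra! hcon
  have hℓ := H.len_pos
  have hh := H.h_pos
  set z₀ : ℝ × ℝ := (ℓ / 2, h / 2) with hz₀
  have hz0 : z₀ ∈ Ioo 0 ℓ ×ˢ Ioo 0 h := ⟨⟨by positivity, by simp [hz₀, hℓ]⟩,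
    ⟨by positivity, by simp [hz₀, hh]⟩⟩
  have hD0 : planeMap Q z₀ ∈ D := H.inside z₀ hz0.2.1 hz0.2.2.le
  have hev : Φ =ᶠ[𝓝 (planeMap Q z₀)] fun _ => 0 := by
    rw [← H.map_nhds (z := z₀) (by rw [abs_of_pos hz0.2.1]; exact hz0.2.2.le)]
    change ∀ᶠ y in map (planeMap Q) (𝓝 z₀), Φ y = 0
    rw [eventually_map]
    filter_upwards [(isOpen_Ioo.prod isOpen_Ioo).mem_nhds hz0] with y hy using hcon y hy
  have hA : AnalyticOnNhd ℝ Φ D := fun w hw => S.analytic w (subset_closure hw)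
  obtain ⟨w, hw, hne⟩ := S.nontrivial
  exact hne (hA.eqOn_zero_of_preconnected_of_eventuallyEq_zero H.isPreconnected hD0 hev hw)

end CollarEigenfunction

/-- Points of the domain near the boundary lie in the image of the open collar. -/
lemma Collar.exists_collar_point (H : Collar D ℓ h Q) (x : ℝ) {W : Set (ℝ × ℝ)}
    (hW : W ∈ 𝓝 (x, (0 : ℝ))) {K : Set (ℝ × ℝ)} (hK : K ⊆ D)
    (hx : planeMap Q (x, 0) ∈ closure K) :
    ∃ z ∈ W, 0 < z.2 ∧ z.2 ≤ h ∧ planeMap Q z ∈ K := by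
  have hh := H.h_pos
  have hV : W ∩ {z : ℝ × ℝ | |z.2| < h} ∈ 𝓝 (x, (0 : ℝ)) :=
    inter_mem hW ((isOpen_lt (by fun_prop) (by fun_prop)).mem_nhds (by simpa using hh))
  have hn := H.map_nhds (z := (x, 0)) (by simpa using hh.le)
  have hI : planeMap Q '' (W ∩ {z : ℝ × ℝ | |z.2| < h}) ∈ 𝓝 (planeMap Q (x, 0)) :=
    hn ▸ image_mem_map hV
  obtain ⟨_, ⟨z, ⟨hzW, hz⟩, rfl⟩, hzK⟩ := mem_closure_iff_nhds.mp hx _ hI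
  have hz' := _root_.abs_lt.mp (show |z.2| < h from hz)
  refine ⟨z, hzW, ?_, hz'.2.le, hzK⟩
  by_contra! hneg
  rcases hneg.eq_or_lt with h0 | h0
  · have e : z = (z.1, 0) := Prod.ext rfl h0
    have h1 := H.boundary z.1
    rw [← e, H.isOpen.frontier_eq] at h1
    exact h1.2 (hK hzK)
  · exact H.outside z hz'.1.le h0 (hK hzK)

end CollarEigen

section Cutoff
open Set Filter Topology
open scoped Manifold ContDiff

variable {D : Set (ℝ × ℝ)} {ℓ h δ : ℝ} {Q : ℂ → ℂ} {F χ Φ : ℝ × ℝ → ℝ}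

namespace Collar

lemma isOpen_image (H : Collar D ℓ h Q) {W : Set (ℝ × ℝ)} (hW : IsOpen W)
    (hh : ∀ z ∈ W, |z.2| ≤ h) : IsOpen (planeMap Q '' W) := by
  rw [isOpen_iff_mem_nhds]
  rintro _ ⟨z, hz, rfl⟩
  rw [← H.map_nhds (hh z hz)]
  exact image_mem_map (hW.mem_nhds hz)

lemma planeMap_int (H : Collar D ℓ h Q) (x y : ℝ) (n : ℤ) :
    planeMap Q (x + n * ℓ, y) = planeMap Q (x, y) := by
  have e : toC (x + n * ℓ, y) = toC (x, y) + ((n * ℓ : ℝ) : ℂ) := by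
    rw [toC_add]
  simp only [planeMap, rePart, imPart, e, periodic_int H.periodic]

lemma exists_mem_Ico (H : Collar D ℓ h Q) (z : ℝ × ℝ) :
    ∃ z' : ℝ × ℝ, z'.1 ∈ Ico 0 ℓ ∧ z'.2 = z.2 ∧ planeMap Q z' = planeMap Q z := by
  obtain ⟨n, hn⟩ := exists_int_add_mem_Ico H.len_pos z.1
  exact ⟨(z.1 + n * ℓ, z.2), hn, rfl, H.planeMap_int z.1 z.2 n⟩

/-- A cutoff function, equal to `1` away from the collar of width `δ`. -/
lemma exists_cutoff (H : Collar D ℓ h Q) (hδ : 0 < δ) (hδh : δ ≤ h) :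
    ∃ χ : ℝ × ℝ → ℝ, IsTestFun χ ∧ tsupport χ ⊆ D ∧ (∀ w, χ w ∈ Icc (0 : ℝ) 1) ∧
      ∀ w ∈ D, (∃ z : ℝ × ℝ, z.1 ∈ Ico 0 ℓ ∧ 0 < z.2 ∧ z.2 < δ ∧ planeMap Q z = w) ∨
        χ =ᶠ[𝓝 w] fun _ => 1 := by
  set W : Set (ℝ × ℝ) := {z | |z.2| < δ} with hW
  have hWo : IsOpen (planeMap Q '' W) :=
    H.isOpen_image (isOpen_lt (by fun_prop) (by fun_prop)) fun z hz =>
      (show |z.2| < δ from hz).le.trans hδh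
  have hc : IsCompact (closure D \ planeMap Q '' W) := H.isBounded.isCompact_closure.diff hWo
  have hsub : closure D \ planeMap Q '' W ⊆ D := by
    rintro w ⟨hw, hn⟩
    by_contra hD
    obtain ⟨x, -, rfl⟩ := H.surj w (by rw [H.isOpen.frontier_eq]; exact ⟨hw, hD⟩)
    exact hn ⟨(x, 0), by simpa [hW] using hδ, rfl⟩
  obtain ⟨L, hL, hKL, hLD⟩ := exists_compact_between hc H.isOpen hsub
  obtain ⟨f, hf1, hf0, hf⟩ := exists_contMDiffMap_one_nhds_of_subset_interior (n := (⊤ : ℕ∞))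
    𝓘(ℝ, ℝ × ℝ) hc.isClosed hKL
  have hsupp : tsupport f ⊆ L := closure_minimal (fun w hw => by
    by_contra hn
    exact hw (hf0 w hn)) hL.isClosed
  refine ⟨f, ⟨f.contMDiff.contDiff, hL.of_isClosed_subset (isClosed_tsupport _) hsupp⟩,
    hsupp.trans hLD, hf, fun w hw => ?_⟩
  by_cases hwW : w ∈ planeMap Q '' W
  · left
    obtain ⟨z, hz, rfl⟩ := hwW
    obtain ⟨z', h1, h2, h3⟩ := H.exists_mem_Ico z
    have hz' := _root_.abs_lt.mp (show |z.2| < δ from hz)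
    refine ⟨z', h1, ?_, by rw [h2]; exact hz'.2, h3⟩
    rw [h2]
    by_contra! hneg
    rcases hneg.eq_or_lt with h0 | h0
    · have e : z = (z.1, 0) := Prod.ext rfl h0
      have h1 := H.boundary z.1
      rw [← e, H.isOpen.frontier_eq] at h1
      exact h1.2 hw
    · exact H.outside z (by linarith [hz'.1]) h0 hw
  · right
    exact (mem_nhdsSet_iff_forall.mp hf1) w ⟨subset_closure hw, hwW⟩

lemma rectInt_jac_mul (H : Collar D ℓ h Q) (F : ℝ × ℝ → ℝ) :
    rectInt ℓ 0 h (fun z => jac Q z * F (planeMap Q z)) =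
      ∫ w in planeMap Q '' (Ico 0 ℓ ×ˢ Ioc 0 h), F w := by
  have hmem : ∀ z ∈ Ico 0 ℓ ×ˢ Ioc 0 h, |z.2| ≤ 2 * h := fun z hz => H.abs_snd_le ⟨hz.2.1.le, hz.2.2⟩
  rw [integral_image_eq_integral_abs_det_fderiv_smul volume
    (measurableSet_Ico.prod measurableSet_Ioc)
    (fun z hz => (analyticAt_planeMap
      (H.analytic' (hmem z hz))).differentiableAt.hasFDerivAt.hasFDerivWithinAt)
    (H.inj.mono (prod_mono_right Ioc_subset_Icc_self)), rectInt, ← Icc_prod_Icc]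
  have hae : (Ico 0 ℓ ×ˢ Ioc 0 h : Set (ℝ × ℝ)) =ᵐ[volume] Icc 0 ℓ ×ˢ Icc 0 h :=
    Measure.set_prod_ae_eq Ico_ae_eq_Icc Ioc_ae_eq_Icc
  rw [← setIntegral_congr_set hae]
  refine setIntegral_congr_fun (measurableSet_Ico.prod measurableSet_Ioc) fun z hz => ?_
  change _ = |(fderiv ℝ (planeMap Q) z).det| • F (planeMap Q z)
  rw [det_fderiv_planeMap (H.analytic' (hmem z hz)).differentiableAt, abs_of_nonneg (jac_nonneg _ _)]
  rfl

lemma rectInt_jac_le (H : Collar D ℓ h Q) (hF : Integrable F) (h0 : ∀ w, 0 ≤ F w) :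
    rectInt ℓ 0 h (fun z => jac Q z * F (planeMap Q z)) ≤ ∫ w, F w := by
  rw [H.rectInt_jac_mul]
  exact setIntegral_le_integral hF (ae_of_all _ h0)

lemma rectInt_jac_eq (H : Collar D ℓ h Q)
    (h0 : ∀ w, F w ≠ 0 → ∃ z : ℝ × ℝ, z.1 ∈ Ico 0 ℓ ∧ z.2 ∈ Ioc 0 h ∧ planeMap Q z = w) :
    rectInt ℓ 0 h (fun z => jac Q z * F (planeMap Q z)) = ∫ w, F w := by
  rw [H.rectInt_jac_mul]
  refine setIntegral_eq_integral_of_forall_compl_eq_zero fun w hw => ?_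
  by_contra hn
  obtain ⟨z, h1, h2, h3⟩ := h0 w hn
  exact hw ⟨z, ⟨h1, h2⟩, h3⟩

end Collar

/-- A function smooth near the support of a cutoff becomes a test function. -/
lemma IsTestFun.mul_of_tsupport (hχ : IsTestFun χ) (hD : tsupport χ ⊆ D)
    (hΦ : ∀ w ∈ D, AnalyticAt ℝ Φ w) : IsTestFun (χ * Φ) := by
  refine ⟨contDiff_iff_contDiffAt.mpr fun w => ?_, hχ.2.mul_right⟩
  by_cases hw : w ∈ tsupport χ
  · exact hχ.1.contDiffAt.mul (hΦ w (hD hw)).contDiffAt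
  · have : χ * Φ =ᶠ[𝓝 w] fun _ => 0 := by
      filter_upwards [notMem_tsupport_iff_eventuallyEq.mp hw] with y hy
      simp [hy]
    exact contDiffAt_const.congr_of_eventuallyEq this

end Cutoff

section MassBound
open Set Filter Topology

variable {D : Set (ℝ × ℝ)} {ℓ h lam δ : ℝ} {Q : ℂ → ℂ} {F χ Φ : ℝ × ℝ → ℝ} {w : ℝ × ℝ}

lemma lap_mul (hχ : IsTestFun χ) (hΦ : AnalyticAt ℝ Φ w) :
    dx (dx (χ * Φ)) w + dy (dy (χ * Φ)) w =
      Φ w * (dx (dx χ) w + dy (dy χ) w) + 2 * (dx χ w * dx Φ w + dy χ w * dy Φ w) +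
        χ w * (dx (dx Φ) w + dy (dy Φ) w) := by
  have ex : dx (χ * Φ) =ᶠ[𝓝 w] dx χ * Φ + χ * dx Φ := by
    filter_upwards [hΦ.eventually_analyticAt] with y hy
    rw [dx_mul (hχ.diff y) hy.differentiableAt]
    simp
  have ey : dy (χ * Φ) =ᶠ[𝓝 w] dy χ * Φ + χ * dy Φ := by
    filter_upwards [hΦ.eventually_analyticAt] with y hy
    rw [dy_mul (hχ.diff y) hy.differentiableAt]
    simp
  have dΦ := hΦ.differentiableAt
  have dΦx := hΦ.partial_x.differentiableAt
  have dΦy := hΦ.partial_y.differentiableAt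
  rw [ex.partial_x.eq_of_nhds, ey.partial_y.eq_of_nhds,
    dx_add ((hχ.dx.diff w).mul dΦ) ((hχ.diff w).mul dΦx),
    dy_add ((hχ.dy.diff w).mul dΦ) ((hχ.diff w).mul dΦy),
    dx_mul (hχ.dx.diff w) dΦ, dx_mul (hχ.diff w) dΦx,
    dy_mul (hχ.dy.diff w) dΦ, dy_mul (hχ.diff w) dΦy]
  ring

lemma IsTestFun.exists_abs_le (hχ : IsTestFun χ) : ∃ K > 0, ∀ w, |χ w| ≤ K := by
  obtain ⟨K, hK⟩ := hχ.2.exists_bound_of_continuous hχ.cont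
  exact ⟨|K| + 1, by positivity, fun w => (hK w).trans ((le_abs_self K).trans (by linarith))⟩

lemma IsTestFun.apply_eq_zero (hD : tsupport χ ⊆ D) (hw : w ∉ D) :
    χ w = 0 ∧ dx χ w = 0 ∧ dy χ w = 0 ∧ dx (dx χ) w = 0 ∧ dy (dy χ) w = 0 := by
  have h0 : χ =ᶠ[𝓝 w] fun _ => 0 := notMem_tsupport_iff_eventuallyEq.mp fun h => hw (hD h)
  have hx := h0.partial_x
  have hy := h0.partial_y
  rw [dx_const] at hx
  rw [dy_const] at hy
  have hxx := hx.partial_x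
  have hyy := hy.partial_y
  rw [dx_const] at hxx
  rw [dy_const] at hyy
  exact ⟨h0.eq_of_nhds, hx.eq_of_nhds, hy.eq_of_nhds, hxx.eq_of_nhds, hyy.eq_of_nhds⟩

lemma partial_eq_zero_of_eq_one (h1 : χ =ᶠ[𝓝 w] fun _ => 1) :
    χ w = 1 ∧ dx χ w = 0 ∧ dy χ w = 0 ∧ dx (dx χ) w = 0 ∧ dy (dy χ) w = 0 := by
  have hx := h1.partial_x
  have hy := h1.partial_y
  rw [dx_const] at hx
  rw [dy_const] at hy
  have hxx := hx.partial_x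
  have hyy := hy.partial_y
  rw [dx_const] at hxx
  rw [dy_const] at hyy
  exact ⟨h1.eq_of_nhds, hx.eq_of_nhds, hy.eq_of_nhds, hxx.eq_of_nhds, hyy.eq_of_nhds⟩

lemma rectInt_pos {f : ℝ × ℝ → ℝ} (hf : ContinuousOn f {p | p.2 ∈ Icc 0 h}) (h0 : ∀ p, 0 ≤ f p)
    {z : ℝ × ℝ} (hz : z ∈ Ioo 0 ℓ ×ˢ Ioo 0 h) (hne : f z ≠ 0) : 0 < rectInt ℓ 0 h f := by
  rw [rectInt, setIntegral_pos_iff_support_of_nonneg_ae (ae_of_all _ h0)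
    (integrableOn_rect le_rfl hf)]
  have hc : ContinuousAt f z := hf.continuousAt (mem_of_superset
    ((isOpen_Ioo.prod isOpen_Ioo).mem_nhds hz) fun p hp => ⟨hp.2.1.le, hp.2.2.le⟩)
  have hn : Function.support f ∩ Icc (0, 0) (ℓ, h) ∈ 𝓝 z := by
    filter_upwards [hc.eventually_ne hne, (isOpen_Ioo.prod isOpen_Ioo).mem_nhds hz] with p h1 h2
    exact ⟨h1, ⟨⟨h2.1.1.le, h2.2.1.le⟩, ⟨h2.1.2.le, h2.2.2.le⟩⟩⟩
  exact Measure.measure_pos_of_mem_nhds volume hn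

namespace Collar

lemma continuousOn_planeMap (H : Collar D ℓ h Q) : ContinuousOn (planeMap Q) {p | p.2 ∈ Icc 0 h} :=
  fun _ hz => (analyticAt_planeMap (H.analytic' (H.abs_snd_le hz))).continuousAt.continuousWithinAt

lemma exists_abs_fst_le (H : Collar D ℓ h Q) : ∃ R > 0, ∀ w ∈ D, |w.1| ≤ R := by
  obtain ⟨R, hR⟩ := H.isBounded.exists_norm_le
  exact ⟨|R| + 1, by positivity, fun w hw => ((norm_fst_le w).trans (hR w hw)).trans
    ((le_abs_self R).trans (by linarith))⟩

set_option maxHeartbeats 1000000 in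
/-- An eigenfunction small on a collar has small mass. -/
lemma exists_mass_bound (H : Collar D ℓ h Q) (hδ : 0 < δ) (hδh : δ ≤ h) :
    ∃ A > 0, ∀ lam Φ, CollarEigenfunction D Q lam Φ → ∀ S ≥ 0,
      (∀ q : ℝ × ℝ, q.2 ∈ Icc 0 δ → |(Φ ∘ planeMap Q) q| ≤ S ∧ |dx (Φ ∘ planeMap Q) q| ≤ S ∧
        |dy (Φ ∘ planeMap Q) q| ≤ S) →
      √(rectInt ℓ 0 h (fun q => (Φ ∘ planeMap Q) q ^ 2)) ≤ A * S := by
  obtain ⟨χ, hχ, hχD, hχ01, hχ1⟩ := H.exists_cutoff hδ hδh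
  obtain ⟨c, hc, K₀, _, hj⟩ := H.exists_jac_bounds
  obtain ⟨R, hR, hRD⟩ := H.exists_abs_fst_le
  obtain ⟨K₁, hK₁, h1⟩ := hχ.dx.exists_abs_le
  obtain ⟨K₂, hK₂, h2⟩ := hχ.dy.exists_abs_le
  obtain ⟨K₃, hK₃, h3⟩ := (hχ.dx.dx.add hχ.dy.dy).exists_abs_le
  set G : ℝ := √(2 / c) with hG
  set B : ℝ := K₃ + 2 * (K₁ * G + K₂ * G) with hB
  set V : ℝ := (volume (closure D)).toReal with hV
  set I₁ : ℝ := rectInt ℓ 0 h (fun _ => 1) with hI₁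
  have hI₁0 : 0 ≤ I₁ := rectInt_nonneg fun _ _ => zero_le_one
  have hV0 : 0 ≤ V := ENNReal.toReal_nonneg
  set A₀ : ℝ := I₁ + c⁻¹ * (R ^ 2 * Real.exp (4 * R) * (B ^ 2 * V)) with hA₀
  have hA₀0 : 0 ≤ A₀ := by positivity
  refine ⟨√A₀ + 1, by positivity, fun lam Φ E S hS hb => ?_⟩
  have hΦD : ∀ w ∈ D, AnalyticAt ℝ Φ w := fun w hw => E.analytic w (subset_closure hw)
  have hf : IsTestFun (χ * Φ) := hχ.mul_of_tsupport hχD hΦD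
  have hfD : tsupport (χ * Φ) ⊆ D := (tsupport_mul_subset_left (f := χ) (g := Φ)).trans hχD
  have hg := (hf.dx.dx.add hf.dy.dy).add (hf.const_mul (lam ^ 2))
  have hgb : ∀ w, (dx (dx (χ * Φ)) w + dy (dy (χ * Φ)) w + lam ^ 2 * (χ * Φ) w) ^ 2 ≤
      (closure D).indicator (fun _ => B ^ 2 * S ^ 2) w := by
    intro w
    by_cases hw : w ∈ D
    · rw [indicator_of_mem (subset_closure hw), lap_mul hχ (hΦD w hw), E.eigen w hw, Pi.mul_apply]
      rcases hχ1 w hw with ⟨z, -, hz0, hzδ, rfl⟩ | hone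
      · have hQz := H.analytic' (z := z) (H.abs_snd_le ⟨hz0.le, hzδ.le.trans hδh⟩)
        have hgr := grad_comp_planeMap hQz.differentiableAt (hΦD _ hw).differentiableAt
          (hΦD _ hw).differentiableAt
        obtain ⟨b0, bx, bqy⟩ := hb z ⟨hz0.le, hzδ.le⟩
        have hjz := (hj z (by rw [abs_of_pos hz0]; exact hzδ.le.trans hδh)).1
        have hgrad : dx Φ (planeMap Q z) ^ 2 + dy Φ (planeMap Q z) ^ 2 ≤ 2 / c * S ^ 2 := by
          rw [div_mul_eq_mul_div, le_div_iff₀ hc]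
          have := sq_le_sq' (abs_le.mp bx).1 (abs_le.mp bx).2
          have := sq_le_sq' (abs_le.mp bqy).1 (abs_le.mp bqy).2
          nlinarith [mul_le_mul_of_nonneg_right hjz (by positivity :
            0 ≤ dx Φ (planeMap Q z) ^ 2 + dy Φ (planeMap Q z) ^ 2)]
        have hG2 : G ^ 2 = 2 / c := Real.sq_sqrt (by positivity)
        have hG0 : 0 ≤ G := Real.sqrt_nonneg _
        have gx : |dx Φ (planeMap Q z)| ≤ G * S := abs_le_of_sq_le_sq
          (by rw [mul_pow, hG2]; nlinarith [sq_nonneg (dy Φ (planeMap Q z))]) (by positivity)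
        have gy : |dy Φ (planeMap Q z)| ≤ G * S := abs_le_of_sq_le_sq
          (by rw [mul_pow, hG2]; nlinarith [sq_nonneg (dx Φ (planeMap Q z))]) (by positivity)
        rw [← mul_pow]
        refine sq_le_sq' ?_ ?_ <;>
        · have e1 : |Φ (planeMap Q z) * (dx (dx χ) (planeMap Q z) + dy (dy χ) (planeMap Q z))| ≤
              S * K₃ := by
            rw [abs_mul]; exact mul_le_mul b0 (h3 _) (abs_nonneg _) hS
          have e2 : |dx χ (planeMap Q z) * dx Φ (planeMap Q z)| ≤ K₁ * (G * S) := by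
            rw [abs_mul]; exact mul_le_mul (h1 _) gx (abs_nonneg _) hK₁.le
          have e3 : |dy χ (planeMap Q z) * dy Φ (planeMap Q z)| ≤ K₂ * (G * S) := by
            rw [abs_mul]; exact mul_le_mul (h2 _) gy (abs_nonneg _) hK₂.le
          rw [hB]
          nlinarith [abs_le.mp e1, abs_le.mp e2, abs_le.mp e3]
      · obtain ⟨o0, ox, oy, oxx, oyy⟩ := partial_eq_zero_of_eq_one hone
        rw [o0, ox, oy, oxx, oyy]
        ring_nf
        positivity
    · obtain ⟨o0, ox, oy, oxx, oyy⟩ := IsTestFun.apply_eq_zero hfD hw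
      rw [oxx, oyy, o0]
      simp only [add_zero, mul_zero, ne_eq, OfNat.ofNat_ne_zero, not_false_eq_true, zero_pow]
      exact indicator_nonneg (fun _ _ => by positivity) w
  have hVfin : volume (closure D) ≠ ⊤ := H.isBounded.isCompact_closure.measure_lt_top.ne
  have hgi : ∫ w, (dx (dx (χ * Φ)) w + dy (dy (χ * Φ)) w + lam ^ 2 * (χ * Φ) w) ^ 2 ≤
      B ^ 2 * V * S ^ 2 := by
    refine (integral_mono hg.integrable_sq ((integrable_indicator_iff isClosed_closure.measurableSet).mpr
      (integrableOn_const hVfin)) hgb).trans_eq ?_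
    rw [integral_indicator isClosed_closure.measurableSet, setIntegral_const, smul_eq_mul, hV,
      Measure.real]
    ring
  have hfi := hf.integral_sq_le (R := R) (fun z hz => hRD z (by
    by_contra hn
    exact hz (IsTestFun.apply_eq_zero hfD hn).1))
    (lam ^ 2)
  have hv : ContinuousOn (Φ ∘ planeMap Q) {p | p.2 ∈ Icc 0 h} := fun z hz =>
    (E.analyticAt_comp H hz).continuousAt.continuousWithinAt
  have hjc : ContinuousOn (fun z => jac Q z * ((χ * Φ) (planeMap Q z)) ^ 2) {p | p.2 ∈ Icc 0 h} :=
    H.smoothStrip_jac.cont.mul ((hf.cont.comp_continuousOn H.continuousOn_planeMap).pow 2)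
  have hmass : rectInt ℓ 0 h (fun q => (Φ ∘ planeMap Q) q ^ 2) ≤
      rectInt ℓ 0 h (fun q => S ^ 2 * 1 + c⁻¹ * (jac Q q * ((χ * Φ) (planeMap Q q)) ^ 2)) := by
    refine rectInt_mono le_rfl (hv.pow 2) (continuousOn_const.add (continuousOn_const.mul hjc))
      fun q hq => ?_
    have hq2 : q.2 ∈ Icc 0 h := ⟨hq.1.2, hq.2.2⟩
    have hjq := (hj q (by rw [abs_of_nonneg hq2.1]; exact hq2.2)).1
    have hjn := jac_nonneg Q q
    have hsmall : |(Φ ∘ planeMap Q) q| ≤ S →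
        (Φ ∘ planeMap Q) q ^ 2 ≤ S ^ 2 * 1 + c⁻¹ * (jac Q q * ((χ * Φ) (planeMap Q q)) ^ 2) := by
      intro hle
      have := sq_le_sq' (abs_le.mp hle).1 (abs_le.mp hle).2
      have : 0 ≤ c⁻¹ * (jac Q q * ((χ * Φ) (planeMap Q q)) ^ 2) := by positivity
      linarith
    by_cases hqδ : q.2 ≤ δ
    · exact hsmall (hb q ⟨hq2.1, hqδ⟩).1
    · push Not at hqδ
      rcases hχ1 _ (H.inside q (hδ.trans hqδ) hq2.2) with ⟨z, -, hz0, hzδ, hz⟩ | hone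
      · refine hsmall ?_
        have := (hb z ⟨hz0.le, hzδ.le⟩).1
        rwa [Function.comp, hz] at this
      · rw [Pi.mul_apply, hone.eq_of_nhds, one_mul, Function.comp]
        have : (1 : ℝ) ≤ c⁻¹ * jac Q q := by
          rw [inv_mul_eq_div, le_div_iff₀ hc]; linarith
        nlinarith [sq_nonneg S, mul_le_mul_of_nonneg_right this (sq_nonneg (Φ (planeMap Q q)))]
  have hjc' : ContinuousOn (fun z => c⁻¹ * (jac Q z * ((χ * Φ) (planeMap Q z)) ^ 2))
      {p | p.2 ∈ Icc 0 h} := continuousOn_const.mul hjc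
  rw [rectInt_add le_rfl continuousOn_const hjc', rectInt_const_mul,
    rectInt_const_mul] at hmass
  have hcv := H.rectInt_jac_le hf.integrable_sq (fun w => sq_nonneg _)
  have hfin : rectInt ℓ 0 h (fun q => (Φ ∘ planeMap Q) q ^ 2) ≤ A₀ * S ^ 2 := by
    have e1 : c⁻¹ * rectInt ℓ 0 h (fun z => jac Q z * (χ * Φ) (planeMap Q z) ^ 2) ≤
        c⁻¹ * (R ^ 2 * Real.exp (4 * R) * (B ^ 2 * V * S ^ 2)) := by
      refine mul_le_mul_of_nonneg_left (hcv.trans (hfi.trans ?_)) (by positivity)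
      exact mul_le_mul_of_nonneg_left hgi (by positivity)
    rw [hA₀]
    linarith
  calc √(rectInt ℓ 0 h (fun q => (Φ ∘ planeMap Q) q ^ 2)) ≤ √(A₀ * S ^ 2) := Real.sqrt_le_sqrt hfin
    _ = √A₀ * S := by rw [Real.sqrt_mul hA₀0, Real.sqrt_sq hS]
    _ ≤ (√A₀ + 1) * S := by nlinarith

/-- The total order of vanishing of an eigenfunction on the boundary is at most linear in `lam`. -/
lemma exists_order_bound (H : Collar D ℓ h Q) : ∃ A > 0, ∀ lam > 0, ∀ Φ,
    CollarEigenfunction D Q lam Φ → ∀ (Z : Finset ℝ) (m : ℝ → ℕ), (∀ a ∈ Z, a ∈ Ico 0 ℓ) →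
      (∀ a ∈ Z, ∀ i < m a, iteratedDeriv i (fun x => (Φ ∘ planeMap Q) (x, 0)) a = 0) →
      ((∑ a ∈ Z, m a : ℕ) : ℝ) ≤ A * (1 + lam) := by
  obtain ⟨C, hC, hCb⟩ := H.exists_iterate_dx_jac_le
  obtain ⟨δ, hδ, hδh, ρ, hρ, hρ1, C₁, hC₁, C₂, hC₂, hdich⟩ :=
    exists_strip_dichotomy H.len_pos H.h_pos H.h_le hC
  obtain ⟨a, ha, hmass⟩ := H.exists_mass_bound hδ hδh
  set L : ℝ := Real.log (1 / ρ) with hL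
  have hL0 : 0 < L := Real.log_pos (by rw [lt_div_iff₀ hρ]; linarith)
  refine ⟨(|Real.log (2 * a * C₂ * C₁)| + 4) / L, by positivity, fun lam hlam Φ E Z m hZ hm => ?_⟩
  set M : ℝ := √(rectInt ℓ 0 h (fun q => (Φ ∘ planeMap Q) q ^ 2)) with hM
  have hv : ContinuousOn (Φ ∘ planeMap Q) {p | p.2 ∈ Icc 0 h} := fun z hz =>
    (E.analyticAt_comp H hz).continuousAt.continuousWithinAt
  have hM0 : 0 < M := by
    obtain ⟨z, hz, hne⟩ := E.exists_ne_zero H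
    exact Real.sqrt_pos.mpr (rectInt_pos (hv.pow 2) (fun p => sq_nonneg _) hz (pow_ne_zero 2 hne))
  have hexp := Real.exp_pos (3 * lam)
  set N : ℝ := M / (2 * a * C₂ * Real.exp (3 * lam)) with hN
  have hN0 : 0 < N := by positivity
  rcases hdich lam hlam _ _ (E.stripSolution H hCb) (E.analyticOnNhd_trace H) N hN0 with hs | hs
  · have := hmass lam Φ E _ (by positivity) hs
    have e : a * (C₂ * Real.exp (3 * lam) * N) = M / 2 := by rw [hN]; field_simp
    rw [e] at this
    linarith
  · have h1 := hs Z m hZ hm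
    set n := ∑ a ∈ Z, m a with hn
    have hρn : 0 < ρ ^ n := by positivity
    have h2 : (1 / ρ) ^ n ≤ 2 * a * C₂ * C₁ * Real.exp (4 * lam) := by
      rw [hN, div_le_iff₀ (by positivity)] at h1
      have e4 : Real.exp (4 * lam) = Real.exp lam * Real.exp (3 * lam) := by
        rw [← Real.exp_add]; ring_nf
      rw [one_div, inv_pow, inv_le_iff_one_le_mul₀ hρn, e4]
      have : M * 1 ≤ M * (2 * a * C₂ * C₁ * (Real.exp lam * Real.exp (3 * lam)) * ρ ^ n) := by
        linarith
      exact le_of_mul_le_mul_left this hM0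
    have h3 := Real.log_le_log (by positivity) h2
    rw [Real.log_pow, Real.log_mul (by positivity) (by positivity), Real.log_exp] at h3
    rw [div_mul_eq_mul_div, le_div_iff₀ hL0]
    have := le_abs_self (Real.log (2 * a * C₂ * C₁))
    nlinarith [abs_nonneg (Real.log (2 * a * C₂ * C₁))]

end Collar
end MassBound

section SmallFrequency
open Set Filter Topology

/-- A Poincaré inequality for periodic functions with a zero. -/
lemma integral_sq_le_of_zero {ℓ x₀ : ℝ} {f f' : ℝ → ℝ} (hℓ : 0 < ℓ) (hf : ∀ x, HasDerivAt f (f' x) x)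
    (hf' : Continuous f') (hx₀ : x₀ ∈ Icc 0 ℓ) (h0 : f x₀ = 0) :
    ∫ t in (0 : ℝ)..ℓ, f t ^ 2 ≤ 4 * ℓ ^ 2 * ∫ t in (0 : ℝ)..ℓ, f' t ^ 2 := by
  have hfc : Continuous f := continuous_iff_continuousAt.mpr fun x => (hf x).continuousAt
  set U : ℝ := ∫ t in (0 : ℝ)..ℓ, f t ^ 2 with hU
  set U' : ℝ := ∫ t in (0 : ℝ)..ℓ, f' t ^ 2 with hU'
  have hg : ∫ t in (0 : ℝ)..ℓ, (1 / (2 * ℓ) * f t ^ 2 + 2 * ℓ * f' t ^ 2) =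
      1 / (2 * ℓ) * U + 2 * ℓ * U' := by
    rw [intervalIntegral.integral_add (Continuous.intervalIntegrable (by fun_prop) _ _)
      (Continuous.intervalIntegrable (by fun_prop) _ _), intervalIntegral.integral_const_mul,
      intervalIntegral.integral_const_mul]
  have hpt : ∀ x ∈ Icc 0 ℓ, f x ^ 2 ≤ 1 / (2 * ℓ) * U + 2 * ℓ * U' := by
    intro x hx
    have hd : ∀ t ∈ uIcc x₀ x, HasDerivAt (fun t => f t ^ 2) (2 * f t * f' t) t := fun t _ => by
      simpa using (hf t).fun_pow 2
    have hi_int := intervalIntegral.integral_eq_sub_of_hasDerivAt hd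
      (Continuous.intervalIntegrable (by fun_prop) _ _)
    simp only [h0, ne_eq, OfNat.ofNat_ne_zero, not_false_eq_true, zero_pow, sub_zero] at hi_int
    have hnn : ∀ t, 0 ≤ 1 / (2 * ℓ) * f t ^ 2 + 2 * ℓ * f' t ^ 2 := fun t => by positivity
    have h1 : ‖∫ t in x₀..x, 2 * f t * f' t‖ ≤
        |∫ t in x₀..x, (1 / (2 * ℓ) * f t ^ 2 + 2 * ℓ * f' t ^ 2)| := by
      refine intervalIntegral.norm_integral_le_abs_of_norm_le (ae_of_all _ fun t => ?_)
        (Continuous.intervalIntegrable (by fun_prop) _ _)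
      have e : 1 / (2 * ℓ) * f t ^ 2 + 2 * ℓ * f' t ^ 2 =
        (f t ^ 2 + (2 * ℓ * f' t) ^ 2) / (2 * ℓ) := by field_simp
      rw [e, Real.norm_eq_abs, le_div_iff₀ (by positivity)]
      rw [← abs_of_pos (by positivity : 0 < 2 * ℓ), ← abs_mul, abs_of_pos (by positivity : 0 < 2 * ℓ)]
      refine abs_le.mpr ⟨?_, ?_⟩ <;>
        nlinarith [sq_nonneg (f t - 2 * ℓ * f' t), sq_nonneg (f t + 2 * ℓ * f' t)]
    have h2 : |∫ t in x₀..x, (1 / (2 * ℓ) * f t ^ 2 + 2 * ℓ * f' t ^ 2)| ≤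
        |∫ t in (0 : ℝ)..ℓ, (1 / (2 * ℓ) * f t ^ 2 + 2 * ℓ * f' t ^ 2)| := by
      refine intervalIntegral.abs_integral_mono_interval ?_ (ae_of_all _ hnn)
        (Continuous.intervalIntegrable (by fun_prop) _ _)
      rw [uIoc_of_le hℓ.le]
      exact Ioc_subset_Ioc (le_min hx₀.1 hx.1) (max_le hx₀.2 hx.2)
    rw [hi_int, Real.norm_eq_abs] at h1
    rw [hg, abs_of_nonneg (a := 1 / (2 * ℓ) * U + 2 * ℓ * U') (by
      rw [← hg]; exact intervalIntegral.integral_nonneg hℓ.le fun t _ => hnn t)] at h2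
    exact (le_abs_self _).trans (h1.trans h2)
  have h3 : U ≤ ∫ t in (0 : ℝ)..ℓ, (1 / (2 * ℓ) * U + 2 * ℓ * U') :=
    intervalIntegral.integral_mono_on hℓ.le (Continuous.intervalIntegrable (by fun_prop) _ _)
      (by simp) hpt
  rw [intervalIntegral.integral_const, smul_eq_mul, sub_zero] at h3
  have e : ℓ * (1 / (2 * ℓ) * U + 2 * ℓ * U') = U / 2 + 2 * ℓ ^ 2 * U' := by field_simp
  rw [e] at h3
  linarith

set_option maxHeartbeats 2000000 in
/-- A strip solution of low frequency with a zero on `y = 0` satisfies a Poincaré inequality. -/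
lemma StripSolution.exists_poincare {ℓ h C : ℝ} (hℓ : 0 < ℓ) (hh : 0 < h) (h1 : h ≤ 1) (hC : 0 ≤ C) :
    ∃ A > 0, ∃ L > 0, L ≤ 1 ∧ ∀ lam > 0, lam ≤ L → ∀ p v : ℝ × ℝ → ℝ, StripSolution ℓ h C lam p v →
      ∀ x₀ ∈ Icc 0 ℓ, v (x₀, 0) = 0 →
      rectInt ℓ 0 h (fun q => v q ^ 2) ≤ A * rectInt ℓ 0 h (fun q => dx v q ^ 2 + dy v q ^ 2) := by
  set B : ℝ := 8 * ℓ ^ 2 / h ^ 2 with hB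
  have hB0 : 0 < B := by positivity
  refine ⟨2 * (4 + B * (7 + 2 * (C + C ^ 2))), by positivity, 1 / (1 + 4 * B * C ^ 2), by positivity,
    ?_, fun lam hlam hlamL p v S x₀ hx₀ hv0 => ?_⟩
  · rw [div_le_one (by positivity)]
    nlinarith [mul_nonneg hB0.le (sq_nonneg C)]
  have hvx := S.smooth_v.dx
  have hvc := S.smooth_v.cont
  have hxc := S.smooth_v.dx.cont
  have hyc := S.smooth_v.dy.cont
  set V : ℝ := rectInt ℓ 0 h (fun q => v q ^ 2) with hV
  set G : ℝ := rectInt ℓ 0 h (fun q => dx v q ^ 2 + dy v q ^ 2) with hG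
  set U : ℝ := ∫ x in (0 : ℝ)..ℓ, v (x, 0) ^ 2 with hU
  set U' : ℝ := ∫ x in (0 : ℝ)..ℓ, dx v (x, 0) ^ 2 with hU'
  have hV0 : 0 ≤ V := rectInt_nonneg fun q _ => sq_nonneg _
  have hG0 : 0 ≤ G := rectInt_nonneg fun q _ => by positivity
  have hgc : ContinuousOn (fun q => dx v q ^ 2 + dy v q ^ 2) {p | p.2 ∈ Icc 0 h} :=
    (hxc.pow 2).add (hyc.pow 2)
  have hm0 : ∀ x : ℝ, (x, (0 : ℝ)).2 ∈ Icc 0 h := fun _ => ⟨le_rfl, hh.le⟩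
  have hVU : V ≤ 2 * U + 4 * G := by
    have hws : SmoothStrip h (fun p : ℝ × ℝ => (h - p.2) ^ 1) := smoothStrip_weight h 1
    have hdiv := rectInt_divergence (P := fun _ => 0) (Q := (fun p => (h - p.2) ^ 1) * (v * v)) hℓ.le
      le_rfl hh.le (ContDiff.smoothStrip contDiff_const) (hws.mul (S.smooth_v.mul S.smooth_v))
      (fun _ _ => rfl)
    have e : ∀ q ∈ Icc ((0 : ℝ), (0 : ℝ)) (ℓ, h), dx (fun _ : ℝ × ℝ => (0 : ℝ)) q +
        dy ((fun p => (h - p.2) ^ 1) * (v * v)) q = 2 * (h - q.2) * v q * dy v q - v q ^ 2 := by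
      intro q hq
      have hq2 : q.2 ∈ Icc 0 h := ⟨hq.1.2, hq.2.2⟩
      have hv := S.smooth_v.diff hq2
      rw [dx_const, dy_mul (hws.diff hq2) (hv.mul hv), dy_mul hv hv, (hasFDerivAt_weight h 1 q).2]
      simp only [Pi.mul_apply]
      push_cast
      ring
    rw [rectInt_congr e] at hdiv
    simp only [Pi.mul_apply, sub_self, sub_zero, zero_mul, pow_one, intervalIntegral.integral_zero,
      zero_sub, intervalIntegral.integral_const_mul] at hdiv
    have e2 : (∫ x in (0 : ℝ)..ℓ, v (x, 0) * v (x, 0)) = U := by simp only [hU, pow_two]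
    rw [e2] at hdiv
    have hle : rectInt ℓ 0 h (fun q => 1 / 2 * v q ^ 2) ≤ rectInt ℓ 0 h (fun q =>
        2 * (dx v q ^ 2 + dy v q ^ 2) + (-1) * (2 * (h - q.2) * v q * dy v q - v q ^ 2)) := by
      refine rectInt_mono le_rfl (by fun_prop) (by fun_prop) fun q hq => ?_
      have hq1 : h - q.2 ≤ 1 := by linarith [hq.1.2]
      have hq0 : 0 ≤ h - q.2 := by linarith [hq.2.2]
      have : (h - q.2) ^ 2 ≤ 1 := by nlinarith
      nlinarith [sq_nonneg (v q - 2 * (h - q.2) * dy v q), sq_nonneg (dx v q), sq_nonneg (dy v q)]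
    rw [rectInt_add le_rfl (by fun_prop) (by fun_prop), rectInt_const_mul, rectInt_const_mul,
      rectInt_const_mul, hdiv] at hle
    have : h * U ≤ U := mul_le_of_le_one_left (intervalIntegral.integral_nonneg hℓ.le
      fun t _ => sq_nonneg _) h1
    linarith
  have hUU : U ≤ 4 * ℓ ^ 2 * U' := by
    refine integral_sq_le_of_zero hℓ (fun x => hasDerivAt_dx (S.smooth_v.diff (hm0 x))) ?_ hx₀ hv0
    exact hxc.comp_continuous (by fun_prop) hm0
  have hdy0 : ∀ x, dy (dx v) (x, 0) = 0 := fun x => by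
    rw [← dx_dy_comm (S.smooth_v _ (hm0 x))]
    have hd := hasDerivAt_dx (S.smooth_v.dy.diff (hm0 x))
    have : (fun t => dy v (t, (x, (0 : ℝ)).2)) = fun _ => 0 := funext fun t => S.neumann t
    rw [this] at hd
    exact hd.unique (hasDerivAt_const _ _)
  have hcac := caccioppoli hℓ.le hh.le hvx S.periodic.dx hdy0 0
  have htr := trace_le (y₀ := 0) hℓ.le le_rfl hh.le h1 hvx 0
  have hxx := hvx.dx.cont
  have hxy := hvx.dy.cont
  have hlap : ∀ q : ℝ × ℝ, q.2 ∈ Icc 0 h → dx (dx (dx v)) q + dy (dy (dx v)) q =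
      -lam ^ 2 * (dx p q * v q + p q * dx v q) := by
    intro q hq
    have := S.lap_iterate hh 1 q hq
    simp only [Finset.sum_range_succ, Finset.sum_range_zero, Function.iterate_one,
      Function.iterate_zero, id, Nat.choose_zero_right, Nat.choose_one_right, Nat.cast_one, one_mul,
      zero_add, Nat.sub_zero, Nat.sub_self] at this
    rw [this]; ring
  have hpt : rectInt ℓ 0 h (fun q => (h - q.2) ^ (2 * 0 + 2) *
      (|dx v q| * |dx (dx (dx v)) q + dy (dy (dx v)) q|)) ≤
      rectInt ℓ 0 h (fun q => lam ^ 2 * (C + C ^ 2) * (dx v q ^ 2 + dy v q ^ 2) +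
        lam ^ 2 * C ^ 2 * v q ^ 2) := by
    have := hvx.dx.dx.cont
    have := hvx.dy.dy.cont
    refine rectInt_mono le_rfl (by fun_prop) (by fun_prop) fun q hq => ?_
    have hq2 : q.2 ∈ Icc 0 h := ⟨hq.1.2, hq.2.2⟩
    have hp0 := S.bound 0 q hq2
    have hp1 := S.bound 1 q hq2
    simp only [Function.iterate_zero, id, zero_add, pow_one, Nat.factorial_zero, Nat.cast_one,
      mul_one, Function.iterate_one, Nat.factorial_one] at hp0 hp1
    norm_num at hp1
    have hq1 : h - q.2 ≤ 1 := by linarith [hq.1.2]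
    have hq0 : 0 ≤ h - q.2 := by linarith [hq.2.2]
    rw [hlap q hq2, abs_mul, abs_neg, abs_of_nonneg (sq_nonneg lam)]
    have e1 : |dx p q * v q + p q * dx v q| ≤ C ^ 2 * |v q| + C * |dx v q| := by
      refine (abs_add_le _ _).trans ?_
      rw [abs_mul, abs_mul]
      gcongr
    have hw : (h - q.2) ^ (2 * 0 + 2) ≤ 1 := pow_le_one₀ hq0 hq1
    calc (h - q.2) ^ (2 * 0 + 2) * (|dx v q| * (lam ^ 2 * |dx p q * v q + p q * dx v q|))
        ≤ 1 * (|dx v q| * (lam ^ 2 * (C ^ 2 * |v q| + C * |dx v q|))) := by gcongr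
      _ = lam ^ 2 * (C ^ 2 * (|dx v q| * |v q|) + C * |dx v q| ^ 2) := by ring
      _ ≤ lam ^ 2 * (C ^ 2 * (|dx v q| ^ 2 + |v q| ^ 2) + C * |dx v q| ^ 2) := by
          gcongr
          nlinarith [sq_nonneg (|dx v q| - |v q|), sq_nonneg (|dx v q|), sq_nonneg (|v q|)]
      _ ≤ _ := by
          rw [sq_abs, sq_abs]
          have : 0 ≤ lam ^ 2 * (C + C ^ 2) * dy v q ^ 2 := by positivity
          linarith
  rw [rectInt_add le_rfl (by fun_prop) (by fun_prop), rectInt_const_mul, rectInt_const_mul] at hpt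
  have hxG : rectInt ℓ 0 h (fun q => (h - q.2) ^ (2 * 0) * dx v q ^ 2) ≤ G :=
    rectInt_mono le_rfl (by fun_prop) hgc fun q _ => by
      simpa using sq_nonneg (dy v q)
  have hT : rectInt ℓ 0 h (fun q => (h - q.2) ^ (2 * 0 + 2) * dy (dx v) q ^ 2) ≤
      rectInt ℓ 0 h (fun q => (h - q.2) ^ (2 * 0 + 2) * (dx (dx v) q ^ 2 + dy (dx v) q ^ 2)) :=
    rectInt_mono le_rfl (by fun_prop) (by fun_prop) fun q hq => by
      have : 0 ≤ (h - q.2) ^ (2 * 0 + 2) := by norm_num; positivity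
      nlinarith [sq_nonneg (dx (dx v) q)]
  have hfin : h ^ 2 * U' ≤ (7 + 2 * lam ^ 2 * (C + C ^ 2)) * G + 2 * lam ^ 2 * C ^ 2 * V := by
    norm_num at htr hcac hT hpt hxG ⊢
    rw [← hU'] at htr
    rw [← hG, ← hV] at hpt
    clear_value U' G V
    calc h ^ 2 * U' ≤ 3 * G + (2 * (lam ^ 2 * (C + C ^ 2) * G + lam ^ 2 * C ^ 2 * V) + 4 * G) := by
          linarith
      _ = _ := by ring
  have hUB : 8 * ℓ ^ 2 * U' = B * (h ^ 2 * U') := by rw [hB]; field_simp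
  have hl2 : lam ^ 2 ≤ lam := by
    have : lam ≤ 1 := hlamL.trans (by
      rw [div_le_one (by positivity)]
      nlinarith [mul_nonneg hB0.le (sq_nonneg C)])
    nlinarith
  have hl1 : lam ^ 2 ≤ 1 := hl2.trans (hlamL.trans (by
    rw [div_le_one (by positivity)]
    nlinarith [mul_nonneg hB0.le (sq_nonneg C)]))
  have hsm : 4 * B * C ^ 2 * lam ^ 2 ≤ 1 := by
    rw [le_div_iff₀ (by positivity)] at hlamL
    nlinarith [mul_nonneg hB0.le (sq_nonneg C)]
  have hBX := mul_le_mul_of_nonneg_left hfin hB0.le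
  have hk1 : lam ^ 2 * ((C + C ^ 2) * B * G) ≤ 1 * ((C + C ^ 2) * B * G) := by gcongr
  have hk2 : 4 * B * C ^ 2 * lam ^ 2 * V ≤ 1 * V := by gcongr
  have h2 : V ≤ 2 * U + 4 * G := hVU
  have h3 : V ≤ B * (h ^ 2 * U') + 4 * G := by linarith
  linarith [h3.trans (add_le_add_left hBX _)]

end SmallFrequency

section Energy
open Set Filter Topology

variable {D : Set (ℝ × ℝ)} {ℓ h δ lam : ℝ} {Q : ℂ → ℂ} {Φ χ : ℝ × ℝ → ℝ}

/-- A cutoff which equals one on the domain away from the collar of width `δ`. -/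
structure IsCollarCutoff (D : Set (ℝ × ℝ)) (ℓ δ : ℝ) (Q : ℂ → ℂ) (χ : ℝ × ℝ → ℝ) : Prop where
  test : IsTestFun χ
  supp : tsupport χ ⊆ D
  mem_Icc : ∀ w, χ w ∈ Icc 0 1
  eq_one : ∀ w ∈ D, (∃ z : ℝ × ℝ, z.1 ∈ Ico 0 ℓ ∧ 0 < z.2 ∧ z.2 < δ ∧ planeMap Q z = w) ∨
    χ =ᶠ[𝓝 w] fun _ => 1

namespace IsCollarCutoff

variable (X : IsCollarCutoff D ℓ δ Q χ) (E : CollarEigenfunction D Q lam Φ) (H : Collar D ℓ h Q)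
include X

lemma mul_test {Ψ : ℝ × ℝ → ℝ} (hΨ : ∀ w ∈ D, AnalyticAt ℝ Ψ w) : IsTestFun (χ * Ψ) :=
  X.test.mul_of_tsupport X.supp hΨ

lemma dx_supp : tsupport (dx χ) ⊆ D := by
  refine Subset.trans ?_ X.supp
  refine closure_minimal (fun w hw => ?_) isClosed_closure
  exact tsupport_fderiv_subset ℝ (subset_closure fun h0 => hw (by simp [dx, h0]))

lemma dy_supp : tsupport (dy χ) ⊆ D := by
  refine Subset.trans ?_ X.supp
  refine closure_minimal (fun w hw => ?_) isClosed_closure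
  exact tsupport_fderiv_subset ℝ (subset_closure fun h0 => hw (by simp [dy, h0]))

/-- Integrals of functions supported where the cutoff varies can be computed in the collar. -/
lemma rectInt_eq (H : Collar D ℓ h Q) (hδh : δ ≤ h) {F : ℝ × ℝ → ℝ} (h0 : ∀ w ∉ D, F w = 0)
    (h1 : ∀ w, dx χ w = 0 → dy χ w = 0 → F w = 0) :
    rectInt ℓ 0 h (fun z => jac Q z * F (planeMap Q z)) = ∫ w, F w := by
  refine H.rectInt_jac_eq fun w hw => ?_
  have hwD : w ∈ D := by
    by_contra hn
    exact hw (h0 w hn)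
  rcases X.eq_one w hwD with ⟨z, a, b, c, d⟩ | h2
  · exact ⟨z, a, ⟨b, c.le.trans hδh⟩, d⟩
  · obtain ⟨-, ox, oy, -⟩ := partial_eq_zero_of_eq_one h2
    exact absurd (h1 w ox oy) hw

lemma apply_top (H : Collar D ℓ h Q) (hδh : δ < h) (x : ℝ) : χ (planeMap Q (x, h)) = 1 := by
  have hh := H.h_pos
  rcases X.eq_one _ (H.inside (x, h) hh le_rfl) with ⟨z, a, b, c, d⟩ | h2
  · obtain ⟨z', a', b', d'⟩ := H.exists_mem_Ico (x, h)
    have := H.inj (show z ∈ Ico 0 ℓ ×ˢ Icc 0 h from ⟨a, b.le, (c.trans hδh).le⟩)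
      (show z' ∈ Ico 0 ℓ ×ˢ Icc 0 h from ⟨a', by rw [b']; exact ⟨hh.le, le_rfl⟩⟩) (d.trans d'.symm)
    rw [this, b'] at c
    exact absurd c (by simpa using hδh.le)
  · exact h2.eq_of_nhds

lemma smoothStrip_comp (H : Collar D ℓ h Q) : SmoothStrip h (χ ∘ planeMap Q) := fun z hz =>
  (X.test.1.contDiffAt).comp z
    (analyticAt_planeMap (H.analytic' (H.abs_snd_le hz))).contDiffAt

include E

omit X in
lemma analytic_grad_sq : ∀ w ∈ D, AnalyticAt ℝ (dx Φ * dx Φ + dy Φ * dy Φ) w := fun w hw => by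
  have := E.analytic w (subset_closure hw)
  exact (this.partial_x.mul this.partial_x).add (this.partial_y.mul this.partial_y)

lemma interior_identity :
    (∫ w, (dx χ w * (Φ w * dx Φ w) + dy χ w * (Φ w * dy Φ w))) +
      ∫ w, (χ * (dx Φ * dx Φ + dy Φ * dy Φ)) w = lam ^ 2 * ∫ w, (χ * (Φ * Φ)) w := by
  have hA : ∀ w ∈ D, AnalyticAt ℝ Φ w := fun w hw => E.analytic w (subset_closure hw)
  have hx : IsTestFun (χ * (Φ * dx Φ)) := X.mul_test fun w hw => (hA w hw).mul (hA w hw).partial_x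
  have hy : IsTestFun (χ * (Φ * dy Φ)) := X.mul_test fun w hw => (hA w hw).mul (hA w hw).partial_y
  have hx' : IsTestFun (dx χ * (Φ * dx Φ)) := X.test.dx.mul_of_tsupport X.dx_supp
    fun w hw => (hA w hw).mul (hA w hw).partial_x
  have hy' : IsTestFun (dy χ * (Φ * dy Φ)) := X.test.dy.mul_of_tsupport X.dy_supp
    fun w hw => (hA w hw).mul (hA w hw).partial_y
  have hg : IsTestFun (χ * (dx Φ * dx Φ + dy Φ * dy Φ)) := X.mul_test (analytic_grad_sq E)
  have hm : IsTestFun (χ * (Φ * Φ)) := X.mul_test fun w hw => (hA w hw).mul (hA w hw)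
  have h1 : ∫ w, (dx (χ * (Φ * dx Φ)) w + dy (χ * (Φ * dy Φ)) w) = 0 := by
    rw [integral_add hx.dx.integrable hy.dy.integrable, hx.integral_dx_eq_zero,
      hy.integral_dy_eq_zero, add_zero]
  have h2 : ∀ w, dx (χ * (Φ * dx Φ)) w + dy (χ * (Φ * dy Φ)) w =
      ((dx χ * (Φ * dx Φ)) w + (dy χ * (Φ * dy Φ)) w) +
        ((χ * (dx Φ * dx Φ + dy Φ * dy Φ)) w + (-lam ^ 2) * (χ * (Φ * Φ)) w) := by
    intro w
    by_cases hw : w ∈ D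
    · have a := (hA w hw).differentiableAt
      have ax := (hA w hw).partial_x.differentiableAt
      have ay := (hA w hw).partial_y.differentiableAt
      rw [dx_mul (X.test.diff w) (a.mul ax), dy_mul (X.test.diff w) (a.mul ay), dx_mul a ax,
        dy_mul a ay]
      have := E.eigen w hw
      simp only [Pi.mul_apply, Pi.add_apply]
      linear_combination (χ w * Φ w) * this
    · obtain ⟨-, a, -⟩ := IsTestFun.apply_eq_zero (χ := χ * (Φ * dx Φ))
        ((tsupport_mul_subset_left (f := χ) (g := Φ * dx Φ)).trans X.supp) hw
      obtain ⟨-, -, b, -⟩ := IsTestFun.apply_eq_zero (χ := χ * (Φ * dy Φ))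
        ((tsupport_mul_subset_left (f := χ) (g := Φ * dy Φ)).trans X.supp) hw
      obtain ⟨c, d, e, -⟩ := IsTestFun.apply_eq_zero X.supp hw
      rw [a, b]
      simp [c, d, e]
  simp only [h2] at h1
  have i1 : Integrable (fun w => (dx χ * (Φ * dx Φ)) w + (dy χ * (Φ * dy Φ)) w) :=
    (hx'.add hy').integrable
  have i2 : Integrable (fun w => (χ * (dx Φ * dx Φ + dy Φ * dy Φ)) w +
    (-lam ^ 2) * (χ * (Φ * Φ)) w) := (hg.add (hm.const_mul (-lam ^ 2))).integrable
  rw [integral_add i1 i2, integral_add hg.integrable (hm.const_mul (-lam ^ 2)).integrable, integral_const_mul] at h1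
  simp only [Pi.mul_apply] at h1 ⊢
  linarith

include H

lemma collar_identity (hδh : δ < h) :
    -(∫ w, (dx χ w * (Φ w * dx Φ w) + dy χ w * (Φ w * dy Φ w))) +
      rectInt ℓ 0 h (fun z => (1 - (χ ∘ planeMap Q) z) *
        (dx (Φ ∘ planeMap Q) z ^ 2 + dy (Φ ∘ planeMap Q) z ^ 2)) =
    lam ^ 2 * rectInt ℓ 0 h (fun z => (1 - (χ ∘ planeMap Q) z) *
      (jac Q z * (Φ ∘ planeMap Q) z ^ 2)) := by
  have hA : ∀ w ∈ closure D, AnalyticAt ℝ Φ w := E.analytic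
  have hh := H.h_pos
  set v := Φ ∘ planeMap Q with hv
  set u := χ ∘ planeMap Q with hu
  have sv : SmoothStrip h v := fun z hz => (E.analyticAt_comp H hz).contDiffAt
  have su : SmoothStrip h u := X.smoothStrip_comp H
  set η : ℝ × ℝ → ℝ := (fun _ => 1) + (fun _ => (-1 : ℝ)) * u with hη
  have sη : SmoothStrip h η := (ContDiff.smoothStrip contDiff_const).add
    ((ContDiff.smoothStrip contDiff_const).mul su)
  have pv : PeriodicX ℓ v := fun x y => congrArg Φ (H.periodic_planeMap x y)
  have pη : PeriodicX ℓ η := fun x y => by simp [hη, hu, H.periodic_planeMap x y]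
  have hdiv := rectInt_divergence (P := η * (v * dx v)) (Q := η * (v * dy v)) H.len_pos.le le_rfl hh.le
    (sη.mul (sv.mul sv.dx)) (sη.mul (sv.mul sv.dy)) (pη.mul (pv.mul pv.dx))
  have htop : ∀ x, (η * (v * dy v)) (x, h) = 0 := fun x => by
    simp [hη, hu, X.apply_top H hδh x]
  have hbot : ∀ x, (η * (v * dy v)) (x, 0) = 0 := fun x => by
    have : dy v (x, 0) = 0 := E.neumann x
    simp [this]
  simp only [htop, hbot, intervalIntegral.integral_zero, sub_zero] at hdiv
  have e : ∀ z ∈ Icc ((0 : ℝ), (0 : ℝ)) (ℓ, h), dx (η * (v * dx v)) z + dy (η * (v * dy v)) z =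
      ((-1) * (jac Q z * (fun w => dx χ w * (Φ w * dx Φ w) + dy χ w * (Φ w * dy Φ w))
        (planeMap Q z)) + (1 - u z) * (dx v z ^ 2 + dy v z ^ 2)) +
        (-lam ^ 2) * ((1 - u z) * (jac Q z * v z ^ 2)) := by
    intro z hz
    have hz2 : z.2 ∈ Icc 0 h := ⟨hz.1.2, hz.2.2⟩
    have hQz := (H.analytic' (H.abs_snd_le hz2)).differentiableAt
    have a := sv.diff hz2
    have hg := grad_comp_planeMap hQz (X.test.diff (planeMap Q z))
      (hA _ (H.mem_closure hz2)).differentiableAt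
    have hlap := (E.strip_eq H hz2).eq_of_nhds
    rw [dx_mul (sη.diff hz2) (a.mul (sv.dx.diff hz2)), dy_mul (sη.diff hz2) (a.mul (sv.dy.diff hz2)),
      dx_mul a (sv.dx.diff hz2), dy_mul a (sv.dy.diff hz2)]
    have c1 : DifferentiableAt ℝ (fun _ : ℝ × ℝ => (1 : ℝ)) z := by fun_prop
    have c2 : DifferentiableAt ℝ (fun _ : ℝ × ℝ => (-1 : ℝ)) z := by fun_prop
    have b := su.diff hz2
    have ex : dx η z = - dx u z := by
      rw [hη, dx_add c1 (c2.mul b), dx_mul c2 b, dx_const, dx_const]; ring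
    have ey : dy η z = - dy u z := by
      rw [hη, dy_add c1 (c2.mul b), dy_mul c2 b, dy_const, dy_const]; ring
    have e0 : η z = 1 - u z := by simp [hη]; ring
    have ev : v z = Φ (planeMap Q z) := rfl
    rw [ex, ey, e0]
    simp only [Pi.mul_apply, Pi.add_apply] at hlap ⊢
    rw [← hv] at hlap hg
    rw [← hu] at hg
    simp only [← ev]
    linear_combination (-v z) * hg + (1 - u z) * v z * hlap
  rw [rectInt_congr e] at hdiv
  have hF : ∀ Ψ : ℝ × ℝ → ℝ, ContinuousOn Ψ (closure D) →
      ContinuousOn (fun z => Ψ (planeMap Q z)) {p | p.2 ∈ Icc 0 h} := fun Ψ hΨ =>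
    hΨ.comp H.continuousOn_planeMap fun z hz => H.mem_closure hz
  have k1 : ContinuousOn (fun z => (-1) * (jac Q z * (fun w => dx χ w * (Φ w * dx Φ w) +
      dy χ w * (Φ w * dy Φ w)) (planeMap Q z))) {p | p.2 ∈ Icc 0 h} := by
    refine continuousOn_const.mul (H.smoothStrip_jac.cont.mul (hF (fun w => dx χ w * (Φ w * dx Φ w) +
      dy χ w * (Φ w * dy Φ w)) fun w hw => ?_))
    have a := (hA w hw).continuousAt
    have ax := (hA w hw).partial_x.continuousAt
    have ay := (hA w hw).partial_y.continuousAt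
    exact ((X.test.dx.cont.continuousAt.mul (a.mul ax)).add
      (X.test.dy.cont.continuousAt.mul (a.mul ay))).continuousWithinAt
  have kv := sv.cont
  have kx := sv.dx.cont
  have ky := sv.dy.cont
  have ku := su.cont
  have kj := H.smoothStrip_jac.cont
  have k2 : ContinuousOn (fun z => (1 - u z) * (dx v z ^ 2 + dy v z ^ 2)) {p | p.2 ∈ Icc 0 h} := by
    fun_prop
  have k3 : ContinuousOn (fun z => (-lam ^ 2) * ((1 - u z) * (jac Q z * v z ^ 2)))
    {p | p.2 ∈ Icc 0 h} := by fun_prop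
  have k4 : ContinuousOn (fun z => (-1) * (jac Q z * (fun w => dx χ w * (Φ w * dx Φ w) +
      dy χ w * (Φ w * dy Φ w)) (planeMap Q z)) + (1 - u z) * (dx v z ^ 2 + dy v z ^ 2))
      {p | p.2 ∈ Icc 0 h} := k1.add k2
  rw [rectInt_add le_rfl k4 k3, rectInt_add le_rfl k1 k2, rectInt_const_mul,
    rectInt_const_mul, X.rectInt_eq H hδh.le (F := fun w => dx χ w * (Φ w * dx Φ w) +
      dy χ w * (Φ w * dy Φ w))] at hdiv
  · linarith
  · intro w hw
    obtain ⟨-, d, e, -⟩ := IsTestFun.apply_eq_zero X.supp hw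
    simp [d, e]
  · intro w d e
    simp [d, e]

/-- The mass of an eigenfunction is controlled by its energy and its mass in the collar. -/
lemma integral_sq_le (hδh : δ ≤ h) {R K K₁ : ℝ} (hR : ∀ w ∈ D, |w.1| ≤ R)
    (hK : ∀ z : ℝ × ℝ, |z.2| ≤ h → jac Q z ≤ K) (hK₁ : ∀ w, |dx χ w| ≤ K₁) :
    ∫ w, (χ * (Φ * Φ)) w ≤
      2 * (R * K₁ * K) * rectInt ℓ 0 h (fun z => (Φ ∘ planeMap Q) z ^ 2) +
        4 * R ^ 2 * ∫ w, (χ * (dx Φ * dx Φ + dy Φ * dy Φ)) w := by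
  have hA : ∀ w ∈ D, AnalyticAt ℝ Φ w := fun w hw => E.analytic w (subset_closure hw)
  have hf : ∀ w : ℝ × ℝ, AnalyticAt ℝ (fun w : ℝ × ℝ => w.1) w := fun w => analyticAt_fst
  have hn : IsTestFun (χ * ((fun w : ℝ × ℝ => w.1) * (Φ * Φ))) :=
    X.mul_test fun w hw => (hf w).mul ((hA w hw).mul (hA w hw))
  have hb : IsTestFun (dx χ * ((fun w : ℝ × ℝ => w.1) * (Φ * Φ))) := X.test.dx.mul_of_tsupport X.dx_supp
    fun w hw => (hf w).mul ((hA w hw).mul (hA w hw))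
  have hg : IsTestFun (χ * (dx Φ * dx Φ + dy Φ * dy Φ)) := X.mul_test (analytic_grad_sq E)
  have hm : IsTestFun (χ * (Φ * Φ)) := X.mul_test fun w hw => (hA w hw).mul (hA w hw)
  have hle : ∫ w, ((χ * (Φ * Φ)) w + (dx χ * ((fun w : ℝ × ℝ => w.1) * (Φ * Φ))) w) ≤
      ∫ w, (dx (χ * ((fun w : ℝ × ℝ => w.1) * (Φ * Φ))) w +
        (1 / 2 * (χ * (Φ * Φ)) w + 2 * R ^ 2 * (χ * (dx Φ * dx Φ + dy Φ * dy Φ)) w)) := by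
    refine integral_mono (hm.add hb).integrable (hn.dx.add
      ((hm.const_mul (1 / 2)).add (hg.const_mul (2 * R ^ 2)))).integrable fun w => ?_
    by_cases hw : w ∈ D
    · have a := (hA w hw).differentiableAt
      have b := (hf w).differentiableAt
      simp only
      rw [dx_mul (X.test.diff w) (b.mul (a.mul a)), dx_mul b (a.mul a), dx_mul a a, dx_fst]
      simp only [Pi.mul_apply, Pi.add_apply]
      have hr := sq_le_sq' (abs_le.mp (hR w hw)).1 (abs_le.mp (hR w hw)).2
      have h1 : 0 ≤ 2 * w.1 * Φ w * dx Φ w + (1 / 2 * (Φ w * Φ w) +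
          2 * R ^ 2 * (dx Φ w * dx Φ w + dy Φ w * dy Φ w)) := by
        nlinarith [sq_nonneg (Φ w + 2 * w.1 * dx Φ w), mul_nonneg (sq_nonneg R) (sq_nonneg (dy Φ w)),
          mul_le_mul_of_nonneg_right hr (sq_nonneg (dx Φ w))]
      have := mul_nonneg (X.mem_Icc w).1 h1
      linarith
    · obtain ⟨-, a, -⟩ := IsTestFun.apply_eq_zero (χ := χ * ((fun w : ℝ × ℝ => w.1) * (Φ * Φ)))
        ((tsupport_mul_subset_left (f := χ) (g := (fun w : ℝ × ℝ => w.1) * (Φ * Φ))).trans X.supp) hw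
      obtain ⟨c, d, -⟩ := IsTestFun.apply_eq_zero X.supp hw
      simp only
      rw [a]
      simp [c, d]
  have i1 : Integrable (fun w => 1 / 2 * (χ * (Φ * Φ)) w +
      2 * R ^ 2 * (χ * (dx Φ * dx Φ + dy Φ * dy Φ)) w) :=
    ((hm.const_mul (1 / 2)).add (hg.const_mul (2 * R ^ 2))).integrable
  rw [integral_add hm.integrable hb.integrable, integral_add hn.dx.integrable i1,
    integral_add (hm.const_mul (1 / 2)).integrable (hg.const_mul (2 * R ^ 2)).integrable,
    integral_const_mul, integral_const_mul, hn.integral_dx_eq_zero, ← X.rectInt_eq H hδh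
    (F := dx χ * ((fun w : ℝ × ℝ => w.1) * (Φ * Φ)))] at hle
  · have hv : ContinuousOn (Φ ∘ planeMap Q) {p | p.2 ∈ Icc 0 h} := fun z hz =>
      (E.analyticAt_comp H hz).continuousAt.continuousWithinAt
    have hj := H.smoothStrip_jac.cont
    have hc : rectInt ℓ 0 h (fun z => -(R * K₁ * K) * (Φ ∘ planeMap Q) z ^ 2) ≤
        rectInt ℓ 0 h (fun z => jac Q z * (dx χ * ((fun w : ℝ × ℝ => w.1) * (Φ * Φ))) (planeMap Q z)) := by
      refine rectInt_mono le_rfl (continuousOn_const.mul (hv.pow 2))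
        (hj.mul (hb.cont.comp_continuousOn H.continuousOn_planeMap)) fun z hz => ?_
      have hz2 : z.2 ∈ Icc 0 h := ⟨hz.1.2, hz.2.2⟩
      have hjz := hK z (by rw [abs_of_nonneg hz2.1]; exact hz2.2)
      have hj0 := jac_nonneg Q z
      by_cases hzD : planeMap Q z ∈ D
      · have e : |jac Q z * (dx χ (planeMap Q z) * (planeMap Q z).1)| ≤ K * (K₁ * R) := by
          rw [abs_mul, abs_mul, abs_of_nonneg hj0]
          have := hK₁ (planeMap Q z)
          have := hR _ hzD
          have : 0 ≤ K := hj0.trans hjz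
          have : 0 ≤ K₁ := (abs_nonneg _).trans (hK₁ 0)
          gcongr
        simp only [Pi.mul_apply, Function.comp]
        nlinarith [mul_le_mul_of_nonneg_right (abs_le.mp e).1 (sq_nonneg (Φ (planeMap Q z)))]
      · obtain ⟨-, d, -⟩ := IsTestFun.apply_eq_zero X.supp hzD
        simp only [Pi.mul_apply, d, zero_mul, mul_zero]
        have hR0 : 0 ≤ R := by
          obtain ⟨w, hw, -⟩ := E.nontrivial
          exact (abs_nonneg _).trans (hR w hw)
        have : 0 ≤ K := hj0.trans hjz
        have : 0 ≤ K₁ := (abs_nonneg _).trans (hK₁ 0)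
        have : 0 ≤ R * K₁ * K * (Φ ∘ planeMap Q) z ^ 2 := by positivity
        linarith
    rw [rectInt_const_mul] at hc
    linarith
  · intro w hw
    obtain ⟨-, d, -⟩ := IsTestFun.apply_eq_zero X.supp hw
    simp [d]
  · intro w d _
    simp [d]

end IsCollarCutoff

/-- Eigenfunctions of low frequency do not vanish on the boundary. -/
lemma Collar.exists_low_frequency (H : Collar D ℓ h Q) : ∃ L > 0, ∀ lam > 0, lam ≤ L → ∀ Φ,
    CollarEigenfunction D Q lam Φ → ∀ x ∈ Icc 0 ℓ, (Φ ∘ planeMap Q) (x, 0) ≠ 0 := by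
  have hh := H.h_pos
  obtain ⟨C, hC, hCb⟩ := H.exists_iterate_dx_jac_le
  obtain ⟨A, hA, L, hL, hL1, hP⟩ := StripSolution.exists_poincare H.len_pos H.h_pos H.h_le hC
  obtain ⟨χ, hχ, hχD, hχ01, hχ1⟩ := H.exists_cutoff (half_pos hh) (half_le_self hh.le)
  have X : IsCollarCutoff D ℓ (h / 2) Q χ := ⟨hχ, hχD, hχ01, hχ1⟩
  obtain ⟨c, hc, K, hK, hj⟩ := H.exists_jac_bounds
  obtain ⟨R, hR, hRD⟩ := H.exists_abs_fst_le
  obtain ⟨K₁, hK₁, h1⟩ := hχ.dx.exists_abs_le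
  set B : ℝ := (2 * (R * K₁ * K) + K) * A + 4 * R ^ 2 with hB
  have hB0 : 0 < B := by positivity
  refine ⟨min L (1 / (2 * B)), by positivity, fun lam hlam hlamL Φ E x hx h0 => ?_⟩
  have hpo := hP lam hlam (hlamL.trans (min_le_left _ _)) _ _ (E.stripSolution H hCb) x hx h0
  have hi_int := X.interior_identity E
  have hcol := X.collar_identity E H (half_lt_self hh)
  have hmass := X.integral_sq_le E H (half_le_self hh.le) hRD (fun z hz => (hj z hz).2) h1
  have hgt : IsTestFun (χ * (dx Φ * dx Φ + dy Φ * dy Φ)) :=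
    X.mul_test (IsCollarCutoff.analytic_grad_sq E)
  have hmt : IsTestFun (χ * (Φ * Φ)) := X.mul_test fun w hw =>
    (E.analytic w (subset_closure hw)).mul (E.analytic w (subset_closure hw))
  have g1 := H.rectInt_jac_le hgt.integrable fun w => by
    have := (hχ01 w).1
    simp only [Pi.mul_apply, Pi.add_apply]
    nlinarith [mul_nonneg this (add_nonneg (sq_nonneg (dx Φ w)) (sq_nonneg (dy Φ w)))]
  have g2 := H.rectInt_jac_le hmt.integrable fun w => by
    have := (hχ01 w).1
    simp only [Pi.mul_apply]
    nlinarith [mul_nonneg this (sq_nonneg (Φ w))]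
  have hx1 := H.continuousOn_planeMap
  have kg := hgt.cont.comp_continuousOn hx1
  have km := hmt.cont.comp_continuousOn hx1
  set v := Φ ∘ planeMap Q with hv
  set u := χ ∘ planeMap Q with hu
  have sv : SmoothStrip h v := fun z hz => (E.analyticAt_comp H hz).contDiffAt
  have kv := sv.cont
  have kx := sv.dx.cont
  have ky := sv.dy.cont
  have ku : ContinuousOn u {p | p.2 ∈ Icc 0 h} := (X.smoothStrip_comp H).cont
  have kj := H.smoothStrip_jac.cont
  have e1 : rectInt ℓ 0 h (fun z => dx v z ^ 2 + dy v z ^ 2) =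
      rectInt ℓ 0 h (fun z => (1 - u z) *
        (dx v z ^ 2 + dy v z ^ 2)) +
      rectInt ℓ 0 h (fun z => jac Q z *
        (χ * (dx Φ * dx Φ + dy Φ * dy Φ)) (planeMap Q z)) := by
    have k1 : ContinuousOn (fun z => (1 - u z) * (dx v z ^ 2 + dy v z ^ 2)) {p | p.2 ∈ Icc 0 h} := by
      fun_prop
    have k2 : ContinuousOn (fun z => jac Q z * (χ * (dx Φ * dx Φ + dy Φ * dy Φ)) (planeMap Q z))
      {p | p.2 ∈ Icc 0 h} := kj.mul kg
    rw [← rectInt_add le_rfl k1 k2]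
    refine rectInt_congr fun z hz => ?_
    have hz2 : z.2 ∈ Icc 0 h := ⟨hz.1.2, hz.2.2⟩
    have dΦ := (E.analytic _ (H.mem_closure hz2)).differentiableAt
    have := grad_comp_planeMap (H.analytic' (H.abs_snd_le hz2)).differentiableAt dΦ dΦ
    simp only [Pi.mul_apply, Pi.add_apply]
    have hu' : u z = χ (planeMap Q z) := rfl
    rw [hu']
    linear_combination (χ (planeMap Q z)) * this
  have e2 : rectInt ℓ 0 h (fun z => jac Q z * v z ^ 2) =
      rectInt ℓ 0 h (fun z => (1 - u z) * (jac Q z * v z ^ 2)) +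
      rectInt ℓ 0 h (fun z => jac Q z * (χ * (Φ * Φ)) (planeMap Q z)) := by
    have k1 : ContinuousOn (fun z => (1 - u z) * (jac Q z * v z ^ 2)) {p | p.2 ∈ Icc 0 h} := by
      fun_prop
    have k2 : ContinuousOn (fun z => jac Q z * (χ * (Φ * Φ)) (planeMap Q z))
      {p | p.2 ∈ Icc 0 h} := kj.mul km
    rw [← rectInt_add le_rfl k1 k2]
    refine rectInt_congr fun z hz => ?_
    have hu' : u z = χ (planeMap Q z) := rfl
    have hv' : v z = Φ (planeMap Q z) := rfl
    simp only [Pi.mul_apply, hu', hv']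
    ring
  have e3 : rectInt ℓ 0 h (fun z => (1 - u z) * (jac Q z * v z ^ 2)) ≤
      rectInt ℓ 0 h (fun z => K * v z ^ 2) := by
    refine rectInt_mono le_rfl (by fun_prop) (by fun_prop) fun z hz => ?_
    have hz2 : z.2 ∈ Icc 0 h := ⟨hz.1.2, hz.2.2⟩
    have hjz := (hj z (by rw [abs_of_nonneg hz2.1]; exact hz2.2)).2
    have hc1 := (hχ01 (planeMap Q z)).1
    have hp : 0 ≤ jac Q z * v z ^ 2 := mul_nonneg (jac_nonneg _ _) (sq_nonneg _)
    have hu' : u z = χ (planeMap Q z) := rfl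
    rw [hu']
    nlinarith [mul_nonneg hc1 hp, mul_le_mul_of_nonneg_right hjz (sq_nonneg (v z))]
  rw [rectInt_const_mul] at e3
  have e4 : 0 < rectInt ℓ 0 h (fun z => jac Q z * v z ^ 2) := by
    obtain ⟨z, hz, hne⟩ := E.exists_ne_zero H
    refine rectInt_pos (by fun_prop) (fun p => mul_nonneg (jac_nonneg _ _) (sq_nonneg _)) hz ?_
    have := (hj z (by rw [abs_of_pos hz.2.1]; exact hz.2.2.le)).1
    exact mul_ne_zero (by linarith) (pow_ne_zero 2 hne)
  have e5 : 0 ≤ rectInt ℓ 0 h (fun z => (1 - u z) *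
      (dx v z ^ 2 + dy v z ^ 2)) := rectInt_nonneg fun z _ =>
    mul_nonneg (sub_nonneg.mpr (hχ01 _).2) (by positivity)
  have hl : lam ^ 2 * B ≤ 1 / 2 := by
    have h2 : lam ≤ 1 := hlamL.trans ((min_le_left _ _).trans hL1)
    have h3 := hlamL.trans (min_le_right _ _)
    rw [le_div_iff₀ (by positivity)] at h3
    nlinarith [mul_pos hlam hB0]
  generalize rectInt ℓ 0 h (fun z => (1 - u z) *
      (dx v z ^ 2 + dy v z ^ 2)) = E₂ at *
  generalize rectInt ℓ 0 h (fun z => (1 - u z) *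
    (jac Q z * v z ^ 2)) = M₂ at *
  generalize rectInt ℓ 0 h (fun z => v z ^ 2) = V at *
  generalize rectInt ℓ 0 h (fun z => dx v z ^ 2 + dy v z ^ 2) = G at *
  generalize (∫ w, (χ * (dx Φ * dx Φ + dy Φ * dy Φ)) w) = E₁ at *
  generalize (∫ w, (χ * (Φ * Φ)) w) = M₁ at *
  have hE : E₁ + E₂ = lam ^ 2 * (M₁ + M₂) := by linarith
  have hF : 0 < M₁ + M₂ := by linarith
  have hV : (2 * (R * K₁ * K) + K) * V ≤ (2 * (R * K₁ * K) + K) * (A * (E₁ + E₂)) := by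
    refine mul_le_mul_of_nonneg_left (hpo.trans ?_) (by positivity)
    exact mul_le_mul_of_nonneg_left (by linarith) hA.le
  have h4 : 4 * R ^ 2 * E₁ ≤ 4 * R ^ 2 * (E₁ + E₂) :=
    mul_le_mul_of_nonneg_left (by linarith) (by positivity)
  have h5 : M₁ + M₂ ≤ B * (E₁ + E₂) := by
    rw [hB]; linarith
  rw [hE] at h5
  nlinarith [mul_le_mul_of_nonneg_right hl hF.le]

end Energy

section Components
open Set Filter Topology

variable {D : Set (ℝ × ℝ)} {ℓ h : ℝ} {Q : ℂ → ℂ}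

/-- The total order of vanishing on the boundary is bounded by a multiple of the frequency. -/
lemma Collar.exists_linear_order_bound (H : Collar D ℓ h Q) : ∃ A > 0, ∀ lam > 0, ∀ Φ,
    CollarEigenfunction D Q lam Φ → ∀ (Z : Finset ℝ) (m : ℝ → ℕ), (∀ a ∈ Z, a ∈ Ico 0 ℓ) →
      (∀ a ∈ Z, ∀ i < m a, iteratedDeriv i (fun x => (Φ ∘ planeMap Q) (x, 0)) a = 0) →
      ((∑ a ∈ Z, m a : ℕ) : ℝ) ≤ A * lam := by
  obtain ⟨A, hA, hAb⟩ := H.exists_order_bound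
  obtain ⟨L, hL, hLb⟩ := H.exists_low_frequency
  refine ⟨A * (1 / L + 1), by positivity, fun lam hlam Φ E Z m hZ hm => ?_⟩
  rcases le_or_gt lam L with hle | hlt
  · have h0 : ∑ a ∈ Z, m a = 0 := Finset.sum_eq_zero fun a ha => by
      by_contra hne
      have := hm a ha 0 (Nat.pos_of_ne_zero hne)
      rw [iteratedDeriv_zero] at this
      exact hLb lam hlam hle Φ E a ⟨(hZ a ha).1, (hZ a ha).2.le⟩ this
    rw [h0, Nat.cast_zero]
    positivity
  · refine (hAb lam hlam Φ E Z m hZ hm).trans ?_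
    have : 1 ≤ lam / L := by rw [le_div_iff₀ hL]; linarith
    have e : A * (1 / L + 1) * lam = A * (lam / L + lam) := by ring
    rw [e]
    gcongr

/-- The components of the zero set of `Φ` in `D` whose closure meets the frontier of `D`. -/
def touchingComponents (D : Set (ℝ × ℝ)) (Φ : ℝ × ℝ → ℝ) : Set (Set (ℝ × ℝ)) :=
  {K | ∃ x ∈ {w | w ∈ D ∧ Φ w = 0}, K = connectedComponentIn {w | w ∈ D ∧ Φ w = 0} x ∧
    (closure K ∩ frontier D).Nonempty}

lemma CollarEigenfunction.exists_order {lam A : ℝ} {Φ : ℝ × ℝ → ℝ} {s : ℝ}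
    (hA : ∀ (Z : Finset ℝ) (m : ℝ → ℕ), (∀ a ∈ Z, a ∈ Ico 0 ℓ) →
      (∀ a ∈ Z, ∀ i < m a, iteratedDeriv i (fun x => (Φ ∘ planeMap Q) (x, 0)) a = 0) →
      ((∑ a ∈ Z, m a : ℕ) : ℝ) ≤ A * lam) (hs : s ∈ Ico 0 ℓ) :
    ∃ m, (∀ i < m, iteratedDeriv i (fun x => (Φ ∘ planeMap Q) (x, 0)) s = 0) ∧
      iteratedDeriv m (fun x => (Φ ∘ planeMap Q) (x, 0)) s ≠ 0 := by
  classical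
  have hex : ∃ m, iteratedDeriv m (fun x => (Φ ∘ planeMap Q) (x, 0)) s ≠ 0 := by
    by_contra! hcon
    obtain ⟨n, hn⟩ := exists_nat_gt (A * lam)
    have := hA {s} (fun _ => n) (by simpa using hs)
      (fun a ha i _ => by rw [Finset.mem_singleton.mp ha]; exact hcon i)
    rw [Finset.sum_singleton] at this
    linarith
  exact ⟨Nat.find hex, fun i hi => not_not.mp (Nat.find_min hex hi), Nat.find_spec hex⟩

lemma CollarEigenfunction.exists_arcs {lam : ℝ} {Φ : ℝ × ℝ → ℝ} {s : ℝ} {m : ℕ}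
    (E : CollarEigenfunction D Q lam Φ) (H : Collar D ℓ h Q)
    (h0 : ∀ i < m, iteratedDeriv i (fun x => (Φ ∘ planeMap Q) (x, 0)) s = 0)
    (hm : iteratedDeriv m (fun x => (Φ ∘ planeMap Q) (x, 0)) s ≠ 0) :
    ∃ c : Fin m → Set (ℝ × ℝ), ∀ K, (∃ x ∈ {w | w ∈ D ∧ Φ w = 0},
      K = connectedComponentIn {w | w ∈ D ∧ Φ w = 0} x) → planeMap Q (s, 0) ∈ closure K →
      ∃ j, K = c j := by
  classical
  have hh := H.h_pos
  have hs0 : ((s, (0 : ℝ)) : ℝ × ℝ).2 ∈ Icc 0 h := ⟨le_rfl, hh.le⟩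
  have sv : SmoothStrip h (Φ ∘ planeMap Q) := fun z hz => (E.analyticAt_comp H hz).contDiffAt
  have hsl := fun i => iteratedDeriv_slice sv (y := 0) ⟨le_rfl, hh.le⟩ i
  have hsl' := fun i => iteratedDeriv_slice sv.dy (y := 0) ⟨le_rfl, hh.le⟩ i
  have hjac : AnalyticAt ℝ (fun w => -lam ^ 2 * jac Q w) (s, 0) :=
    analyticAt_const.mul (H.analyticAt_jac (by simpa using hh.le))
  obtain ⟨γ, hγ, hγ0, hev⟩ := exists_local_arcs (m := m) (E.analyticAt_comp H hs0) hjac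
    (E.strip_eq H hs0) (fun i hi => (congrFun (hsl i) s).symm.trans (h0 i hi))
    (fun h => hm ((congrFun (hsl m) s).trans h))
    (fun i => by
      have h1 := congrFun (hsl' i) s
      simp only [E.neumann] at h1
      rw [← h1]
      simp)
    hh
  refine ⟨fun j => if hj : (γ j).Nonempty then
    connectedComponentIn {w | w ∈ D ∧ Φ w = 0} (planeMap Q hj.some) else ∅, ?_⟩
  rintro K ⟨x, hx, rfl⟩ hcl
  have hKN := connectedComponentIn_subset {w | w ∈ D ∧ Φ w = 0} x
  obtain ⟨z, hz, hz0, hzh, hzK⟩ := H.exists_collar_point s hev (fun w hw => (hKN hw).1) hcl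
  obtain ⟨j, hj⟩ := hz hz0 (hKN hzK).2
  refine ⟨j, ?_⟩
  have hne : (γ j).Nonempty := ⟨z, hj⟩
  have hmem : ∀ w ∈ γ j, w.2 ∈ Icc 0 h := fun w hw => ⟨(hγ0 j w hw).1.le, (hγ0 j w hw).2.1.le⟩
  have hpre : IsPreconnected (planeMap Q '' γ j) :=
    (hγ j).image _ (H.continuousOn_planeMap.mono hmem)
  have hsub : planeMap Q '' γ j ⊆ {w | w ∈ D ∧ Φ w = 0} := by
    rintro _ ⟨w, hw, rfl⟩
    obtain ⟨a, b, c⟩ := hγ0 j w hw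
    exact ⟨H.inside w a b.le, c⟩
  have h1 := hpre.subset_connectedComponentIn (mem_image_of_mem _ hj) hsub
  rw [← connectedComponentIn_eq hzK] at h1
  beta_reduce
  rw [dif_pos hne]
  exact connectedComponentIn_eq (h1 (mem_image_of_mem _ hne.some_mem))

/-- The nodal components touching the boundary, in collar coordinates. -/
theorem Collar.exists_touchingComponents_bound (H : Collar D ℓ h Q) : ∃ A > 0, ∀ lam > 0, ∀ Φ,
    CollarEigenfunction D Q lam Φ → (touchingComponents D Φ).Finite ∧
      ((touchingComponents D Φ).ncard : ℝ) ≤ A * lam := by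
  classical
  obtain ⟨A, hA, hAb⟩ := H.exists_linear_order_bound
  refine ⟨A, hA, fun lam hlam Φ E => ?_⟩
  have hord := hAb lam hlam Φ E
  have hex : ∀ s, ∃ m, s ∈ Ico 0 ℓ →
      (∀ i < m, iteratedDeriv i (fun x => (Φ ∘ planeMap Q) (x, 0)) s = 0) ∧
      iteratedDeriv m (fun x => (Φ ∘ planeMap Q) (x, 0)) s ≠ 0 := fun s => by
    by_cases hs : s ∈ Ico 0 ℓ
    · obtain ⟨m, hm⟩ := CollarEigenfunction.exists_order hord hs
      exact ⟨m, fun _ => hm⟩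
    · exact ⟨0, fun h => absurd h hs⟩
  choose m hm using hex
  have hlab : ∀ K ∈ touchingComponents D Φ, ∃ p : (s : ℝ) × Fin (m s), p.1 ∈ Ico 0 ℓ ∧
      ∃ hp : p.1 ∈ Ico 0 ℓ, K = (E.exists_arcs H (hm p.1 hp).1 (hm p.1 hp).2).choose p.2 := by
    rintro K ⟨x, hx, hK, w, hwK, hwF⟩
    obtain ⟨s, hs, rfl⟩ := H.surj w hwF
    obtain ⟨j, hj⟩ := (E.exists_arcs H (hm s hs).1 (hm s hs).2).choose_spec K ⟨x, hx, hK⟩ hwK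
    exact ⟨⟨s, j⟩, hs, hs, hj⟩
  rcases (touchingComponents D Φ).eq_empty_or_nonempty with hemp | ⟨K₀, hK₀⟩
  · rw [hemp, Set.ncard_empty, Nat.cast_zero]
    exact ⟨Set.finite_empty, by positivity⟩
  have : Nonempty ((s : ℝ) × Fin (m s)) := ⟨(hlab K₀ hK₀).choose⟩
  choose! f hf hfK using hlab
  have hcard : ∀ F : Finset (Set (ℝ × ℝ)), ↑F ⊆ touchingComponents D Φ → (F.card : ℝ) ≤ A * lam := by
    intro F hF
    set Z : Finset ℝ := F.image fun K => (f K).1 with hZ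
    have h1 : F.card ≤ (Z.sigma fun s => (Finset.univ : Finset (Fin (m s)))).card := by
      refine Finset.card_le_card_of_injOn f (fun K hK => ?_) fun K hK K' hK' hKK' => ?_
      · simp only [Finset.coe_sigma, Set.mem_sigma_iff, Finset.mem_coe, Finset.mem_univ, and_true, hZ]
        exact Finset.mem_image_of_mem (fun K => (f K).1) hK
      · obtain ⟨a, ha⟩ := hfK K (hF hK)
        obtain ⟨b, hb⟩ := hfK K' (hF hK')
        have key : ∀ p q : (s : ℝ) × Fin (m s), p = q → ∀ (a : p.1 ∈ Ico 0 ℓ) (b : q.1 ∈ Ico 0 ℓ),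
            (E.exists_arcs H (hm p.1 a).1 (hm p.1 a).2).choose p.2 =
              (E.exists_arcs H (hm q.1 b).1 (hm q.1 b).2).choose q.2 := by
          rintro p _ rfl a b
          rfl
        rw [ha, hb]
        exact key _ _ hKK' a b
    rw [Finset.card_sigma] at h1
    simp only [Finset.card_univ, Fintype.card_fin] at h1
    have hZm : ∀ a ∈ Z, a ∈ Ico 0 ℓ := fun a ha => by
      obtain ⟨K, hK, rfl⟩ := Finset.mem_image.mp ha
      exact hf K (hF hK)
    exact (Nat.cast_le.mpr h1).trans (hord Z m hZm fun a ha => (hm a (hZm a ha)).1)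
  have hfin : (touchingComponents D Φ).Finite := by
    by_contra hinf
    obtain ⟨n, hn⟩ := exists_nat_gt (A * lam)
    obtain ⟨F, hF, hFn⟩ := Set.Infinite.exists_subset_card_eq hinf n
    have := hcard F hF
    rw [hFn] at this
    linarith
  refine ⟨hfin, ?_⟩
  rw [Set.ncard_eq_toFinset_card _ hfin]
  exact hcard _ (by simp)

end Components

section PeriodicExtension
open Set Filter Topology

variable {f : ℝ → ℝ} {ℓ : ℝ}

/-- The Taylor coefficients of a real-analytic function grow at most geometrically. -/
lemma AnalyticAt.exists_iteratedDeriv_le {a : ℝ} (hf : AnalyticAt ℝ f a) :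
    ∃ C, ∃ r > 0, ∀ n, |iteratedDeriv n f a| ≤ C * n.factorial / r ^ n := by
  have h := hf.hasFPowerSeriesAt
  rw [hasFPowerSeriesAt_iff, Metric.eventually_nhds_iff] at h
  obtain ⟨ε, hε, h⟩ := h
  have hs := (h (y := ε / 2) (by rw [dist_zero_right, Real.norm_eq_abs, abs_of_pos] <;> linarith)).summable
  obtain ⟨C, hC⟩ := (hs.tendsto_atTop_zero.norm.bddAbove_range)
  refine ⟨C, ε / 2, by positivity, fun n => ?_⟩
  have h1 := hC (mem_range_self n)
  simp only [FormalMultilinearSeries.coeff_ofScalars, smul_eq_mul, Real.norm_eq_abs] at h1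
  rw [abs_mul, abs_div, Nat.abs_cast, abs_pow, abs_of_pos (by positivity : 0 < ε / 2)] at h1
  have hn : (0 : ℝ) < n.factorial := by positivity
  rw [le_div_iff₀ (by positivity)]
  calc _ = (ε / 2) ^ n * (|iteratedDeriv n f a| / n.factorial) * n.factorial := by field_simp
    _ ≤ _ := by gcongr

lemma iteratedDeriv_ofReal_eq_of_isOpen {U : Set ℝ} {V : Set ℂ} {F : ℂ → ℂ} (hU : IsOpen U)
    (hV : IsOpen V) (hUV : ∀ x ∈ U, (x : ℂ) ∈ V) (hf : AnalyticOnNhd ℝ f univ)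
    (hF : DifferentiableOn ℂ F V) (h : ∀ x ∈ U, F x = f x) (k : ℕ) :
    ∀ x ∈ U, iteratedDeriv k F (x : ℂ) = (iteratedDeriv k f x : ℝ) := by
  induction k with
  | zero => intro x hx; simpa using h x hx
  | succ k ih =>
    intro x hx
    have h1 : AnalyticAt ℂ (iteratedDeriv k F) (x : ℂ) :=
      (hF.analyticAt (hV.mem_nhds (hUV x hx))).iteratedDeriv' k
    have h2 := h1.differentiableAt.hasDerivAt.comp_ofReal
    have h3 : HasDerivAt (fun y : ℝ => ((iteratedDeriv k f y : ℝ) : ℂ))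
        ((deriv (iteratedDeriv k f) x : ℝ) : ℂ) x :=
      ((hf x trivial).iteratedDeriv' k).differentiableAt.hasDerivAt.ofReal_comp
    rw [iteratedDeriv_succ, iteratedDeriv_succ]
    refine h2.unique (h3.congr_of_eventuallyEq ?_)
    filter_upwards [hU.mem_nhds hx] with y hy using ih y hy

/-- The derivatives of a real-analytic function satisfy locally uniform Cauchy estimates. -/
lemma exists_iteratedDeriv_le_nhds (hf : AnalyticOnNhd ℝ f univ) (a : ℝ) :
    ∃ C, ∃ r > 0, ∀ᶠ b in 𝓝 a, ∀ n, |iteratedDeriv n f b| ≤ C * n.factorial / r ^ n := by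
  obtain ⟨C, r, hr, hC⟩ := (hf a trivial).exists_iteratedDeriv_le
  have hd := differentiableOn_complexTaylor hr hC
  obtain ⟨ε, hε, hev⟩ := Metric.eventually_nhds_iff.mp (complexTaylor_eventuallyEq (hf a trivial))
  have hδ : 0 < min ε (r / 2) := lt_min hε (by positivity)
  set δ := min ε (r / 2) with hδdef
  have hδr : δ ≤ r / 2 := min_le_right _ _
  have hball : ∀ b ∈ Metric.ball a (δ / 2), ∀ z ∈ Metric.closedBall (b : ℂ) (δ / 2),
      ‖z - a‖ ≤ r / 2 := by
    intro b hb z hz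
    rw [mem_closedBall_iff_norm] at hz
    have hb' : ‖(b : ℂ) - a‖ < δ / 2 := by
      rw [← Complex.ofReal_sub, Complex.norm_real]
      simpa [dist_eq_norm] using hb
    have := norm_add_le (z - b) (b - a)
    rw [sub_add_sub_cancel] at this
    linarith
  refine ⟨2 * C, δ / 2, by positivity, ?_⟩
  filter_upwards [Metric.ball_mem_nhds a (half_pos hδ)] with b hb n
  have h1 := iteratedDeriv_ofReal_eq_of_isOpen (f := f) Metric.isOpen_ball Metric.isOpen_ball
    (U := Metric.ball a (δ / 2)) (fun x hx => by
      have hx : |x - a| < δ / 2 := by simpa [dist_eq_norm] using hx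
      rw [Metric.mem_ball, dist_eq_norm, ← Complex.ofReal_sub, Complex.norm_real, Real.norm_eq_abs]
      linarith) hf hd
    (fun x hx => hev (hx.trans_le (by linarith [min_le_left ε (r / 2)]))) n b hb
  have h2 : DiffContOnCl ℂ (complexTaylor f a) (Metric.ball (b : ℂ) (δ / 2)) := by
    refine DifferentiableOn.diffContOnCl (hd.mono ?_)
    refine Metric.closure_ball_subset_closedBall.trans fun z hz => ?_
    rw [mem_ball_iff_norm]
    linarith [hball b hb z hz]
  have h3 := Complex.norm_iteratedDeriv_le_of_forall_mem_sphere_norm_le n (half_pos hδ) h2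
    (fun z hz => norm_complexTaylor_le hr hC (hball b hb z (Metric.sphere_subset_closedBall hz)))
  rw [h1, Complex.norm_real, Real.norm_eq_abs] at h3
  refine h3.trans (le_of_eq ?_)
  ring

lemma exists_iteratedDeriv_le_of_periodic (hℓ : 0 < ℓ) (hf : AnalyticOnNhd ℝ f univ)
    (hp : Function.Periodic f ℓ) :
    ∃ C, ∃ r > 0, ∀ n b, |iteratedDeriv n f b| ≤ C * n.factorial / r ^ n := by
  have hK : ∃ C, ∃ r > 0, ∀ b ∈ Icc 0 ℓ, ∀ n, |iteratedDeriv n f b| ≤ C * n.factorial / r ^ n := by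
    refine isCompact_Icc.induction_on (p := fun s => ∃ C, ∃ r > 0, ∀ b ∈ s, ∀ n,
      |iteratedDeriv n f b| ≤ C * n.factorial / r ^ n) ⟨0, 1, one_pos, by simp⟩ ?_ ?_ ?_
    · rintro s t hst ⟨C, r, hr, h⟩
      exact ⟨C, r, hr, fun b hb => h b (hst hb)⟩
    · rintro s t ⟨C, r, hr, h⟩ ⟨C', r', hr', h'⟩
      refine ⟨max |C| |C'|, min r r', lt_min hr hr', ?_⟩
      have hm : 0 < min r r' := lt_min hr hr'
      rintro b (hb | hb) n
      · refine (h b hb n).trans ?_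
        gcongr
        · exact (le_abs_self C).trans (le_max_left _ _)
        · exact min_le_left _ _
      · refine (h' b hb n).trans ?_
        gcongr
        · exact (le_abs_self C').trans (le_max_right _ _)
        · exact min_le_right _ _
    · intro x _
      obtain ⟨C, r, hr, h⟩ := exists_iteratedDeriv_le_nhds hf x
      exact ⟨_, mem_nhdsWithin_of_mem_nhds h, C, r, hr, fun b hb => hb⟩
  obtain ⟨C, r, hr, h⟩ := hK
  refine ⟨C, r, hr, fun n b => ?_⟩
  obtain ⟨k, hk⟩ := exists_int_add_mem_Ico hℓ b
  have := (hp.iteratedDeriv' n).int_mul k b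
  rw [← this]
  exact h _ ⟨hk.1, hk.2.le⟩ n

/-- Holomorphic functions on a strip agreeing on the real line agree. -/
lemma eqOn_strip_of_eq_ofReal {F G : ℂ → ℂ} {r : ℝ} (hr : 0 < r)
    (hF : DifferentiableOn ℂ F {z | |z.im| < r}) (hG : DifferentiableOn ℂ G {z | |z.im| < r})
    (h : ∀ x : ℝ, F x = G x) : EqOn F G {z | |z.im| < r} := by
  refine AnalyticOnNhd.eqOn_of_preconnected_of_frequently_eq (z₀ := ((0 : ℝ) : ℂ))
    (hF.analyticOnNhd (isOpen_strip r)) (hG.analyticOnNhd (isOpen_strip r))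
    (convex_strip r).isPreconnected (by simpa using hr) ?_
  have h5 : Tendsto (fun t : ℝ => (t : ℂ)) (𝓝[≠] 0) (𝓝[≠] ((0 : ℝ) : ℂ)) := by
    refine tendsto_nhdsWithin_of_tendsto_nhds_of_eventually_within _
      (Complex.continuous_ofReal.continuousAt.tendsto.mono_left nhdsWithin_le_nhds) ?_
    filter_upwards [self_mem_nhdsWithin] with t ht
    simpa using ht
  exact h5.frequently (Frequently.of_forall h)

/-- A periodic real-analytic function extends to a periodic holomorphic function on a strip. -/
theorem exists_periodic_holomorphic_extension (hℓ : 0 < ℓ) (hf : AnalyticOnNhd ℝ f univ)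
    (hp : Function.Periodic f ℓ) : ∃ r > 0, ∃ F : ℂ → ℂ, DifferentiableOn ℂ F {z | |z.im| < r} ∧
      (∀ x : ℝ, F x = f x) ∧ ∀ z, F (z + ℓ) = F z := by
  classical
  obtain ⟨C, r, hr, hb⟩ := exists_iteratedDeriv_le_of_periodic hℓ hf hp
  obtain ⟨F, hF, hFf, -⟩ := exists_holomorphic_extension hr hf hb
  have hmaps : ∀ z : ℂ, (z + ℓ).im = z.im := by simp
  have hFp : EqOn (fun z => F (z + ℓ)) F {z | |z.im| < r} :=
    eqOn_strip_of_eq_ofReal hr (hF.comp (by fun_prop) fun z hz => by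
      simpa using hz) hF fun x => by
      rw [← Complex.ofReal_add, hFf, hFf, hp x]
  refine ⟨r, hr, fun z => if |z.im| < r then F z else 0, ?_, fun x => ?_, fun z => ?_⟩
  · exact hF.congr fun z hz => if_pos hz
  · simp [hr, hFf]
  · simp only [hmaps]
    split_ifs with hz
    · exact hFp hz
    · rfl

end PeriodicExtension

section CollarInjectivity
open Set Filter Topology

variable {Q : ℂ → ℂ} {ℓ r : ℝ}

lemma AnalyticAt.eventually_injOn {z : ℂ} (hQ : AnalyticAt ℂ Q z) (h0 : deriv Q z ≠ 0) :
    ∃ U ∈ 𝓝 z, InjOn Q U := by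
  have h : HasStrictDerivAt Q (deriv Q z) z := hQ.hasStrictDerivAt
  have h1 := (h.hasStrictFDerivAt_equiv h0).eventually_left_inverse
  exact ⟨_, h1, fun a ha b hb hab => by
    have ha : _ = a := ha
    have hb : _ = b := hb
    rw [← ha, ← hb, hab]⟩

lemma tendsto_toC_uncurry (x : ℝ) : Tendsto (fun p : ℝ × ℝ => toC (p.2, p.1)) (𝓝 (0, x)) (𝓝 (x : ℂ)) := by
  have h : Continuous fun p : ℝ × ℝ => toC (p.2, p.1) := continuous_toC.comp (by fun_prop)
  have := h.tendsto (0, x)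
  simpa [toC] using this

lemma exists_deriv_ne_zero_strip (hℓ : 0 < ℓ) (hr : 0 < r)
    (hQ : DifferentiableOn ℂ Q {z | |z.im| < r}) (hp : ∀ z, Q (z + ℓ) = Q z)
    (h0 : ∀ x : ℝ, deriv Q x ≠ 0) : ∀ᶠ y : ℝ in 𝓝 0, ∀ x : ℝ, deriv Q (toC (x, y)) ≠ 0 := by
  have hev : ∀ᶠ y : ℝ in 𝓝 0, ∀ x ∈ Icc 0 ℓ, deriv Q (toC (x, y)) ≠ 0 := by
    refine isCompact_Icc.eventually_forall_of_forall_eventually fun x _ => ?_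
    have hmem : {z : ℂ | |z.im| < r} ∈ 𝓝 (x : ℂ) := (isOpen_strip r).mem_nhds (by simpa using hr)
    exact (tendsto_toC_uncurry x).eventually
      ((hQ.analyticAt hmem).deriv.continuousAt.eventually_ne (h0 x))
  filter_upwards [hev] with y hy x
  obtain ⟨n, hn⟩ := exists_int_add_mem_Ico hℓ x
  have := hy _ ⟨hn.1, hn.2.le⟩
  rwa [toC_add, periodic_int (deriv_periodic hp)] at this

/-- A periodic holomorphic map which is injective modulo the period and regular on the real line
is injective modulo the period on a thin strip. -/
lemma exists_injective_mod_strip (hℓ : 0 < ℓ) (hr : 0 < r)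
    (hQ : DifferentiableOn ℂ Q {z | |z.im| < r}) (hp : ∀ z, Q (z + ℓ) = Q z)
    (h0 : ∀ x : ℝ, deriv Q x ≠ 0)
    (hinj : ∀ x y : ℝ, Q x = Q y → ∃ n : ℤ, x - y = n * ℓ) :
    ∀ᶠ y : ℝ × ℝ in 𝓝 0, ∀ x x' : ℝ, Q (toC (x, y.1)) = Q (toC (x', y.2)) →
      y.1 = y.2 ∧ ∃ n : ℤ, x - x' = n * ℓ := by
  have hmem : ∀ x : ℝ, {z : ℂ | |z.im| < r} ∈ 𝓝 (x : ℂ) :=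
    fun x => (isOpen_strip r).mem_nhds (by simpa using hr)
  have ht1 : ∀ a : ℝ × ℝ, Tendsto (fun p : (ℝ × ℝ) × (ℝ × ℝ) => toC (p.2.1, p.1.1)) (𝓝 (0, a))
      (𝓝 (a.1 : ℂ)) := fun a => by
    have h : Continuous fun p : (ℝ × ℝ) × (ℝ × ℝ) => toC (p.2.1, p.1.1) :=
      continuous_toC.comp (by fun_prop)
    simpa [toC] using h.tendsto (0, a)
  have ht2 : ∀ a : ℝ × ℝ, Tendsto (fun p : (ℝ × ℝ) × (ℝ × ℝ) => toC (p.2.2, p.1.2)) (𝓝 (0, a))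
      (𝓝 (a.2 : ℂ)) := fun a => by
    have h : Continuous fun p : (ℝ × ℝ) × (ℝ × ℝ) => toC (p.2.2, p.1.2) :=
      continuous_toC.comp (by fun_prop)
    simpa [toC] using h.tendsto (0, a)
  have hev : ∀ᶠ y : ℝ × ℝ in 𝓝 0, ∀ x ∈ Icc (0 : ℝ) ℓ ×ˢ Icc (0 : ℝ) ℓ,
      Q (toC (x.1, y.1)) = Q (toC (x.2, y.2)) → y.1 = y.2 ∧ ∃ n : ℤ, x.1 - x.2 = n * ℓ := by
    refine (isCompact_Icc.prod isCompact_Icc).eventually_forall_of_forall_eventually fun x _ => ?_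
    by_cases hx : Q x.1 = Q x.2
    · obtain ⟨n, hn⟩ := hinj _ _ hx
      obtain ⟨U, hU, hUi⟩ := (hQ.analyticAt (hmem x.1)).eventually_injOn (h0 x.1)
      have hsh : Tendsto (fun p : (ℝ × ℝ) × (ℝ × ℝ) => toC (p.2.2, p.1.2) + ((n * ℓ : ℝ) : ℂ))
          (𝓝 (0, x)) (𝓝 (x.1 : ℂ)) := by
        have e : (x.1 : ℂ) = x.2 + ((n * ℓ : ℝ) : ℂ) := by
          rw [← Complex.ofReal_add, ← hn]; simp
        rw [e]
        exact (ht2 x).add tendsto_const_nhds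
      filter_upwards [ht1 x hU, hsh hU] with p h1 h2 hpe
      have h3 := hUi h1 h2 (by rw [periodic_int hp, hpe])
      have hre := congrArg Complex.re h3
      have him := congrArg Complex.im h3
      simp [toC] at hre him
      exact ⟨him, n, by linarith⟩
    · have hc1 := ((hQ.analyticAt (hmem x.1)).continuousAt.tendsto.comp (ht1 x))
      have hc2 := ((hQ.analyticAt (hmem x.2)).continuousAt.tendsto.comp (ht2 x))
      filter_upwards [(hc1.prodMk_nhds hc2).eventually
        (isClosed_diagonal.isOpen_compl.mem_nhds hx)] with p hpn hpe
      exact absurd hpe hpn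
  filter_upwards [hev] with y hy x x' hxx'
  obtain ⟨n, hn⟩ := exists_int_add_mem_Ico hℓ x
  obtain ⟨n', hn'⟩ := exists_int_add_mem_Ico hℓ x'
  obtain ⟨h1, k, hk⟩ := hy (x + n * ℓ, x' + n' * ℓ) ⟨⟨hn.1, hn.2.le⟩, hn'.1, hn'.2.le⟩ (by
    rw [toC_add, toC_add, periodic_int hp, periodic_int hp, hxx'])
  refine ⟨h1, k - n + n', ?_⟩
  push_cast
  linarith

end CollarInjectivity

/-- Conformal coordinates near the boundary curve of a plane domain, without any assertion on the
side of the curve on which the domain lies. -/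
structure TwoSidedCollar (D : Set (ℝ × ℝ)) (ℓ h : ℝ) (Q : ℂ → ℂ) : Prop where
  len_pos : 0 < ℓ
  h_pos : 0 < h
  h_le : h ≤ 1
  analytic : ∀ z : ℂ, |z.im| ≤ 2 * h → AnalyticAt ℂ Q z
  periodic : ∀ z : ℂ, Q (z + ℓ) = Q z
  deriv_ne : ∀ z : ℂ, |z.im| ≤ h → deriv Q z ≠ 0
  inj : ∀ z w : ℝ × ℝ, |z.2| ≤ h → |w.2| ≤ h → planeMap Q z = planeMap Q w →
    z.2 = w.2 ∧ ∃ n : ℤ, z.1 - w.1 = n * ℓ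
  boundary : ∀ x, planeMap Q (x, 0) ∈ frontier D
  surj : ∀ w ∈ frontier D, ∃ x, planeMap Q (x, 0) = w
  isOpen : IsOpen D
  isPreconnected : IsPreconnected D
  isBounded : Bornology.IsBounded D
  nonempty : D.Nonempty

section TwoSided
open Set Filter Topology

variable {D : Set (ℝ × ℝ)} {ℓ h r : ℝ} {Q : ℂ → ℂ}

lemma toC_neg (z : ℝ × ℝ) : toC (-z) = -toC z := by simp [toC]; ring

lemma planeMap_neg (Q : ℂ → ℂ) (z : ℝ × ℝ) : planeMap (fun w => Q (-w)) z = planeMap Q (-z) := by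
  simp [planeMap, rePart, imPart, toC_neg]

lemma planeMap_eq_iff {z w : ℝ × ℝ} : planeMap Q z = planeMap Q w ↔ Q (toC z) = Q (toC w) := by
  simp [planeMap, rePart, imPart, Complex.ext_iff]

lemma IsPreconnected.subset_or_disjoint_of_frontier {X : Type*} [TopologicalSpace X] {S U : Set X}
    (hS : IsPreconnected S) (hU : IsOpen U) (h : Disjoint S (frontier U)) :
    S ⊆ U ∨ Disjoint S U := by
  have hcov : S ⊆ U ∪ (closure U)ᶜ := fun x hx => by
    by_cases hxU : x ∈ U
    · exact Or.inl hxU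
    · refine Or.inr fun hc => h.le_bot ⟨hx, hc, ?_⟩
      rwa [hU.interior_eq]
  rcases isPreconnected_iff_subset_of_disjoint.mp hS U (closure U)ᶜ hU
    isClosed_closure.isOpen_compl hcov (by
      rw [Set.eq_empty_iff_forall_notMem]
      rintro x ⟨-, h1, h2⟩
      exact h2 (subset_closure h1)) with h1 | h1
  · exact Or.inl h1
  · exact Or.inr (Set.disjoint_left.mpr fun x hx hxU => h1 hx (subset_closure hxU))

namespace TwoSidedCollar

lemma neg (H : TwoSidedCollar D ℓ h Q) : TwoSidedCollar D ℓ h (fun z => Q (-z)) where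
  len_pos := H.len_pos
  h_pos := H.h_pos
  h_le := H.h_le
  analytic := fun z hz => by
    have h1 : AnalyticAt ℂ Q (-z) := H.analytic _ (by simpa using hz)
    exact h1.fun_comp analyticAt_id.neg
  periodic := fun z => by
    rw [← H.periodic (-(z + ℓ))]
    congr 1
    ring
  deriv_ne := fun z hz => by
    rw [deriv_comp_neg]
    exact neg_ne_zero.mpr (H.deriv_ne _ (by simpa using hz))
  inj := fun z w hz hw hzw => by
    rw [planeMap_neg, planeMap_neg] at hzw
    obtain ⟨h1, n, hn⟩ := H.inj _ _ (by simpa using hz) (by simpa using hw) hzw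
    refine ⟨neg_injective h1, -n, ?_⟩
    simp only [Prod.fst_neg] at hn
    push_cast
    linarith
  boundary := fun x => by
    rw [planeMap_neg]
    simpa using H.boundary (-x)
  surj := fun w hw => by
    obtain ⟨x, hx⟩ := H.surj w hw
    exact ⟨-x, by rw [planeMap_neg, ← hx]; simp⟩
  isOpen := H.isOpen
  isPreconnected := H.isPreconnected
  isBounded := H.isBounded
  nonempty := H.nonempty

variable (H : TwoSidedCollar D ℓ h Q)
include H

lemma continuousAt_planeMap {z : ℝ × ℝ} (hz : |z.2| ≤ h) : ContinuousAt (planeMap Q) z :=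
  (analyticAt_planeMap (H.analytic _ (by
    rw [toC_im]
    linarith [H.h_pos]))).continuousAt

lemma notMem_frontier {z : ℝ × ℝ} (hz : |z.2| ≤ h) (h0 : z.2 ≠ 0) :
    planeMap Q z ∉ frontier D := fun hf => by
  obtain ⟨x, hx⟩ := H.surj _ hf
  exact h0 (H.inj (x, 0) z (by simpa using H.h_pos.le) hz hx).1.symm

lemma image_subset_or_disjoint {I : Set ℝ} (hI : Convex ℝ I) (hIh : ∀ y ∈ I, |y| ≤ h ∧ y ≠ 0) :
    planeMap Q '' (univ ×ˢ I) ⊆ D ∨ Disjoint (planeMap Q '' (univ ×ˢ I)) D := by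
  refine IsPreconnected.subset_or_disjoint_of_frontier ?_ H.isOpen ?_
  · exact (convex_univ.prod hI).isPreconnected.image _
      fun z hz => (H.continuousAt_planeMap (hIh _ hz.2).1).continuousWithinAt
  · rw [Set.disjoint_left]
    rintro _ ⟨z, hz, rfl⟩
    exact H.notMem_frontier (hIh _ hz.2).1 (hIh _ hz.2).2

lemma image_mem_nhds (x : ℝ) : planeMap Q '' {z | |z.2| ≤ h} ∈ 𝓝 (planeMap Q (x, 0)) := by
  rw [← map_nhds_planeMap (H.analytic _ (by simpa using H.h_pos.le))
    (H.deriv_ne _ (by simpa using H.h_pos.le))]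
  refine image_mem_map ?_
  have : ∀ᶠ z : ℝ × ℝ in 𝓝 (x, 0), |z.2| < h :=
    (by fun_prop : Continuous fun z : ℝ × ℝ => |z.2|).continuousAt.eventually_lt_const
      (by simpa using H.h_pos)
  filter_upwards [this] with z hz using le_of_lt hz

lemma collar_of_inside (hup : ∀ z : ℝ × ℝ, 0 < z.2 → z.2 ≤ h → planeMap Q z ∈ D) :
    Collar D ℓ h Q where
  len_pos := H.len_pos
  h_pos := H.h_pos
  h_le := H.h_le
  analytic := H.analytic
  periodic := H.periodic
  deriv_ne := H.deriv_ne
  inj := by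
    rintro ⟨x, y⟩ ⟨hx, hy⟩ ⟨x', y'⟩ ⟨hx', hy'⟩ he
    simp only at hx hy hx' hy'
    obtain ⟨h1, n, hn⟩ := H.inj _ _ (abs_le.mpr ⟨by linarith [hy.1, H.h_pos], hy.2⟩)
      (abs_le.mpr ⟨by linarith [hy'.1, H.h_pos], hy'.2⟩) he
    simp only at h1 hn
    have hn1 : ((n : ℝ)) * ℓ < 1 * ℓ := by linarith [hx.2, hx'.1]
    have hn2 : (-1 : ℝ) * ℓ < n * ℓ := by linarith [hx.1, hx'.2]
    have h3 : (n : ℝ) < 1 := lt_of_mul_lt_mul_right hn1 H.len_pos.le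
    have h4 : (-1 : ℝ) < n := lt_of_mul_lt_mul_right hn2 H.len_pos.le
    have h5 : n = 0 := by
      have h6 : n < 1 := by exact_mod_cast h3
      have h7 : -1 < n := by exact_mod_cast h4
      omega
    rw [h5] at hn
    simp only [Int.cast_zero, zero_mul] at hn
    rw [h1, sub_eq_zero.mp hn]
  boundary := H.boundary
  surj := fun w hw => by
    obtain ⟨x, rfl⟩ := H.surj w hw
    obtain ⟨n, hn⟩ := exists_int_add_mem_Ico H.len_pos x
    refine ⟨_, hn, planeMap_eq_iff.mpr ?_⟩
    rw [toC_add, periodic_int H.periodic]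
  inside := hup
  outside := by
    rcases H.image_subset_or_disjoint (convex_Ico (-h) 0)
      (fun y hy => ⟨abs_le.mpr ⟨hy.1, by linarith [hy.2, H.h_pos]⟩, hy.2.ne⟩) with hlo | hlo
    · exfalso
      have hcl : IsOpen (closure D) := by
        rw [isOpen_iff_mem_nhds]
        intro w hw
        by_cases hwD : w ∈ D
        · exact mem_of_superset (H.isOpen.mem_nhds hwD) subset_closure
        · obtain ⟨x, rfl⟩ := H.surj w ⟨hw, by rwa [H.isOpen.interior_eq]⟩
          refine mem_of_superset (H.image_mem_nhds x) ?_
          rintro _ ⟨⟨a, b⟩, hab, rfl⟩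
          have hab : |b| ≤ h := hab
          rcases lt_trichotomy b 0 with hb | hb | hb
          · exact subset_closure (hlo ⟨(a, b), ⟨trivial, (abs_le.mp hab).1, hb⟩, rfl⟩)
          · rw [hb]
            exact (H.boundary a).1
          · exact subset_closure (hup (a, b) hb (abs_le.mp hab).2)
      have huniv := IsClopen.eq_univ ⟨isClosed_closure, hcl⟩ H.nonempty.closure
      have hb := H.isBounded.closure
      rw [huniv] at hb
      exact NormedSpace.unbounded_univ ℝ (ℝ × ℝ) hb
    · intro z h1 h2 hz
      exact hlo.le_bot ⟨⟨z, ⟨trivial, h1, h2⟩, rfl⟩, hz⟩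
  isOpen := H.isOpen
  isPreconnected := H.isPreconnected
  isBounded := H.isBounded

/-- After possibly reversing the boundary curve, a two-sided collar is a collar. -/
theorem collar_or_neg : Collar D ℓ h Q ∨ Collar D ℓ h (fun z => Q (-z)) := by
  rcases H.image_subset_or_disjoint (convex_Ioc 0 h)
    (fun y hy => ⟨abs_le.mpr ⟨by linarith [hy.1, H.h_pos], hy.2⟩, hy.1.ne'⟩) with h1 | h1
  · exact Or.inl (H.collar_of_inside fun z hz hzh => h1 ⟨z, ⟨trivial, hz, hzh⟩, rfl⟩)
  rcases H.image_subset_or_disjoint (convex_Ico (-h) 0)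
    (fun y hy => ⟨abs_le.mpr ⟨hy.1, by linarith [hy.2, H.h_pos]⟩, hy.2.ne⟩) with h2 | h2
  · refine Or.inr (H.neg.collar_of_inside fun z hz hzh => ?_)
    rw [planeMap_neg]
    exact h2 ⟨-z, ⟨trivial, by simpa using hzh, by simpa using hz⟩, rfl⟩
  · exfalso
    obtain ⟨_, ⟨⟨a, b⟩, hab, rfl⟩, hwD⟩ :=
      mem_closure_iff_nhds.mp (H.boundary 0).1 _ (H.image_mem_nhds 0)
    have hab : |b| ≤ h := hab
    rcases lt_trichotomy b 0 with hb | hb | hb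
    · exact h2.le_bot ⟨⟨(a, b), ⟨trivial, (abs_le.mp hab).1, hb⟩, rfl⟩, hwD⟩
    · have := (H.boundary a).2
      rw [H.isOpen.interior_eq] at this
      rw [hb] at hwD
      exact this hwD
    · exact h1.le_bot ⟨⟨(a, b), ⟨trivial, hb, (abs_le.mp hab).2⟩, rfl⟩, hwD⟩

end TwoSidedCollar

/-- A regular closed curve bounding a plane domain, continued holomorphically to a strip, gives
collar coordinates. -/
theorem exists_twoSidedCollar (hℓ : 0 < ℓ) (hr : 0 < r)
    (hQ : DifferentiableOn ℂ Q {z | |z.im| < r}) (hp : ∀ z, Q (z + ℓ) = Q z)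
    (h0 : ∀ x : ℝ, deriv Q x ≠ 0)
    (hinj : ∀ x y : ℝ, Q x = Q y → ∃ n : ℤ, x - y = n * ℓ)
    (hbd : ∀ x, planeMap Q (x, 0) ∈ frontier D)
    (hsurj : ∀ w ∈ frontier D, ∃ x, planeMap Q (x, 0) = w)
    (hD : IsOpen D) (hDc : IsPreconnected D) (hDb : Bornology.IsBounded D) (hDn : D.Nonempty) :
    ∃ h, TwoSidedCollar D ℓ h Q := by
  obtain ⟨δ, hδ, hd⟩ := Metric.eventually_nhds_iff.mp (exists_deriv_ne_zero_strip hℓ hr hQ hp h0)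
  obtain ⟨ε, hε, he⟩ := Metric.eventually_nhds_iff.mp (exists_injective_mod_strip hℓ hr hQ hp h0 hinj)
  have hm : 0 < min (min 1 r) (min δ ε) := by positivity
  set m := min (min 1 r) (min δ ε) with hmdef
  have m1 : m ≤ 1 := (min_le_left _ _).trans (min_le_left _ _)
  have m2 : m ≤ r := (min_le_left _ _).trans (min_le_right _ _)
  have m3 : m ≤ δ := (min_le_right _ _).trans (min_le_left _ _)
  have m4 : m ≤ ε := (min_le_right _ _).trans (min_le_right _ _)
  refine ⟨m / 3, hℓ, by positivity, by linarith, fun z hz => ?_, hp, fun z hz => ?_,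
    fun z w hz hw hzw => ?_, hbd, hsurj, hD, hDc, hDb, hDn⟩
  · refine hQ.analyticAt ((isOpen_strip r).mem_nhds ?_)
    change |z.im| < r
    linarith
  · have := hd (y := z.im) (by rw [dist_zero_right, Real.norm_eq_abs]; linarith) z.re
    have e : toC (z.re, z.im) = z := by apply Complex.ext <;> simp
    rwa [e] at this
  · refine he (y := (z.2, w.2)) ?_ z.1 w.1 (planeMap_eq_iff.mp hzw)
    rw [dist_zero_right, Prod.norm_def, max_lt_iff, Real.norm_eq_abs, Real.norm_eq_abs]
    constructor <;> linarith

end TwoSided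

section Plane
open Set Filter Topology

variable {Ω : Set E2} {B : BoundaryParam Ω} {lam : ℝ} {φ : E2 → ℝ}

/-- The Euclidean plane as a product. -/
def planeEquiv : E2 ≃L[ℝ] ℝ × ℝ :=
  (EuclideanSpace.equiv (Fin 2) ℝ).trans (ContinuousLinearEquiv.finTwoArrow ℝ ℝ)

lemma planeEquiv_apply (x : E2) : planeEquiv x = (x 0, x 1) := rfl

lemma planeEquiv_symm_fst : planeEquiv.symm (1, 0) = EuclideanSpace.single 0 1 := by
  rw [ContinuousLinearEquiv.symm_apply_eq, planeEquiv_apply]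
  simp

lemma planeEquiv_symm_snd : planeEquiv.symm (0, 1) = EuclideanSpace.single 1 1 := by
  rw [ContinuousLinearEquiv.symm_apply_eq, planeEquiv_apply]
  simp

lemma dx_comp_planeEquiv_symm (φ : E2 → ℝ) : dx (φ ∘ planeEquiv.symm) =
    (fun x => fderiv ℝ φ x (EuclideanSpace.single 0 1)) ∘ planeEquiv.symm := by
  funext w
  rw [dx, ContinuousLinearEquiv.comp_right_fderiv, ← planeEquiv_symm_fst]
  rfl

lemma dy_comp_planeEquiv_symm (φ : E2 → ℝ) : dy (φ ∘ planeEquiv.symm) =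
    (fun x => fderiv ℝ φ x (EuclideanSpace.single 1 1)) ∘ planeEquiv.symm := by
  funext w
  rw [dy, ContinuousLinearEquiv.comp_right_fderiv, ← planeEquiv_symm_snd]
  rfl

lemma lap_planeEquiv_symm (φ : E2 → ℝ) (w : ℝ × ℝ) :
    dx (dx (φ ∘ planeEquiv.symm)) w + dy (dy (φ ∘ planeEquiv.symm)) w =
      lap φ (planeEquiv.symm w) := by
  rw [dx_comp_planeEquiv_symm, dx_comp_planeEquiv_symm, dy_comp_planeEquiv_symm,
    dy_comp_planeEquiv_symm, lap, Fin.sum_univ_two]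
  rfl

namespace BoundaryParam

lemma hasDerivAt_coord (B : BoundaryParam Ω) (i : Fin 2) (s : ℝ) :
    HasDerivAt (fun t => B.q t i) (B.qd s i) s :=
  (EuclideanSpace.proj (𝕜 := ℝ) i).hasFDerivAt.comp_hasDerivAt s (B.hasDerivAt s)

lemma exists_sub_eq_of_q_eq (B : BoundaryParam Ω) {x y : ℝ} (h : B.q x = B.q y) :
    ∃ n : ℤ, x - y = n * B.len := by
  obtain ⟨m, hm⟩ := exists_int_add_mem_Ico B.len_pos x
  obtain ⟨n, hn⟩ := exists_int_add_mem_Ico B.len_pos y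
  have := B.injOn hm hn (by rw [B.periodic.int_mul, B.periodic.int_mul, h])
  refine ⟨n - m, ?_⟩
  push_cast
  linarith

/-- The rotated tangent vector is a multiple of the normal. -/
lemma inner_rotate_eq_zero (B : BoundaryParam Ω) (s : ℝ) {g : E2} (hg : ⟪g, B.ν s⟫ = 0) :
    -B.qd s 1 * g 0 + B.qd s 0 * g 1 = 0 := by
  have h1 := B.ν_unit s
  have h2 := B.ν_orth s
  rw [EuclideanSpace.norm_eq, Real.sqrt_eq_one, Fin.sum_univ_two] at h1
  simp only [Real.norm_eq_abs, sq_abs] at h1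
  simp only [PiLp.inner_apply, Fin.sum_univ_two, RCLike.inner_apply, conj_trivial] at hg h2
  set a := B.ν s 0
  set b := B.ν s 1
  set c := B.qd s 0
  set d := B.qd s 1
  linear_combination (-(d * g 0) + c * g 1) * (-h1) + (c * b - d * a) * hg +
    (a * g 1 - b * g 0) * h2

/-- The boundary curve extends to collar coordinates. -/
theorem exists_collar (hΩ : IsPlaneDomain Ω) (B : BoundaryParam Ω) (hB : B.IsAnalytic) :
    ∃ h, ∃ Q : ℂ → ℂ, Collar (planeEquiv '' Ω) B.len h Q ∧ ∀ x : ℝ, ∃ s ε : ℝ,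
      planeMap Q (x, 0) = planeEquiv (B.q s) ∧ rePart (deriv Q) (x, 0) = ε * B.qd s 0 ∧
        imPart (deriv Q) (x, 0) = ε * B.qd s 1 := by
  have hana : ∀ i : Fin 2, AnalyticOnNhd ℝ (fun t => B.q t i) univ := fun i s hs =>
    ((EuclideanSpace.proj (𝕜 := ℝ) i : E2 →L[ℝ] ℝ).analyticAt (B.q s)).comp (hB s hs)
  have hper : ∀ i : Fin 2, Function.Periodic (fun t => B.q t i) B.len := fun i t => by
    simp only [B.periodic t]
  obtain ⟨r₁, hr₁, F₁, hF₁, hF₁q, hF₁p⟩ :=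
    exists_periodic_holomorphic_extension B.len_pos (hana 0) (hper 0)
  obtain ⟨r₂, hr₂, F₂, hF₂, hF₂q, hF₂p⟩ :=
    exists_periodic_holomorphic_extension B.len_pos (hana 1) (hper 1)
  have hr : 0 < min r₁ r₂ := lt_min hr₁ hr₂
  set r := min r₁ r₂ with hrdef
  set Q : ℂ → ℂ := fun z => F₁ z + Complex.I * F₂ z with hQdef
  have hQ : DifferentiableOn ℂ Q {z | |z.im| < r} :=
    (hF₁.mono fun z (hz : |z.im| < r) => hz.trans_le (min_le_left _ _)).add
      ((hF₂.mono fun z (hz : |z.im| < r) => hz.trans_le (min_le_right _ _)).const_mul _)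
  have hp : ∀ z, Q (z + B.len) = Q z := fun z => by simp only [hQdef, hF₁p, hF₂p]
  have hQx : ∀ x : ℝ, Q x = B.q x 0 + Complex.I * B.q x 1 := fun x => by
    simp only [hQdef, hF₁q, hF₂q]
  have hQd : ∀ x : ℝ, deriv Q x = B.qd x 0 + Complex.I * B.qd x 1 := fun x => by
    have h1 := (hQ.differentiableAt ((isOpen_strip r).mem_nhds
      (by simpa using hr : (x : ℂ) ∈ {z : ℂ | |z.im| < r}))).hasDerivAt.comp_ofReal
    have h2 := (B.hasDerivAt_coord 0 x).ofReal_comp.add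
      ((B.hasDerivAt_coord 1 x).ofReal_comp.const_mul Complex.I)
    simp only [hQx] at h1
    exact h1.unique h2
  have htoC : ∀ x : ℝ, toC (x, 0) = x := fun x => by simp [toC]
  have hpm : ∀ x : ℝ, planeMap Q (x, 0) = planeEquiv (B.q x) := fun x => by
    simp [planeMap, rePart, imPart, htoC, hQx, planeEquiv_apply]
  have h0 : ∀ x : ℝ, deriv Q x ≠ 0 := fun x h => by
    rw [hQd] at h
    have hre := congrArg Complex.re h
    have him := congrArg Complex.im h
    simp at hre him
    have := B.unitSpeed x
    rw [EuclideanSpace.norm_eq, Fin.sum_univ_two, hre, him] at this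
    simp at this
  have hfr : frontier (planeEquiv '' Ω) = planeEquiv '' frontier Ω :=
    (planeEquiv.toHomeomorph.image_frontier Ω).symm
  obtain ⟨h, H⟩ := exists_twoSidedCollar (D := planeEquiv '' Ω) B.len_pos hr hQ hp h0
    (fun x y hxy => B.exists_sub_eq_of_q_eq (planeEquiv.injective (by
      rw [← hpm, ← hpm, planeMap_eq_iff, htoC, htoC, hxy])))
    (fun x => by
      rw [hpm, hfr, ← B.range_eq]
      exact mem_image_of_mem _ (mem_range_self x))
    (fun w hw => by
      rw [hfr, ← B.range_eq] at hw
      obtain ⟨_, ⟨x, rfl⟩, rfl⟩ := hw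
      exact ⟨x, hpm x⟩)
    (planeEquiv.toHomeomorph.isOpenMap _ hΩ.isOpen)
    (hΩ.isConnected.isPreconnected.image _ planeEquiv.continuous.continuousOn)
    (planeEquiv.lipschitz.isBounded_image hΩ.isBounded) (hΩ.isConnected.nonempty.image _)
  rcases H.collar_or_neg with H | H
  · refine ⟨h, Q, H, fun x => ⟨x, 1, hpm x, ?_, ?_⟩⟩ <;>
      simp [rePart, imPart, htoC, hQd]
  · refine ⟨h, _, H, fun x => ⟨-x, -1, ?_, ?_, ?_⟩⟩
    · rw [planeMap_neg, ← hpm]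
      simp
    all_goals
      have hd : deriv (fun z => Q (-z)) (x : ℂ) = -deriv Q ((-x : ℝ) : ℂ) := by
        rw [deriv_comp_neg]
        simp
      simp only [rePart, imPart, htoC, hd, hQd]
      simp

end BoundaryParam

namespace IsNeumannEigenfunction

lemma collarEigenfunction {Q : ℂ → ℂ} {h : ℝ} (hφ : IsNeumannEigenfunction B lam φ)
    (H : Collar (planeEquiv '' Ω) B.len h Q)
    (hQ : ∀ x : ℝ, ∃ s ε : ℝ, planeMap Q (x, 0) = planeEquiv (B.q s) ∧
      rePart (deriv Q) (x, 0) = ε * B.qd s 0 ∧ imPart (deriv Q) (x, 0) = ε * B.qd s 1) :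
    CollarEigenfunction (planeEquiv '' Ω) Q lam (φ ∘ planeEquiv.symm) := by
  have hana : ∀ w ∈ closure (planeEquiv '' Ω), AnalyticAt ℝ (φ ∘ planeEquiv.symm) w := by
    intro w hw
    obtain ⟨U, -, hU, hφU⟩ := hφ.analytic
    rw [← planeEquiv.image_closure] at hw
    obtain ⟨x, hx, rfl⟩ := hw
    refine AnalyticAt.comp (hφU _ ?_) (planeEquiv.symm.analyticAt _)
    rw [planeEquiv.symm_apply_apply]
    exact hU hx
  refine ⟨hana, ?_, ?_, ?_⟩
  · rintro _ ⟨x, hx, rfl⟩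
    rw [lap_planeEquiv_symm]
    simpa using hφ.eigen x hx
  · intro x
    obtain ⟨s, ε, h1, h2, h3⟩ := hQ x
    rw [dy_comp_planeMap (H.analytic _ (by simpa using H.h_pos.le)).differentiableAt
      (hana _ (H.boundary x).1).differentiableAt, h1, h2, h3, dx_comp_planeEquiv_symm,
      dy_comp_planeEquiv_symm]
    simp only [Function.comp_apply, ContinuousLinearEquiv.symm_apply_apply]
    have h4 := B.inner_rotate_eq_zero s (hφ.neumann s)
    have hc : ∀ i : Fin 2, fderiv ℝ φ (B.q s) (EuclideanSpace.single i 1) =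
        gradient φ (B.q s) i := fun i => by
      rw [← inner_gradient_left, EuclideanSpace.inner_single_right]
      simp
    rw [hc, hc]
    linear_combination ε * h4
  · obtain ⟨x, hx, hx0⟩ := hφ.nontrivial
    exact ⟨_, mem_image_of_mem _ hx, by simpa using hx0⟩

end IsNeumannEigenfunction

end Plane

/-- The number of connected components of the nodal set of a Neumann eigenfunction whose
closure touches the boundary is at most `C·λ`. -/
theorem neumann_nodal_components_touching_boundary
    (Ω : Set E2) (hΩ : IsPlaneDomain Ω) (B : BoundaryParam Ω) (hB : B.IsAnalytic) :
    ∃ C > 0, ∀ lam : ℝ, 0 < lam → ∀ φ : E2 → ℝ, IsNeumannEigenfunction B lam φ →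
      ({K : Set E2 | ∃ x ∈ {x ∈ Ω | φ x = 0},
          K = connectedComponentIn {x ∈ Ω | φ x = 0} x ∧
            (closure K ∩ frontier Ω).Nonempty}).Finite ∧
      (({K : Set E2 | ∃ x ∈ {x ∈ Ω | φ x = 0},
          K = connectedComponentIn {x ∈ Ω | φ x = 0} x ∧
            (closure K ∩ frontier Ω).Nonempty}).ncard : ℝ) ≤ C * lam := by
  classical
  obtain ⟨h, Q, H, hQ⟩ := B.exists_collar hΩ hB
  obtain ⟨A, hA, hAb⟩ := H.exists_touchingComponents_bound
  refine ⟨A, hA, fun lam hlam φ hφ => ?_⟩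
  obtain ⟨hfin, hcard⟩ := hAb lam hlam _ (hφ.collarEigenfunction H hQ)
  have hN : planeEquiv '' {x ∈ Ω | φ x = 0} =
      {w | w ∈ planeEquiv '' Ω ∧ (φ ∘ planeEquiv.symm) w = 0} := by
    ext w
    constructor
    · rintro ⟨x, ⟨hx, hx0⟩, rfl⟩
      exact ⟨⟨x, hx, rfl⟩, by simpa using hx0⟩
    · rintro ⟨⟨x, hx, rfl⟩, hx0⟩
      exact ⟨x, ⟨hx, by simpa using hx0⟩, rfl⟩
  have hmaps : ∀ K ∈ {K : Set E2 | ∃ x ∈ {x ∈ Ω | φ x = 0},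
      K = connectedComponentIn {x ∈ Ω | φ x = 0} x ∧ (closure K ∩ frontier Ω).Nonempty},
      planeEquiv '' K ∈ touchingComponents (planeEquiv '' Ω) (φ ∘ planeEquiv.symm) := by
    rintro K ⟨x, hx, hK, hne⟩
    refine ⟨planeEquiv x, hN ▸ Set.mem_image_of_mem _ hx, ?_, ?_⟩
    · rw [hK, ← hN]
      exact planeEquiv.toHomeomorph.image_connectedComponentIn hx
    · have h1 := planeEquiv.toHomeomorph.image_closure K
      have h2 := planeEquiv.toHomeomorph.image_frontier Ω
      simp only [ContinuousLinearEquiv.coe_toHomeomorph] at h1 h2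
      rw [← h1, ← h2]
      exact (hne.image planeEquiv).mono (Set.image_inter_subset _ _ _)
  have hinj : Set.InjOn (fun K : Set E2 => planeEquiv '' K) {K : Set E2 | ∃ x ∈ {x ∈ Ω | φ x = 0},
      K = connectedComponentIn {x ∈ Ω | φ x = 0} x ∧ (closure K ∩ frontier Ω).Nonempty} :=
    fun K _ K' _ hKK' => planeEquiv.injective.image_injective hKK'
  exact ⟨Set.Finite.of_injOn hmaps hinj hfin,
    (Nat.cast_le.mpr (Set.ncard_le_ncard_of_injOn _ hmaps hinj hfin)).trans hcard⟩
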